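/- Let f and g be multicritical circle maps with the same irrational rotation number and the same number N of critical points, all of whose criticalities are at most d. Suppose h: S¹ → S¹ is a topological conjugacy between f and g (i.e., an orientation-preserving homeomorphism with h ∘ f = g ∘ h) which maps each critical point of f to a critical point of g. Then h is quasi-symmetric and its local quasi-symmetric distortion is universally bounded: there exists a constant K = K(N,d) > 1, independent of f and g, such that σ_h(x) ≤ K for all x ∈ S¹. -/

import Mathlib

open Set Filter Topology
open scoped ENNReal

noncomputable section

namespace MCircle

/-- A lift of an orientation-preserving `C³` circle homeomorphism of `S¹ = ℝ/ℤ`: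
a `C³`, strictly increasing map commuting with the unit translation. -/
structure IsCircleMapLift (f : ℝ → ℝ) : Prop where
  smooth : ContDiff ℝ 3 f
  mono : StrictMono f
  periodic : ∀ x : ℝ, f (x + 1) = f x + 1

/-- `c` is a non-flat (power-law) critical point of `f` of criticality `d > 1`:
near `c` we have `f x = f c + φ x * |φ x| ^ (d - 1)` for a `C³` diffeomorphism `φ`
of a neighbourhood `W` of `c` with `φ c = 0`. -/
def IsNonFlatCritPt (f : ℝ → ℝ) (c d : ℝ) : Prop :=
  1 < d ∧ ∃ (W : Set ℝ) (φ : ℝ → ℝ), IsOpen W ∧ c ∈ W ∧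
    ContDiffOn ℝ 3 φ W ∧ φ c = 0 ∧ (∀ x ∈ W, deriv φ x ≠ 0) ∧ InjOn φ W ∧
    ∀ x ∈ W, f x = f c + φ x * |φ x| ^ (d - 1)

/-- `f` is (a lift of) a multicritical circle map: the set of critical points of the
induced circle map, represented in `[0,1)`, is the nonempty finite set `C`, and each
critical point `c ∈ C` is non-flat of criticality `dc c`. -/
def IsMulticriticalLift (f : ℝ → ℝ) (C : Finset ℝ) (dc : ℝ → ℝ) : Prop :=
  IsCircleMapLift f ∧ C.Nonempty ∧ (↑C : Set ℝ) ⊆ Ico (0 : ℝ) 1 ∧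
    (∀ x : ℝ, deriv f x = 0 ↔ ∃ c ∈ C, ∃ k : ℤ, x = c + (k : ℝ)) ∧
    ∀ c ∈ C, IsNonFlatCritPt f c (dc c)

/-- The lift `f` has (translation) rotation number `ρ`. -/
def HasRotNumber (f : ℝ → ℝ) (ρ : ℝ) : Prop :=
  Tendsto (fun n : ℕ => f^[n] 0 / (n : ℝ)) atTop (𝓝 ρ)

/-- `f` is (a lift of) a multicritical circle map with critical set `C` (criticalities
`dc`) and irrational rotation number `ρ`, the lift being normalized so that `ρ ∈ (0,1)`. -/
def GoodMap (f : ℝ → ℝ) (C : Finset ℝ) (dc : ℝ → ℝ) (ρ : ℝ) : Prop :=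
  IsMulticriticalLift f C dc ∧ HasRotNumber f ρ ∧ Irrational ρ ∧ ρ ∈ Ioo (0 : ℝ) 1

/-- The Gauss map. -/
def gaussMap (x : ℝ) : ℝ := Int.fract x⁻¹

/-- The partial quotients `aₙ` of the continued fraction expansion
`ρ = [a₀, a₁, …] = 1/(a₀ + 1/(a₁ + ⋯))`. -/
def cfA (ρ : ℝ) (n : ℕ) : ℕ := ⌊(gaussMap^[n] (Int.fract ρ))⁻¹⌋₊

/-- The denominators `qₙ` of the convergents of `ρ` (the return times):
`q₀ = 1`, `q₁ = a₀`, `q_{n+2} = a_{n+1} q_{n+1} + qₙ`. -/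
def qden (ρ : ℝ) : ℕ → ℕ
  | 0 => 1
  | 1 => cfA ρ 0
  | n + 2 => cfA ρ (n + 1) * qden ρ (n + 1) + qden ρ n

/-- The numerators `pₙ` of the convergents of `ρ`:
`p₀ = 0`, `p₁ = 1`, `p_{n+2} = a_{n+1} p_{n+1} + pₙ`. -/
def pnum (ρ : ℝ) : ℕ → ℕ
  | 0 => 0
  | 1 => 1
  | n + 2 => cfA ρ (n + 1) * pnum ρ (n + 1) + pnum ρ n

/-- The lift representative of the `n`-th closest return `f^{qₙ}(x)`,
normalized (by the integer `pₙ`) to lie at distance less than one from `x`. -/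
def retPt (f : ℝ → ℝ) (ρ x : ℝ) (n : ℕ) : ℝ := f^[qden ρ n] x - (pnum ρ n : ℝ)

/-- The arc `Iₙ(x)`, with endpoints `x` and `f^{qₙ}(x)` and containing `f^{q_{n+2}}(x)`,
realized as an interval in the lift. -/
def arcI (f : ℝ → ℝ) (ρ x : ℝ) (n : ℕ) : Set ℝ := uIcc x (retPt f ρ x n)

/-- The length `|Iₙ(x)|`. -/
def arcLen (f : ℝ → ℝ) (ρ x : ℝ) (n : ℕ) : ℝ := |retPt f ρ x n - x|

/-- The length `|f^j(Iₙ(x))|`. -/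
def arcImgLen (f : ℝ → ℝ) (ρ x : ℝ) (n j : ℕ) : ℝ :=
  |f^[j] (retPt f ρ x n) - f^[j] x|

/-- Indices for the atoms of the `n`-th dynamical partition
`𝒫ₙ(x) = {fⁱ(Iₙ(x)) : 0 ≤ i ≤ q_{n+1}-1} ∪ {f^j(I_{n+1}(x)) : 0 ≤ j ≤ qₙ-1}`. -/
abbrev AtomIdx (ρ : ℝ) (n : ℕ) : Type :=
  {i : ℕ // i < qden ρ (n + 1)} ⊕ {j : ℕ // j < qden ρ n}

/-- Left endpoint (in the lift) of an atom of `𝒫ₙ(x)`. -/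
def atomL (f : ℝ → ℝ) (ρ x : ℝ) (n : ℕ) : AtomIdx ρ n → ℝ
  | Sum.inl i => min (f^[i.1] x) (f^[i.1] (retPt f ρ x n))
  | Sum.inr j => min (f^[j.1] x) (f^[j.1] (retPt f ρ x (n + 1)))

/-- Right endpoint (in the lift) of an atom of `𝒫ₙ(x)`. -/
def atomR (f : ℝ → ℝ) (ρ x : ℝ) (n : ℕ) : AtomIdx ρ n → ℝ
  | Sum.inl i => max (f^[i.1] x) (f^[i.1] (retPt f ρ x n))
  | Sum.inr j => max (f^[j.1] x) (f^[j.1] (retPt f ρ x (n + 1)))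

/-- Length of an atom of `𝒫ₙ(x)`. -/
def atomLen (f : ℝ → ℝ) (ρ x : ℝ) (n : ℕ) (A : AtomIdx ρ n) : ℝ :=
  atomR f ρ x n A - atomL f ρ x n A

/-- Two lift points represent the same point of the circle `ℝ/ℤ`. -/
def SameCirclePt (a b : ℝ) : Prop := ∃ m : ℤ, a = b + (m : ℝ)

/-- Two atoms of `𝒫ₙ(x)` are adjacent: they are distinct and share an endpoint
on the circle. -/
def AdjacentAtoms (f : ℝ → ℝ) (ρ x : ℝ) (n : ℕ) (A B : AtomIdx ρ n) : Prop :=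
  A ≠ B ∧ ∃ p ∈ ({atomL f ρ x n A, atomR f ρ x n A} : Set ℝ),
    ∃ q ∈ ({atomL f ρ x n B, atomR f ρ x n B} : Set ℝ), SameCirclePt p q

/-- `A` is the left neighbour of `Δ` in `𝒫ₙ(x)`. -/
def IsLeftNbr (f : ℝ → ℝ) (ρ x : ℝ) (n : ℕ) (A Δ : AtomIdx ρ n) : Prop :=
  A ≠ Δ ∧ SameCirclePt (atomR f ρ x n A) (atomL f ρ x n Δ)

/-- `B` is the right neighbour of `Δ` in `𝒫ₙ(x)`. -/
def IsRightNbr (f : ℝ → ℝ) (ρ x : ℝ) (n : ℕ) (B Δ : AtomIdx ρ n) : Prop :=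
  B ≠ Δ ∧ SameCirclePt (atomL f ρ x n B) (atomR f ρ x n Δ)

/-- The arc `f^j(Δ)` is contained (as a circle arc) in some element of `𝒫ₙ(x)`. -/
def ImgInAtom (f : ℝ → ℝ) (ρ x : ℝ) (n j : ℕ) (Δ : AtomIdx ρ n) : Prop :=
  ∃ E : AtomIdx ρ n, ∃ m : ℤ,
    atomL f ρ x n E + (m : ℝ) ≤ f^[j] (atomL f ρ x n Δ) ∧
    f^[j] (atomR f ρ x n Δ) ≤ atomR f ρ x n E + (m : ℝ)

/-- An atom of `𝒫ₙ(x)` as a subset of the circle `ℝ/ℤ`. -/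
def atomSetC (f : ℝ → ℝ) (ρ x : ℝ) (n : ℕ) (A : AtomIdx ρ n) : Set (AddCircle (1 : ℝ)) :=
  (fun y : ℝ => (y : AddCircle (1 : ℝ))) '' Icc (atomL f ρ x n A) (atomR f ρ x n A)

/-- The interval `Tₙ = I_{n+1} ∪ Iₙ ∪ f^{qₙ}(Iₙ)`, realized in the lift. -/
def Tset (f : ℝ → ℝ) (ρ x : ℝ) (n : ℕ) : Set ℝ :=
  arcI f ρ x (n + 1) ∪ arcI f ρ x n ∪
    (fun z => f^[qden ρ n] z - (pnum ρ n : ℝ)) '' arcI f ρ x n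

/-- `j` is a critical time: `f^j(Tₙ)` contains a critical point of `f` (mod 1). -/
def IsCritTime (f : ℝ → ℝ) (ρ x : ℝ) (C : Finset ℝ) (n j : ℕ) : Prop :=
  ∃ c ∈ C, ∃ m : ℤ, c + (m : ℝ) ∈ f^[j] '' Tset f ρ x n

/-- The cross-ratio `[M,T] = |L||R|/(|L∪M||M∪R|)` of the configuration
`M = [b,c] ⋐ T = [a,d]` (so `L = [a,b]`, `R = [c,d]`). -/
def crossRatio (a b c d : ℝ) : ℝ := ((b - a) * (d - c)) / ((c - a) * (d - b))

/-- The cross-ratio distortion `CrD(g; M, T)` of `g` on the configuration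
`M = [b,c] ⋐ T = [a,d]`. -/
def crD (g : ℝ → ℝ) (a b c d : ℝ) : ℝ :=
  crossRatio (g a) (g b) (g c) (g d) / crossRatio a b c d

/-- The Schwarzian derivative `Sg = g'''/g' - (3/2)(g''/g')²`. -/
def schwarzian (g : ℝ → ℝ) (x : ℝ) : ℝ :=
  iteratedDeriv 3 g x / deriv g x - (3 / 2) * (iteratedDeriv 2 g x / deriv g x) ^ 2

/-- `g` is a diffeomorphism on `S` with distortion bounded by `K`. -/
def DiffeoWithDistortionLE (g : ℝ → ℝ) (S : Set ℝ) (K : ℝ) : Prop :=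
  ContDiffOn ℝ 1 g S ∧ InjOn g S ∧ (∀ x ∈ S, deriv g x ≠ 0) ∧
    ∀ x ∈ S, ∀ y ∈ S, |deriv g x| ≤ K * |deriv g y|

/-- `g` is a diffeomorphism on `S` with negative Schwarzian derivative. -/
def NegSchwarzDiffeoOn (g : ℝ → ℝ) (S : Set ℝ) : Prop :=
  ContDiffOn ℝ 3 g S ∧ InjOn g S ∧ ∀ x ∈ S, deriv g x ≠ 0 ∧ schwarzian g x < 0

/-- The local quasi-symmetric distortion
`σ_h(x) = lim_{δ→0} limsup_{|t|≤δ} |h(x+t)-h(x)|/|h(x)-h(x-t)|` of a circle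
homeomorphism lift `h`, with values in `[0,∞]`. -/
def qsDistortion (h : ℝ → ℝ) (x : ℝ) : ℝ≥0∞ :=
  Filter.limsup
    (fun t : ℝ => ENNReal.ofReal (|h (x + t) - h x| / |h x - h (x - t)|))
    (𝓝[≠] (0 : ℝ))

end MCircle

open MCircle

namespace MCircle

/-- Two consecutive closest returns `(q, p)`, `(q', p')` of the rotation by `ρ`, the first one
moving points to the left and the second one to the right. -/
structure Lev (ρ : ℝ) (q : ℕ) (p : ℤ) (q' : ℕ) (p' : ℤ) : Prop where
  q_pos : 0 < q
  q_lt : q < q'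
  left_pos : (q : ℝ) * ρ < p
  right_pos : (p' : ℝ) < q' * ρ
  lt : q' * ρ - p' < p - (q : ℝ) * ρ
  best : ∀ k : ℕ, 0 < k → k < q' → ∀ b : ℤ, p - (q : ℝ) * ρ ≤ |k * ρ - b|

/-- A closest return of the rotation by `ρ`. -/
def IsReturn (ρ : ℝ) (v : ℕ × ℤ) : Prop :=
  0 < v.1 ∧ |v.1 * ρ - v.2| ≤ 1 / 2 ∧ ∀ k : ℕ, 0 < k → k < v.1 → ∀ b : ℤ,
    |v.1 * ρ - v.2| ≤ |k * ρ - b|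

/-- `w` is the closest return following `v`. -/
def IsNextReturn (ρ : ℝ) (v w : ℕ × ℤ) : Prop :=
  |w.1 * ρ - w.2| < |v.1 * ρ - v.2| ∧ ∀ k : ℕ, 0 < k → k < w.1 → ∀ b : ℤ,
    |v.1 * ρ - v.2| ≤ |k * ρ - b|

lemma nat_mul_sub_ne_zero {ρ : ℝ} (hρ : Irrational ρ) {k : ℕ} (hk : 0 < k) (b : ℤ) :
    (k : ℝ) * ρ - b ≠ 0 := by
  intro h
  have h1 : ρ = ((b / k : ℚ) : ℝ) := by
    have : (k : ℝ) ≠ 0 := by positivity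
    push_cast
    field_simp
    linarith
  exact hρ ⟨_, h1.symm⟩

lemma exists_nat_abs_lt {ρ ε : ℝ} (hε : 0 < ε) :
    ∃ k : ℕ, 0 < k ∧ ∃ b : ℤ, |k * ρ - b| < ε := by
  obtain ⟨n, hn⟩ := exists_nat_gt (1 / ε)
  have hn0 : 0 < n := by
    rcases Nat.eq_zero_or_pos n with h | h
    · subst h
      have : 0 < 1 / ε := by positivity
      simp at hn; linarith
    · exact h
  obtain ⟨k, hk, -, h⟩ := Real.exists_nat_abs_mul_sub_round_le ρ hn0
  refine ⟨k, hk, round (k * ρ), h.trans_lt ?_⟩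
  have : (0 : ℝ) < n := by exact_mod_cast hn0
  rw [div_lt_iff₀ (by positivity)]
  rw [div_lt_iff₀ hε] at hn
  nlinarith

lemma exists_nextReturn {ρ : ℝ} (hρ : Irrational ρ) {v : ℕ × ℤ} (hv : IsReturn ρ v) :
    ∃ w : ℕ × ℤ, IsReturn ρ w ∧ IsNextReturn ρ v w := by
  classical
  have hpos : 0 < |v.1 * ρ - v.2| := abs_pos.2 (nat_mul_sub_ne_zero hρ hv.1 _)
  have hex : ∃ k : ℕ, 0 < k ∧ ∃ b : ℤ, |k * ρ - b| < |v.1 * ρ - v.2| := exists_nat_abs_lt hpos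
  obtain ⟨h0, b, hb⟩ := Nat.find_spec hex
  have hmin : ∀ k : ℕ, 0 < k → k < Nat.find hex → ∀ b : ℤ,
      |v.1 * ρ - v.2| ≤ |k * ρ - b| := by
    intro k hk hlt b
    by_contra hcon
    exact Nat.find_min hex hlt ⟨hk, b, not_le.1 hcon⟩
  exact ⟨(Nat.find hex, b), ⟨h0, hb.le.trans hv.2.1,
    fun k hk hlt c => hb.le.trans (hmin k hk hlt c)⟩, hb, hmin⟩

lemma exists_first_return (ρ : ℝ) : ∃ v : ℕ × ℤ, IsReturn ρ v := by
  refine ⟨(1, round ρ), one_pos, ?_, fun k hk hlt => ?_⟩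
  · simpa using abs_sub_round ρ
  · simp only at hlt; omega

/-- A sequence of consecutive closest returns. -/
lemma exists_returns {ρ : ℝ} (hρ : Irrational ρ) :
    ∃ v : ℕ → ℕ × ℤ, (∀ n, IsReturn ρ (v n)) ∧ ∀ n, IsNextReturn ρ (v n) (v (n + 1)) := by
  obtain ⟨v0, h0⟩ := exists_first_return ρ
  choose! F hF using fun (v : ℕ × ℤ) (hv : IsReturn ρ v) => exists_nextReturn hρ hv
  have hr : ∀ n, IsReturn ρ (F^[n] v0) := by
    intro n
    induction n with
    | zero => exact h0
    | succ n ih => rw [Function.iterate_succ_apply']; exact (hF _ ih).1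
  refine ⟨fun n => F^[n] v0, hr, fun n => ?_⟩
  simp only [Function.iterate_succ_apply']
  exact (hF _ (hr n)).2

lemma IsNextReturn.fst_lt {ρ : ℝ} {v w : ℕ × ℤ} (hv : IsReturn ρ v) (hw : IsReturn ρ w)
    (h : IsNextReturn ρ v w) : v.1 < w.1 := by
  rcases lt_trichotomy v.1 w.1 with hlt | heq | hgt
  · exact hlt
  · exfalso
    have h1 := h.1
    rw [← heq] at h1
    have hne : v.2 ≠ w.2 := by
      intro e; rw [e] at h1; exact lt_irrefl _ h1
    have h2 : (1 : ℝ) ≤ |(v.2 : ℝ) - w.2| := by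
      have : (1 : ℤ) ≤ |v.2 - w.2| := Int.one_le_abs (sub_ne_zero.2 hne)
      exact_mod_cast this
    have h3 := hv.2.1
    have h4 : |(v.2 : ℝ) - w.2| ≤ |v.1 * ρ - v.2| + |v.1 * ρ - w.2| := by
      have : (v.2 : ℝ) - w.2 = (v.1 * ρ - w.2) - (v.1 * ρ - v.2) := by ring
      rw [this]
      exact (abs_sub _ _).trans (by linarith)
    linarith
  · exact absurd h.1 (not_lt.2 (hv.2.2 _ hw.1 hgt _))

lemma IsNextReturn.mul_neg {ρ : ℝ} (hρ : Irrational ρ) {v w : ℕ × ℤ} (hv : IsReturn ρ v)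
    (hw : IsReturn ρ w) (h : IsNextReturn ρ v w) :
    (v.1 * ρ - v.2) * (w.1 * ρ - w.2) < 0 := by
  have hlt := IsNextReturn.fst_lt hv hw h
  have hv0 := nat_mul_sub_ne_zero hρ hv.1 v.2
  have hw0 := nat_mul_sub_ne_zero hρ hw.1 w.2
  have hd := h.2 (w.1 - v.1) (by omega) (by have := hv.1; omega) (w.2 - v.2)
  rw [Nat.cast_sub hlt.le] at hd
  have h1 := h.1
  have e : ((w.1 : ℝ) - v.1) * ρ - ((w.2 - v.2 : ℤ) : ℝ)
      = (w.1 * ρ - w.2) - (v.1 * ρ - v.2) := by push_cast; ring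
  rw [e] at hd
  generalize (v.1 : ℝ) * ρ - v.2 = x at *
  generalize (w.1 : ℝ) * ρ - w.2 = y at *
  by_contra hcon
  push Not at hcon
  rcases lt_or_gt_of_ne hv0 with hx | hx <;> rcases lt_or_gt_of_ne hw0 with hy | hy
  · rw [abs_of_neg hx, abs_of_neg hy] at h1
    rw [abs_of_neg hx, abs_of_pos (by linarith)] at hd
    linarith
  · nlinarith
  · nlinarith
  · rw [abs_of_pos hx, abs_of_pos hy] at h1
    rw [abs_of_pos hx, abs_of_neg (by linarith)] at hd
    linarith

lemma IsNextReturn.lev {ρ : ℝ} (hρ : Irrational ρ) {v w : ℕ × ℤ} (hv : IsReturn ρ v)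
    (hw : IsReturn ρ w) (h : IsNextReturn ρ v w) (hs : v.1 * ρ - v.2 < 0) :
    Lev ρ v.1 v.2 w.1 w.2 := by
  have h1 := h.mul_neg hρ hv hw
  have hw0 : 0 < w.1 * ρ - w.2 := by
    by_contra hcon
    nlinarith
  have ha : |v.1 * ρ - v.2| = v.2 - v.1 * ρ := by rw [abs_of_neg hs]; ring
  have hb := h.1
  rw [ha, abs_of_pos hw0] at hb
  exact ⟨hv.1, IsNextReturn.fst_lt hv hw h, by linarith, by linarith, hb,
    fun k hk hlt b => ha ▸ h.2 k hk hlt b⟩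

lemma IsReturn.reflect {ρ : ℝ} {v : ℕ × ℤ} (hv : IsReturn ρ v) : IsReturn (-ρ) (v.1, -v.2) := by
  have key : ∀ (k : ℕ) (b : ℤ), |(k : ℝ) * (-ρ) - b| = |k * ρ - (-b : ℤ)| := by
    intro k b
    rw [← abs_neg]; congr 1; push_cast; ring
  refine ⟨hv.1, ?_, fun k hk hlt b => ?_⟩
  · simpa only [key, neg_neg] using hv.2.1
  · simpa only [key, neg_neg] using hv.2.2 k hk hlt (-b)

lemma IsNextReturn.reflect {ρ : ℝ} {v w : ℕ × ℤ} (h : IsNextReturn ρ v w) :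
    IsNextReturn (-ρ) (v.1, -v.2) (w.1, -w.2) := by
  have key : ∀ (k : ℕ) (b : ℤ), |(k : ℝ) * (-ρ) - b| = |k * ρ - (-b : ℤ)| := by
    intro k b
    rw [← abs_neg]; congr 1; push_cast; ring
  refine ⟨?_, fun k hk hlt b => ?_⟩
  · simpa only [key, neg_neg] using h.1
  · simpa only [key, neg_neg] using h.2 k hk hlt (-b)

/-- Distances add up along every other closest return. -/
lemma IsNextReturn.abs_add_le {ρ : ℝ} (hρ : Irrational ρ) {u v w : ℕ × ℤ} (hu : IsReturn ρ u)
    (hv : IsReturn ρ v) (hw : IsReturn ρ w) (h1 : IsNextReturn ρ u v) (h2 : IsNextReturn ρ v w) :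
    |v.1 * ρ - v.2| + |w.1 * ρ - w.2| ≤ |u.1 * ρ - u.2| := by
  have hlt : u.1 < w.1 :=
    (IsNextReturn.fst_lt hu hv h1).trans (IsNextReturn.fst_lt hv hw h2)
  have hd := h2.2 (w.1 - u.1) (by omega) (by have := hu.1; omega) (w.2 - u.2)
  rw [Nat.cast_sub hlt.le] at hd
  have e : ((w.1 : ℝ) - u.1) * ρ - ((w.2 - u.2 : ℤ) : ℝ)
      = (w.1 * ρ - w.2) - (u.1 * ρ - u.2) := by push_cast; ring
  rw [e] at hd
  have s1 := h1.mul_neg hρ hu hv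
  have s2 := h2.mul_neg hρ hv hw
  have a1 := h1.1
  have a2 := h2.1
  generalize (u.1 : ℝ) * ρ - u.2 = x at *
  generalize (v.1 : ℝ) * ρ - v.2 = y at *
  generalize (w.1 : ℝ) * ρ - w.2 = z at *
  have hxz : 0 < x * z := by
    by_contra hcon
    nlinarith [mul_pos_of_neg_of_neg s1 s2, sq_nonneg y]
  rcases lt_trichotomy x 0 with hx | hx | hx
  · have hz : z < 0 := by by_contra hcon; nlinarith
    rw [abs_of_neg hx] at *
    rw [abs_of_neg hz] at *
    have : |z - x| = z - x := abs_of_pos (by linarith)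
    linarith
  · simp [hx] at hxz
  · have hz : 0 < z := by by_contra hcon; nlinarith
    rw [abs_of_pos hx] at *
    rw [abs_of_pos hz] at *
    have : |z - x| = x - z := by rw [abs_of_neg (by linarith)]; ring
    linarith

end MCircle

namespace MCircle

/-- The complementary cross-ratio `|M||T|/(|L||R|)`. -/
def coRatio (a b c d : ℝ) : ℝ := ((c - b) * (d - a)) / ((b - a) * (d - c))

lemma crossRatio_eq {a b c d : ℝ} (h1 : a < b) (h2 : b < c) (h3 : c < d) :
    crossRatio a b c d = 1 / (1 + coRatio a b c d) := by
  unfold crossRatio coRatio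
  have e1 : b - a ≠ 0 := by linarith
  have e2 : d - c ≠ 0 := by linarith
  have e3 : c - a ≠ 0 := by linarith
  have e4 : d - b ≠ 0 := by linarith
  have e5 : 1 + (c - b) * (d - a) / ((b - a) * (d - c))
      = (c - a) * (d - b) / ((b - a) * (d - c)) := by
    field_simp; ring
  rw [e5, one_div_div]

lemma coRatio_pos {a b c d : ℝ} (h1 : a < b) (h2 : b < c) (h3 : c < d) :
    0 < coRatio a b c d := by
  unfold coRatio
  have e1 : 0 < b - a := by linarith
  have e2 : 0 < d - c := by linarith
  have e3 : 0 < c - b := by linarith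
  have e4 : 0 < d - a := by linarith
  positivity

lemma crossRatio_pos {a b c d : ℝ} (h1 : a < b) (h2 : b < c) (h3 : c < d) :
    0 < crossRatio a b c d := by
  rw [crossRatio_eq h1 h2 h3]
  have := coRatio_pos h1 h2 h3
  positivity

/-- Tangent line inequality for functions with antitone derivative. -/
lemma le_tangent_of_antitoneOn {g g' : ℝ → ℝ} {a d : ℝ}
    (hg : ∀ s ∈ Ioo a d, HasDerivAt g (g' s) s) (hanti : AntitoneOn g' (Ioo a d))
    {y s : ℝ} (hy : y ∈ Ioo a d) (hs : s ∈ Ioo a d) : g s ≤ g y + g' y * (s - y) := by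
  rcases lt_trichotomy y s with h | h | h
  · obtain ⟨ξ, hξ, he⟩ := exists_hasDerivAt_eq_slope g g' h
      (fun x hx => (hg x ⟨hy.1.trans_le hx.1, hx.2.trans_lt hs.2⟩).continuousAt.continuousWithinAt)
      (fun x hx => hg x ⟨hy.1.trans hx.1, hx.2.trans hs.2⟩)
    have h1 := hanti hy ⟨hy.1.trans hξ.1, hξ.2.trans hs.2⟩ hξ.1.le
    rw [he, div_le_iff₀ (by linarith)] at h1
    linarith
  · simp [h]
  · obtain ⟨ξ, hξ, he⟩ := exists_hasDerivAt_eq_slope g g' h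
      (fun x hx => (hg x ⟨hs.1.trans_le hx.1, hx.2.trans_lt hy.2⟩).continuousAt.continuousWithinAt)
      (fun x hx => hg x ⟨hs.1.trans hx.1, hx.2.trans hy.2⟩)
    have h1 := hanti ⟨hs.1.trans hξ.1, hξ.2.trans hy.2⟩ hy hξ.2.le
    rw [he, le_div_iff₀ (by linarith)] at h1
    linarith

lemma inv_sub_half_le_div {W w : ℝ → ℝ} {y d κ : ℝ} (hyd : y < d)
    (hc : ContinuousOn W (Icc y d)) (hW : ∀ s ∈ Ioo y d, HasDerivAt W (w s) s)
    (hw : 0 < w y) (hlt : W y < W d)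
    (hκ : ∀ s ∈ Ioo y d, w s ≤ w y * Real.exp (κ * (s - y))) :
    1 / (d - y) - κ / 2 ≤ w y / (W d - W y) := by
  have hr : 0 < d - y := by linarith
  by_cases hneg : 1 / (d - y) - κ / 2 ≤ 0
  · exact hneg.trans (by have : 0 < W d - W y := by linarith
                         positivity)
  push Not at hneg
  have hk : κ * (d - y) < 2 := by
    have : κ / 2 < 1 / (d - y) := by linarith
    rw [lt_div_iff₀ hr] at this
    linarith
  have hpos : ∀ s ∈ Icc y d, 0 < 1 - κ * (s - y) / 2 := by
    intro s hs
    rcases le_or_gt κ 0 with h | h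
    · nlinarith [hs.1]
    · nlinarith [hs.2]
  have hV : ∀ s ∈ Icc y d, HasDerivAt (fun s => w y * ((s - y) / (1 - κ * (s - y) / 2)))
      (w y * (1 / (1 - κ * (s - y) / 2) ^ 2)) s := by
    intro s hs
    have h0 := (hpos s hs).ne'
    have h1 : HasDerivAt (fun s : ℝ => s - y) 1 s := (hasDerivAt_id s).sub_const y
    have h2 : HasDerivAt (fun s : ℝ => 1 - κ * (s - y) / 2) (-(κ * 1 / 2)) s :=
      ((h1.const_mul κ).div_const 2).const_sub 1
    refine ((h1.div h2 h0).const_mul (w y)).congr_deriv ?_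
    congr 2
    ring
  have hmono : MonotoneOn (fun s => w y * ((s - y) / (1 - κ * (s - y) / 2)) - W s) (Icc y d) := by
    apply monotoneOn_of_hasDerivWithinAt_nonneg (convex_Icc y d)
      (f' := fun s => w y * (1 / (1 - κ * (s - y) / 2) ^ 2) - w s)
    · exact ContinuousOn.sub (fun s hs => (hV s hs).continuousAt.continuousWithinAt) hc
    · intro s hs
      rw [interior_Icc] at hs
      exact ((hV s (Ioo_subset_Icc_self hs)).sub (hW s hs)).hasDerivWithinAt
    · intro s hs
      rw [interior_Icc] at hs
      have hp := hpos s (Ioo_subset_Icc_self hs)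
      have h1 := hκ s hs
      have h2 : Real.exp (κ * (s - y)) ≤ 1 / (1 - κ * (s - y) / 2) ^ 2 := by
        rw [le_div_iff₀ (by positivity)]
        have h3 := Real.add_one_le_exp (-(κ * (s - y) / 2))
        have h4 : (1 - κ * (s - y) / 2) ^ 2 ≤ Real.exp (-(κ * (s - y) / 2)) ^ 2 :=
          pow_le_pow_left₀ hp.le (by linarith) 2
        have h5 : Real.exp (κ * (s - y)) * Real.exp (-(κ * (s - y) / 2)) ^ 2 = 1 := by
          rw [← Real.exp_nat_mul, ← Real.exp_add, Real.exp_eq_one_iff]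
          push_cast
          ring
        nlinarith [Real.exp_pos (κ * (s - y))]
      nlinarith
  have h1 := hmono (left_mem_Icc.2 hyd.le) (right_mem_Icc.2 hyd.le) hyd.le
  simp only [sub_self, mul_zero, zero_div, sub_zero] at h1
  have hp := hpos d (right_mem_Icc.2 hyd.le)
  rw [le_div_iff₀ (by linarith)]
  have e : (1 / (d - y) - κ / 2) * (w y * ((d - y) / (1 - κ * (d - y) / 2))) = w y := by
    have : 1 - κ * (d - y) / 2 ≠ 0 := hp.ne'
    have e1 : (1 / (d - y) - κ / 2) * (d - y) = 1 - κ * (d - y) / 2 := by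
      field_simp
    rw [mul_left_comm, ← mul_div_assoc, e1, div_self this, mul_one]
  have h2 : W d - W y ≤ w y * ((d - y) / (1 - κ * (d - y) / 2)) := by linarith
  calc _ ≤ (1 / (d - y) - κ / 2) * (w y * ((d - y) / (1 - κ * (d - y) / 2))) := by gcongr
    _ = w y := e

/-- Maps with log-concave derivative contract cross-ratios. -/
lemma crossRatio_le_of_logConcave {W w : ℝ → ℝ} {a b c d : ℝ} (h1 : a < b) (h2 : b < c)
    (h3 : c < d) (hc : ContinuousOn W (Icc a d)) (hW : ∀ s ∈ Ioo a d, HasDerivAt W (w s) s)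
    (hw : ∀ s ∈ Ioo a d, 0 < w s)
    (hκ : ∀ y ∈ Ioo a d, ∃ κ, ∀ s ∈ Ioo a d, w s ≤ w y * Real.exp (κ * (s - y))) :
    crossRatio (W a) (W b) (W c) (W d) ≤ crossRatio a b c d := by
  have hmonoW : StrictMonoOn W (Icc a d) := by
    apply strictMonoOn_of_deriv_pos (convex_Icc a d) hc
    intro s hs
    rw [interior_Icc] at hs
    rw [(hW s hs).deriv]
    exact hw s hs
  have key : ∀ y ∈ Ioo a d,
      1 / (y - a) + 1 / (d - y) ≤ w y / (W y - W a) + w y / (W d - W y) := by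
    intro y hy
    obtain ⟨κ, hk⟩ := hκ y hy
    have hR := inv_sub_half_le_div (W := W) (w := w) (κ := κ) hy.2
      (hc.mono (Icc_subset_Icc_left hy.1.le))
      (fun s hs => hW s ⟨hy.1.trans hs.1, hs.2⟩) (hw y hy)
      (hmonoW ⟨hy.1.le, hy.2.le⟩ ⟨(hy.1.trans hy.2).le, le_rfl⟩ hy.2)
      (fun s hs => hk s ⟨hy.1.trans hs.1, hs.2⟩)
    have hL := inv_sub_half_le_div (W := fun s => - W (-s)) (w := fun s => w (-s)) (κ := -κ)
      (y := -y) (d := -a) (by linarith [hy.1])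
      (by
        apply ContinuousOn.neg
        apply hc.comp continuous_neg.continuousOn
        intro s hs
        exact ⟨by linarith [hs.2], by linarith [hs.1, hy.2]⟩)
      (fun s hs => by
        have := (hW (-s) ⟨by linarith [hs.2], by linarith [hs.1, hy.2]⟩).comp s (hasDerivAt_neg s)
        refine this.neg.congr_deriv ?_
        ring)
      (by simpa using hw y hy)
      (by
        simp only [neg_neg, neg_lt_neg_iff]
        exact hmonoW ⟨le_rfl, (hy.1.trans hy.2).le⟩ ⟨hy.1.le, hy.2.le⟩ hy.1)
      (fun s hs => by
        have := hk (-s) ⟨by linarith [hs.2], by linarith [hs.1, hy.2]⟩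
        simp only [neg_neg]
        convert this using 3
        ring)
    simp only [neg_neg] at hL
    have e1 : -a - -y = y - a := by ring
    have e2 : - W a - -W y = W y - W a := by ring
    rw [e1, e2] at hL
    linarith
  have hmono : MonotoneOn (fun y => Real.log (W y - W a) - Real.log (W d - W y)
      - Real.log (y - a) + Real.log (d - y)) (Icc b c) := by
    have hd : ∀ y ∈ Ioo a d, HasDerivAt (fun y => Real.log (W y - W a) - Real.log (W d - W y)
        - Real.log (y - a) + Real.log (d - y))
        (w y / (W y - W a) - (- w y) / (W d - W y) - 1 / (y - a) + (-1) / (d - y)) y := by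
      intro y hy
      have p1 : W a < W y := hmonoW ⟨le_rfl, (hy.1.trans hy.2).le⟩ ⟨hy.1.le, hy.2.le⟩ hy.1
      have p2 : W y < W d := hmonoW ⟨hy.1.le, hy.2.le⟩ ⟨(hy.1.trans hy.2).le, le_rfl⟩ hy.2
      have d1 := ((hW y hy).sub_const (W a)).log (by linarith)
      have d2 := ((hW y hy).const_sub (W d)).log (by linarith)
      have d3 := ((hasDerivAt_id y).sub_const a).log (by simp only [id]; linarith [hy.1])
      have d4 := ((hasDerivAt_id y).const_sub d).log (by simp only [id]; linarith [hy.2])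
      exact ((d1.sub d2).sub d3).add d4
    have hsub : ∀ y ∈ Icc b c, y ∈ Ioo a d := fun y hy => ⟨h1.trans_le hy.1, hy.2.trans_lt h3⟩
    apply monotoneOn_of_hasDerivWithinAt_nonneg (convex_Icc b c)
      (fun y hy => (hd y (hsub y hy)).continuousAt.continuousWithinAt)
      (fun y hy => (hd y (hsub y (interior_subset hy))).hasDerivWithinAt)
    intro y hy
    have := key y (hsub y (interior_subset hy))
    simp only [neg_div]
    linarith
  have hfin := hmono (left_mem_Icc.2 h2.le) (right_mem_Icc.2 h2.le) h2.le
  simp only at hfin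
  have m1 : W a < W b := hmonoW ⟨le_rfl, by linarith⟩ ⟨h1.le, by linarith⟩ h1
  have m2 : W b < W c := hmonoW ⟨h1.le, by linarith⟩ ⟨by linarith, h3.le⟩ h2
  have m3 : W c < W d := hmonoW ⟨by linarith, h3.le⟩ ⟨by linarith, le_rfl⟩ h3
  unfold crossRatio
  rw [div_le_div_iff₀ (mul_pos (by linarith) (by linarith)) (mul_pos (by linarith) (by linarith)),
    ← Real.log_le_log_iff
      (mul_pos (mul_pos (by linarith) (by linarith)) (mul_pos (by linarith) (by linarith)))
      (mul_pos (mul_pos (by linarith) (by linarith)) (mul_pos (by linarith) (by linarith)))]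
  have z1 : W b - W a ≠ 0 := by linarith
  have z2 : W d - W c ≠ 0 := by linarith
  have z3 : W c - W a ≠ 0 := by linarith
  have z4 : W d - W b ≠ 0 := by linarith
  have z5 : b - a ≠ 0 := by linarith
  have z6 : d - c ≠ 0 := by linarith
  have z7 : c - a ≠ 0 := by linarith
  have z8 : d - b ≠ 0 := by linarith
  rw [Real.log_mul (mul_ne_zero z1 z2) (mul_ne_zero z7 z8), Real.log_mul z1 z2,
    Real.log_mul z7 z8, Real.log_mul (mul_ne_zero z5 z6) (mul_ne_zero z3 z4),
    Real.log_mul z5 z6, Real.log_mul z3 z4]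
  linarith

/-- The derivative of the logarithmic derivative of `f`, in terms of the first three
derivatives. -/
def logDD (f1 f2 f3 : ℝ → ℝ) (x : ℝ) : ℝ := f3 x / f1 x - (f2 x / f1 x) ^ 2

lemma exp_neg_mul_coRatio_le {f f1 f2 f3 : ℝ → ℝ} {A a b c d : ℝ} (hA : 0 ≤ A)
    (h1 : a < b) (h2 : b < c) (h3 : c < d)
    (d1 : ∀ x, HasDerivAt f (f1 x) x) (d2 : ∀ x, HasDerivAt f1 (f2 x) x)
    (d3 : ∀ x, HasDerivAt f2 (f3 x) x)
    (hpos : ∀ x ∈ Ioo a d, 0 < f1 x) (hdd : ∀ x ∈ Ioo a d, logDD f1 f2 f3 x ≤ A) :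
    Real.exp (-(A * (d - a) ^ 2)) * coRatio a b c d ≤ coRatio (f a) (f b) (f c) (f d) := by
  have had : a < d := by linarith
  set w : ℝ → ℝ := fun s => f1 s * Real.exp (-(A * (s - a) ^ 2 / 2)) with hw
  have hf1c : Continuous f1 := continuous_iff_continuousAt.2 fun x => (d2 x).continuousAt
  have hwc : Continuous w := by fun_prop
  set W : ℝ → ℝ := fun x => ∫ s in a..x, w s with hWdef
  have hW : ∀ x, HasDerivAt W (w x) x := fun x => hwc.integral_hasStrictDerivAt a x |>.hasDerivAt
  have hf : Continuous f := continuous_iff_continuousAt.2 fun x => (d1 x).continuousAt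
  have hWc : Continuous W := continuous_iff_continuousAt.2 fun x => (hW x).continuousAt
  have hwpos : ∀ s ∈ Ioo a d, 0 < w s := fun s hs => mul_pos (hpos s hs) (Real.exp_pos _)
  have hcr : crossRatio (W a) (W b) (W c) (W d) ≤ crossRatio a b c d := by
    refine crossRatio_le_of_logConcave h1 h2 h3 hWc.continuousOn (fun s _ => hW s) hwpos ?_
    intro y hy
    refine ⟨f2 y / f1 y - A * (y - a), fun s hs => ?_⟩
    have hg : ∀ s ∈ Ioo a d, HasDerivAt (fun s => Real.log (f1 s) - A * (s - a) ^ 2 / 2)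
        (f2 s / f1 s - A * (s - a)) s := by
      intro s hs
      have e1 := (d2 s).log (hpos s hs).ne'
      have e2 : HasDerivAt (fun s => A * (s - a) ^ 2 / 2) (A * (s - a)) s := by
        have := ((((hasDerivAt_id s).sub_const a).pow 2).const_mul A).div_const 2
        refine this.congr_deriv ?_
        simp only [id]
        ring
      exact e1.sub e2
    have hanti : AntitoneOn (fun s => f2 s / f1 s - A * (s - a)) (Ioo a d) := by
      have hd' : ∀ s ∈ Ioo a d, HasDerivAt (fun s => f2 s / f1 s - A * (s - a))
          (logDD f1 f2 f3 s - A) s := by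
        intro s hs
        have hne := (hpos s hs).ne'
        have e1 := (d3 s).div (d2 s) hne
        have e2 := ((hasDerivAt_id s).sub_const a).const_mul A
        refine (e1.sub e2).congr_deriv ?_
        simp only [logDD]
        field_simp
      apply antitoneOn_of_hasDerivWithinAt_nonpos (convex_Ioo a d)
        (fun s hs => (hd' s hs).continuousAt.continuousWithinAt)
        (fun s hs => (hd' s (interior_subset hs)).hasDerivWithinAt)
      intro s hs
      linarith [hdd s (interior_subset hs)]
    have ht := le_tangent_of_antitoneOn hg hanti hy hs
    have hws : ∀ s ∈ Ioo a d, w s = Real.exp (Real.log (f1 s) - A * (s - a) ^ 2 / 2) := by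
      intro s hs
      rw [sub_eq_add_neg, Real.exp_add, Real.exp_log (hpos s hs)]
    rw [hws s hs, hws y hy, ← Real.exp_add]
    exact Real.exp_le_exp.2 ht
  have hmW : ∀ u v, a ≤ u → u ≤ v → v ≤ d → Real.exp (-(A * (d - a) ^ 2 / 2)) * (f v - f u) ≤
      W v - W u ∧ W v - W u ≤ f v - f u := by
    intro u v hu huv hv
    constructor
    · have : MonotoneOn (fun s => W s - Real.exp (-(A * (d - a) ^ 2 / 2)) * f s) (Icc a d) := by
        apply monotoneOn_of_hasDerivWithinAt_nonneg (convex_Icc a d) (by fun_prop)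
          (fun s hs => ((hW s).sub ((d1 s).const_mul _)).hasDerivWithinAt)
        intro s hs
        rw [interior_Icc] at hs
        have : Real.exp (-(A * (d - a) ^ 2 / 2)) ≤ Real.exp (-(A * (s - a) ^ 2 / 2)) := by
          apply Real.exp_le_exp.2
          have : (s - a) ^ 2 ≤ (d - a) ^ 2 :=
            pow_le_pow_left₀ (by linarith [hs.1]) (by linarith [hs.2]) 2
          nlinarith
        simp only [hw]
        nlinarith [hpos s hs]
      have := this ⟨hu, by linarith⟩ ⟨by linarith, hv⟩ huv
      simp only at this
      linarith
    · have : MonotoneOn (fun s => f s - W s) (Icc a d) := by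
        apply monotoneOn_of_hasDerivWithinAt_nonneg (convex_Icc a d) (by fun_prop)
          (fun s hs => ((d1 s).sub (hW s)).hasDerivWithinAt)
        intro s hs
        rw [interior_Icc] at hs
        have : Real.exp (-(A * (s - a) ^ 2 / 2)) ≤ 1 := by
          rw [Real.exp_le_one_iff]
          have : 0 ≤ A * (s - a) ^ 2 / 2 := by positivity
          linarith
        simp only [hw]
        nlinarith [hpos s hs]
      have := this ⟨hu, by linarith⟩ ⟨by linarith, hv⟩ huv
      simp only at this
      linarith
  have hWm : StrictMonoOn W (Icc a d) := by
    apply strictMonoOn_of_deriv_pos (convex_Icc a d) hWc.continuousOn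
    intro s hs
    rw [interior_Icc] at hs
    rw [(hW s).deriv]
    exact hwpos s hs
  have m1 : W a < W b := hWm ⟨le_rfl, by linarith⟩ ⟨h1.le, by linarith⟩ h1
  have m2 : W b < W c := hWm ⟨h1.le, by linarith⟩ ⟨by linarith, h3.le⟩ h2
  have m3 : W c < W d := hWm ⟨by linarith, h3.le⟩ ⟨by linarith, le_rfl⟩ h3
  rw [crossRatio_eq m1 m2 m3, crossRatio_eq h1 h2 h3] at hcr
  have p1 := coRatio_pos m1 m2 m3
  have p2 := coRatio_pos h1 h2 h3
  have hco : coRatio a b c d ≤ coRatio (W a) (W b) (W c) (W d) := by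
    rw [one_div_le_one_div (by linarith) (by linarith)] at hcr
    linarith
  refine (mul_le_mul_of_nonneg_left hco (Real.exp_pos _).le).trans ?_
  have l1 := hmW a b le_rfl h1.le (by linarith)
  have l2 := hmW b c h1.le h2.le (by linarith)
  have l3 := hmW c d (by linarith) h3.le le_rfl
  have l4 := hmW a d le_rfl had.le le_rfl
  set ε := Real.exp (-(A * (d - a) ^ 2 / 2)) with hε
  have hε2 : Real.exp (-(A * (d - a) ^ 2)) = ε * ε := by
    rw [hε, ← Real.exp_add]; congr 1; ring
  have hεp : 0 < ε := Real.exp_pos _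
  rw [hε2]
  unfold coRatio
  rw [← mul_div_assoc, div_le_div_iff₀ (mul_pos (by linarith) (by linarith))
    (mul_pos (by linarith) (by linarith))]
  have q1 : 0 < W b - W a := by linarith
  have q2 : 0 < W c - W b := by linarith
  have q3 : 0 < W d - W c := by linarith
  have q4 : 0 < W d - W a := by linarith
  have r1 : 0 < f b - f a := by linarith
  have r3 : 0 < f d - f c := by linarith
  have r2 : 0 < f c - f b := by linarith
  have r4 : 0 < f d - f a := by linarith
  calc ε * ε * ((W c - W b) * (W d - W a)) * ((f b - f a) * (f d - f c))
      = ((W c - W b) * (W d - W a)) * ((ε * (f b - f a)) * (ε * (f d - f c))) := by ring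
    _ ≤ ((f c - f b) * (f d - f a)) * ((W b - W a) * (W d - W c)) := by
        exact mul_le_mul (mul_le_mul l2.2 l4.2 q4.le r2.le)
          (mul_le_mul l1.1 l3.1 (by positivity) q1.le) (by positivity) (by positivity)
    _ = _ := by ring

end MCircle

namespace MCircle

/-- Slopes over subintervals are at most `K` times the slope over the interval, for intervals of
length at most `ℓ`. -/
def SlopeBd (f : ℝ → ℝ) (K ℓ : ℝ) : Prop :=
  ∀ u s t v : ℝ, u ≤ s → s < t → t ≤ v → v - u ≤ ℓ →
    (f t - f s) * (v - u) ≤ K * (f v - f u) * (t - s)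

/-- The second derivative of `log f'`. -/
def logD2 (f : ℝ → ℝ) : ℝ → ℝ :=
  logDD (deriv f) (deriv (deriv f)) (deriv (deriv (deriv f)))

/-- A three times differentiable increasing map with `(log f')'' ≤ A` off the critical points. -/
structure Reg (f : ℝ → ℝ) (A : ℝ) : Prop where
  d1 : ∀ x, HasDerivAt f (deriv f x) x
  d2 : ∀ x, HasDerivAt (deriv f) (deriv (deriv f) x) x
  d3 : ∀ x, HasDerivAt (deriv (deriv f)) (deriv (deriv (deriv f)) x) x
  mono : StrictMono f
  nonneg : 0 ≤ A
  le : ∀ x, deriv f x ≠ 0 → logD2 f x ≤ A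

/-- There are no critical points in the open interval. -/
def CritFree (f : ℝ → ℝ) (a d : ℝ) : Prop := ∀ x ∈ Ioo a d, deriv f x ≠ 0

lemma Reg.deriv_nonneg {f : ℝ → ℝ} {A : ℝ} (h : Reg f A) (x : ℝ) : 0 ≤ deriv f x :=
  h.mono.monotone.deriv_nonneg

lemma Reg.coRatio_le {f : ℝ → ℝ} {A a b c d : ℝ} (h : Reg f A)
    (h1 : a < b) (h2 : b < c) (h3 : c < d) (hcf : CritFree f a d) :
    Real.exp (-(A * (d - a) ^ 2)) * coRatio a b c d ≤ coRatio (f a) (f b) (f c) (f d) :=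
  exp_neg_mul_coRatio_le h.nonneg h1 h2 h3 h.d1 h.d2 h.d3
    (fun x hx => (h.deriv_nonneg x).lt_of_ne (hcf x hx).symm) (fun x hx => h.le x (hcf x hx))

lemma Reg.crossRatio_le {f : ℝ → ℝ} {A a b c d : ℝ} (h : Reg f A)
    (h1 : a < b) (h2 : b < c) (h3 : c < d) (hcf : CritFree f a d) :
    crossRatio (f a) (f b) (f c) (f d) ≤ Real.exp (A * (d - a) ^ 2) * crossRatio a b c d := by
  have hco := h.coRatio_le h1 h2 h3 hcf
  rw [crossRatio_eq h1 h2 h3, crossRatio_eq (h.mono h1) (h.mono h2) (h.mono h3)]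
  have p1 := coRatio_pos h1 h2 h3
  have p2 := coRatio_pos (h.mono h1) (h.mono h2) (h.mono h3)
  rw [Real.exp_neg] at hco
  have hE : 1 ≤ Real.exp (A * (d - a) ^ 2) :=
    Real.one_le_exp (mul_nonneg h.nonneg (sq_nonneg _))
  rw [mul_one_div, div_le_div_iff₀ (by linarith) (by linarith)]
  rw [inv_mul_le_iff₀ (by linarith)] at hco
  nlinarith

lemma SlopeBd.crossRatio_le {f : ℝ → ℝ} {K ℓ a b c d : ℝ} (hf : StrictMono f)
    (h : SlopeBd f K ℓ) (hK : 0 ≤ K) (h1 : a < b) (h2 : b < c) (h3 : c < d) (hl : d - a ≤ ℓ) :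
    crossRatio (f a) (f b) (f c) (f d) ≤ K ^ 2 * crossRatio a b c d := by
  have e1 := h a a b c le_rfl h1 h2.le (by linarith)
  have e2 := h b c d d h2.le h3 le_rfl (by linarith)
  have m1 := hf h1
  have m2 := hf h2
  have m3 := hf h3
  unfold crossRatio
  rw [← mul_div_assoc, div_le_div_iff₀ (mul_pos (by linarith) (by linarith))
    (mul_pos (by linarith) (by linarith))]
  calc (f b - f a) * (f d - f c) * ((c - a) * (d - b))
      = ((f b - f a) * (c - a)) * ((f d - f c) * (d - b)) := by ring
    _ ≤ (K * (f c - f a) * (b - a)) * (K * (f d - f b) * (d - c)) :=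
        mul_le_mul e1 e2 (mul_nonneg (by linarith) (by linarith))
          (mul_nonneg (mul_nonneg hK (by linarith)) (by linarith))
    _ = _ := by ring

open Classical in
lemma Reg.crossRatio_iterate_le {f : ℝ → ℝ} {A K ℓ a b c d : ℝ} (h : Reg f A)
    (hs : SlopeBd f K ℓ) (hK : 1 ≤ K) (h1 : a < b) (h2 : b < c) (h3 : c < d) (m : ℕ)
    (hl : ∀ i < m, f^[i] d - f^[i] a ≤ ℓ) :
    crossRatio (f^[m] a) (f^[m] b) (f^[m] c) (f^[m] d) ≤
      K ^ (2 * ((Finset.range m).filter fun i => ¬ CritFree f (f^[i] a) (f^[i] d)).card) *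
      Real.exp (A * ∑ i ∈ Finset.range m, (f^[i] d - f^[i] a) ^ 2) * crossRatio a b c d := by
  induction m with
  | zero => simp
  | succ m ih =>
    have ih := ih fun i hi => hl i (by omega)
    have n1 := h.mono.iterate m h1
    have n2 := h.mono.iterate m h2
    have n3 := h.mono.iterate m h3
    simp only [Function.iterate_succ_apply']
    rw [Finset.sum_range_succ, Finset.range_add_one, Finset.filter_insert, mul_add, Real.exp_add]
    have hc0 := (crossRatio_pos h1 h2 h3).le
    set S := A * ∑ i ∈ Finset.range m, (f^[i] d - f^[i] a) ^ 2
    set F := (Finset.range m).filter fun i => ¬ CritFree f (f^[i] a) (f^[i] d) with hF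
    have hE : 1 ≤ Real.exp (A * (f^[m] d - f^[m] a) ^ 2) :=
      Real.one_le_exp (mul_nonneg h.nonneg (sq_nonneg _))
    by_cases hcf : CritFree f (f^[m] a) (f^[m] d)
    · rw [if_neg (not_not.2 hcf)]
      calc _ ≤ _ := h.crossRatio_le n1 n2 n3 hcf
        _ ≤ _ := mul_le_mul_of_nonneg_left ih (Real.exp_pos _).le
        _ = _ := by ring
    · rw [if_pos hcf, Finset.card_insert_of_notMem (by simp [hF])]
      calc _ ≤ _ := hs.crossRatio_le h.mono (by linarith) n1 n2 n3 (hl m (by omega))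
        _ ≤ _ := mul_le_mul_of_nonneg_left ih (by positivity)
        _ = K ^ (2 * (F.card + 1)) * Real.exp S * crossRatio a b c d * 1 := by ring
        _ ≤ K ^ (2 * (F.card + 1)) * Real.exp S * crossRatio a b c d
            * Real.exp (A * (f^[m] d - f^[m] a) ^ 2) :=
            mul_le_mul_of_nonneg_left hE (by positivity)
        _ = _ := by ring

lemma Reg.coRatio_iterate_le {f : ℝ → ℝ} {A a b c d : ℝ} (h : Reg f A)
    (h1 : a < b) (h2 : b < c) (h3 : c < d) (m : ℕ)
    (hcf : ∀ i < m, CritFree f (f^[i] a) (f^[i] d)) :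
    Real.exp (-(A * ∑ i ∈ Finset.range m, (f^[i] d - f^[i] a) ^ 2)) * coRatio a b c d ≤
      coRatio (f^[m] a) (f^[m] b) (f^[m] c) (f^[m] d) := by
  induction m with
  | zero => simp
  | succ m ih =>
    have ih := ih fun i hi => hcf i (by omega)
    have n1 := h.mono.iterate m h1
    have n2 := h.mono.iterate m h2
    have n3 := h.mono.iterate m h3
    simp only [Function.iterate_succ_apply']
    refine le_trans ?_ (h.coRatio_le n1 n2 n3 (hcf m (by omega)))
    refine le_trans ?_ (mul_le_mul_of_nonneg_left ih (Real.exp_pos _).le)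
    rw [← mul_assoc, ← Real.exp_add, Finset.sum_range_succ]
    apply le_of_eq
    congr 2
    ring

end MCircle

namespace MCircle

/-- An almost parabolic bridge: an increasing map `G` without fixed points on `[p, r]` such that
`(G')^(-1/2) = ψ` is convex, normalised in size. -/
structure Bridge (H τ : ℝ) (G ψ : ℝ → ℝ) (p r : ℝ) : Prop where
  one_le : 1 ≤ H
  τ_pos : 0 < τ
  τ_le : τ ≤ 1
  lt : p < r
  len : r - p ≤ 1
  deriv : ∀ y ∈ Icc p r, HasDerivAt G (1 / ψ y ^ 2) y
  convex : ConvexOn ℝ (Icc p r) ψ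
  lower : ∀ y ∈ Icc p r, 1 / H ≤ ψ y
  upper : ∀ y ∈ Icc p r, ψ y ≤ H
  pos : ∀ y ∈ Icc p r, 0 < G y - y
  le_one : ∀ y ∈ Icc p r, G y - y ≤ 1
  left : τ ≤ G p - p
  right : τ ≤ G r - r

namespace Bridge

variable {H τ p r : ℝ} {G ψ : ℝ → ℝ}

lemma hasDerivAt (h : Bridge H τ G ψ p r) {y : ℝ} (hy : y ∈ Icc p r) :
    HasDerivAt (fun y => G y - y) (1 / ψ y ^ 2 - 1) y :=
  (h.deriv y hy).sub (hasDerivAt_id y)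

lemma ψ_pos (h : Bridge H τ G ψ p r) {y : ℝ} (hy : y ∈ Icc p r) : 0 < ψ y :=
  lt_of_lt_of_le (by have := h.one_le; positivity) (h.lower y hy)

lemma slope_le (h : Bridge H τ G ψ p r) {y : ℝ} (hy : y ∈ Icc p r) : 1 / ψ y ^ 2 ≤ H ^ 2 := by
  have h0 := h.ψ_pos hy
  have h1 := h.lower y hy
  have hH := h.one_le
  rw [div_le_iff₀ (by linarith)] at h1
  rw [div_le_iff₀ (by positivity)]
  nlinarith [mul_pos h0 (by linarith : (0 : ℝ) < H)]

lemma le_slope (h : Bridge H τ G ψ p r) {y : ℝ} (hy : y ∈ Icc p r) :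
    1 / H ^ 2 ≤ 1 / ψ y ^ 2 :=
  one_div_le_one_div_of_le (by have := h.ψ_pos hy; positivity)
    (pow_le_pow_left₀ (h.ψ_pos hy).le (h.upper y hy) 2)

lemma abs_slope_le (h : Bridge H τ G ψ p r) {y : ℝ} (hy : y ∈ Icc p r) :
    |1 / ψ y ^ 2 - 1| ≤ H ^ 2 := by
  have h1 := h.slope_le hy
  have h2 : 0 < 1 / ψ y ^ 2 := by have := h.ψ_pos hy; positivity
  have := h.one_le
  rw [abs_le]; constructor <;> nlinarith

lemma exists_slope (h : Bridge H τ G ψ p r) {s t : ℝ} (hs : p ≤ s) (hst : s < t) (ht : t ≤ r) :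
    ∃ ξ ∈ Ioo s t, (G t - t) - (G s - s) = (1 / ψ ξ ^ 2 - 1) * (t - s) := by
  obtain ⟨ξ, hξ, he⟩ := exists_hasDerivAt_eq_slope (fun y => G y - y) (fun y => 1 / ψ y ^ 2 - 1) hst
    (fun x hx => (h.hasDerivAt ⟨hs.trans hx.1, hx.2.trans ht⟩).continuousAt.continuousWithinAt)
    (fun x hx => h.hasDerivAt ⟨hs.trans hx.1.le, hx.2.le.trans ht⟩)
  refine ⟨ξ, hξ, ?_⟩
  rw [he]
  have : t - s ≠ 0 := by linarith
  field_simp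

lemma lipschitz_middle (h : Bridge H τ G ψ p r) {δ s t : ℝ} (hδ : 0 < δ) (hs : p + δ ≤ s)
    (hst : s ≤ t) (ht : t ≤ r - δ) :
    |1 / ψ t ^ 2 - 1 / ψ s ^ 2| ≤ 2 * H ^ 6 / δ * (t - s) := by
  rcases hst.eq_or_lt with rfl | hst
  · simp
  have hH := h.one_le
  have ms : s ∈ Icc p r := ⟨by linarith, by linarith⟩
  have mt : t ∈ Icc p r := ⟨by linarith, by linarith⟩
  have mp : p ∈ Icc p r := ⟨le_rfl, h.lt.le⟩
  have mr : r ∈ Icc p r := ⟨h.lt.le, le_rfl⟩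
  have a1 := h.convex.slope_mono_adjacent ms mr hst (by linarith : t < r)
  have a2 := h.convex.slope_mono_adjacent mp mt (by linarith : p < s) hst
  have hHδ : ∀ x : ℝ, δ ≤ x → H / x ≤ H / δ := fun x hx =>
    div_le_div_of_nonneg_left (by linarith) hδ hx
  have b1 : (ψ r - ψ t) / (r - t) ≤ H / δ := by
    refine le_trans ?_ (hHδ (r - t) (by linarith))
    have := h.upper r mr
    have := h.ψ_pos mt
    gcongr
    · linarith
    · linarith
  have b2 : -(H / δ) ≤ (ψ s - ψ p) / (s - p) := by
    have : (ψ p - ψ s) / (s - p) ≤ H / δ := by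
      refine le_trans ?_ (hHδ (s - p) (by linarith))
      have := h.upper p mp
      have := h.ψ_pos ms
      gcongr
      · linarith
      · linarith
    have e : (ψ s - ψ p) / (s - p) = -((ψ p - ψ s) / (s - p)) := by rw [← neg_div]; ring
    rw [e]; linarith
  have hts : 0 < t - s := by linarith
  have c1 : ψ t - ψ s ≤ H / δ * (t - s) := by
    rw [← div_le_iff₀ hts]; exact a1.trans b1
  have c2 : -(H / δ * (t - s)) ≤ ψ t - ψ s := by
    have := b2.trans a2
    rw [le_div_iff₀ hts] at this
    linarith
  have ps := h.ψ_pos ms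
  have pt := h.ψ_pos mt
  have e : 1 / ψ t ^ 2 - 1 / ψ s ^ 2
      = -(ψ t - ψ s) * ((ψ s + ψ t) * ((1 / ψ t ^ 2) * (1 / ψ s ^ 2))) := by
    field_simp; ring
  rw [e, abs_mul, abs_neg]
  have d1 : |ψ t - ψ s| ≤ H / δ * (t - s) := abs_le.2 ⟨c2, c1⟩
  have d2 : |(ψ s + ψ t) * ((1 / ψ t ^ 2) * (1 / ψ s ^ 2))| ≤ (H + H) * (H ^ 2 * H ^ 2) := by
    rw [abs_of_pos (by positivity)]
    have := h.upper s ms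
    have := h.upper t mt
    have := h.slope_le ms
    have := h.slope_le mt
    gcongr
  calc _ ≤ (H / δ * (t - s)) * ((H + H) * (H ^ 2 * H ^ 2)) :=
        mul_le_mul d1 d2 (abs_nonneg _) (by positivity)
    _ = _ := by field_simp; ring

/-- A Landau type inequality for the displacement. -/
lemma sq_slope_le (h : Bridge H τ G ψ p r) {y : ℝ} (hy : y ∈ Icc p r) :
    (1 / ψ y ^ 2 - 1) ^ 2 ≤ (32 * H ^ 8 / τ + 2 * H ^ 4 / τ) * (G y - y) := by
  have hH := h.one_le
  have hτ := h.τ_pos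
  have hD := h.pos y hy
  have hs := h.abs_slope_le hy
  have hH2 : 1 ≤ H ^ 2 := one_le_pow₀ hH
  set δ := τ / (4 * H ^ 2) with hδ
  have hδ0 : 0 < δ := by positivity
  have hδτ : H ^ 2 * (2 * δ) = τ / 2 := by rw [hδ]; field_simp; ring
  have far : τ / 2 ≤ G y - y →
      (1 / ψ y ^ 2 - 1) ^ 2 ≤ (32 * H ^ 8 / τ + 2 * H ^ 4 / τ) * (G y - y) := by
    intro hfar
    have h1 : (1 / ψ y ^ 2 - 1) ^ 2 ≤ (H ^ 2) ^ 2 := by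
      rw [← sq_abs]; exact pow_le_pow_left₀ (abs_nonneg _) hs 2
    have h2 : (H ^ 2) ^ 2 = 2 * H ^ 4 / τ * (τ / 2) := by field_simp
    have h3 : 2 * H ^ 4 / τ * (τ / 2) ≤ 2 * H ^ 4 / τ * (G y - y) := by gcongr
    have h4 : 0 ≤ 32 * H ^ 8 / τ * (G y - y) := by positivity
    linarith
  rcases lt_or_ge y (p + 2 * δ) with hl | hl
  · apply far
    rcases hy.1.eq_or_lt with rfl | hpy
    · linarith [h.left]
    · obtain ⟨ξ, hξ, he⟩ := h.exists_slope le_rfl hpy hy.2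
      have h1 := (abs_le.1 (h.abs_slope_le ⟨hξ.1.le, hξ.2.le.trans hy.2⟩)).1
      have h2 : -(H ^ 2 * (2 * δ)) ≤ (1 / ψ ξ ^ 2 - 1) * (y - p) := by
        nlinarith [mul_nonneg (by linarith : 0 ≤ 1 / ψ ξ ^ 2 - 1 + H ^ 2)
          (by linarith : 0 ≤ y - p)]
      linarith [h.left]
  rcases lt_or_ge (r - 2 * δ) y with hr | hr
  · apply far
    rcases hy.2.eq_or_lt with rfl | hpy
    · linarith [h.right]
    · obtain ⟨ξ, hξ, he⟩ := h.exists_slope hy.1 hpy le_rfl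
      have h1 := (abs_le.1 (h.abs_slope_le ⟨hy.1.trans hξ.1.le, hξ.2.le⟩)).2
      have h2 : (1 / ψ ξ ^ 2 - 1) * (r - y) ≤ H ^ 2 * (2 * δ) := by
        nlinarith [mul_nonneg (by linarith : 0 ≤ H ^ 2 - (1 / ψ ξ ^ 2 - 1))
          (by linarith : 0 ≤ r - y)]
      linarith [h.right]
  set B := 2 * H ^ 6 / δ with hB
  have hB0 : 0 < B := by positivity
  have hB4 : 4 * B = 32 * H ^ 8 / τ := by rw [hB, hδ]; field_simp; ring
  have hBδ : H ^ 2 ≤ 2 * B * δ := by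
    have : 2 * B * δ = 4 * H ^ 6 := by rw [hB]; field_simp; ring
    rw [this]
    nlinarith [pow_le_pow_right₀ hH (by norm_num : 2 ≤ 6), pow_nonneg (by linarith : 0 ≤ H) 6]
  set s := 1 / ψ y ^ 2 - 1 with hsdef
  have main : s ^ 2 ≤ 4 * B * (G y - y) := by
    rcases lt_trichotomy s 0 with hneg | h0 | hpos
    · set t := -s / (2 * B) with ht
      have ht0 : 0 < t := div_pos (by linarith) (by positivity)
      have htδ : t ≤ δ := by
        rw [ht, div_le_iff₀ (by positivity)]
        rw [abs_of_neg hneg] at hs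
        linarith
      obtain ⟨ξ, hξ, he⟩ := h.exists_slope hy.1 (by linarith : y < y + t) (by linarith)
      have h1 := (abs_le.1 (h.lipschitz_middle hδ0 (by linarith : p + δ ≤ y) hξ.1.le
        (by linarith [hξ.2]))).2
      have h2 : 1 / ψ ξ ^ 2 - 1 ≤ s + B * t := by
        have : B * (ξ - y) ≤ B * t := by
          apply mul_le_mul_of_nonneg_left _ hB0.le
          linarith [hξ.2]
        linarith
      have h3 := h.pos (y + t) ⟨by linarith, by linarith⟩
      have h4 : (1 / ψ ξ ^ 2 - 1) * t ≤ (s + B * t) * t := mul_le_mul_of_nonneg_right h2 ht0.le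
      have h5 : (s + B * t) * t = -(s ^ 2 / (4 * B)) := by rw [ht]; field_simp; ring
      have h6 : s ^ 2 / (4 * B) ≤ G y - y := by
        simp only [add_sub_cancel_left] at he
        linarith
      rwa [div_le_iff₀ (by positivity), mul_comm] at h6
    · rw [h0]; simp; positivity
    · set t := s / (2 * B) with ht
      have ht0 : 0 < t := div_pos (by linarith) (by positivity)
      have htδ : t ≤ δ := by
        rw [ht, div_le_iff₀ (by positivity)]
        rw [abs_of_pos hpos] at hs
        linarith
      obtain ⟨ξ, hξ, he⟩ := h.exists_slope (by linarith) (by linarith : y - t < y) hy.2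
      have h1 := (abs_le.1 (h.lipschitz_middle hδ0 (by linarith [hξ.1] : p + δ ≤ ξ) hξ.2.le
        (by linarith))).2
      have h2 : s - B * t ≤ 1 / ψ ξ ^ 2 - 1 := by
        have : B * (y - ξ) ≤ B * t := by
          apply mul_le_mul_of_nonneg_left _ hB0.le
          linarith [hξ.1]
        linarith
      have h3 := h.pos (y - t) ⟨by linarith, by linarith⟩
      have h4 : (s - B * t) * t ≤ (1 / ψ ξ ^ 2 - 1) * t := mul_le_mul_of_nonneg_right h2 ht0.le
      have h5 : (s - B * t) * t = s ^ 2 / (4 * B) := by rw [ht]; field_simp; ring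
      have h6 : s ^ 2 / (4 * B) ≤ G y - y := by
        have : y - (y - t) = t := by ring
        rw [this] at he
        linarith
      rwa [div_le_iff₀ (by positivity), mul_comm] at h6
  have h4 : 0 ≤ 2 * H ^ 4 / τ * (G y - y) := by positivity
  rw [hB4] at main
  linarith

/-- The Lipschitz constant of the square root of the displacement. -/
def lip (H τ : ℝ) : ℝ := √(32 * H ^ 8 / τ + 2 * H ^ 4 / τ)

lemma abs_sqrt_sub_le (h : Bridge H τ G ψ p r) {y t : ℝ} (hy : y ∈ Icc p r) (ht : t ∈ Icc p r) :
    |√(G t - t) - √(G y - y)| ≤ lip H τ * |t - y| := by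
  have := Convex.norm_image_sub_le_of_norm_hasDerivWithin_le (f := fun y => √(G y - y))
    (f' := fun y => (1 / ψ y ^ 2 - 1) / (2 * √(G y - y))) (C := lip H τ) (s := Icc p r)
    (fun x hx => ((h.hasDerivAt hx).sqrt (h.pos x hx).ne').hasDerivWithinAt) ?_
    (convex_Icc p r) hy ht
  · simpa using this
  · intro x hx
    have hD := h.pos x hx
    have hsq := Real.sqrt_pos.2 hD
    have h1 : |1 / ψ x ^ 2 - 1| ≤ lip H τ * √(G x - x) := by
      rw [lip, ← Real.sqrt_mul' _ hD.le]
      exact Real.abs_le_sqrt (h.sq_slope_le hx)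
    rw [Real.norm_eq_abs, abs_div, abs_of_pos (by positivity : 0 < 2 * √(G x - x)),
      div_le_iff₀ (by positivity)]
    have : 0 ≤ lip H τ := Real.sqrt_nonneg _
    nlinarith [mul_nonneg this hsq.le]

end Bridge

end MCircle

namespace MCircle

namespace Bridge

variable {H τ p r : ℝ} {G ψ : ℝ → ℝ}

/-- Near its minimum the displacement of a bridge grows at least quadratically. -/
lemma quadratic (h : Bridge H τ G ψ p r) {z : ℝ} (hz : z ∈ Icc p r)
    (hmin : ∀ y ∈ Icc p r, G z - z ≤ G y - y) (hsmall : G z - z ≤ τ / 4)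
    {y : ℝ} (hy : y ∈ Icc p r) : (G z - z) + τ / 24 * (y - z) ^ 2 ≤ G y - y := by
  have hτ := h.τ_pos
  have hτ1 := h.τ_le
  have hlen := h.len
  have hpz : p < z := by
    rcases hz.1.eq_or_lt with rfl | h1
    · linarith [h.left]
    · exact h1
  have hzr : z < r := by
    rcases hz.2.eq_or_lt with rfl | h1
    · linarith [h.right]
    · exact h1
  have hψz : ψ z = 1 := by
    have hloc : IsLocalMin (fun y => G y - y) z := by
      filter_upwards [Icc_mem_nhds hpz hzr] with y hy using hmin y hy
    have h0 := hloc.hasDerivAt_eq_zero (h.hasDerivAt hz)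
    have hp := h.ψ_pos hz
    have : ψ z ^ 2 = 1 := by
      field_simp at h0
      linarith
    nlinarith
  have small : ∀ u, z ≤ u → u < r → G u - u ≤ τ / 2 → ∃ t ∈ Ioo u r, ψ t ≤ 1 - τ / 6 := by
    intro u hzu hur hu
    obtain ⟨t, ht, he⟩ := h.exists_slope (hz.1.trans hzu) hur le_rfl
    refine ⟨t, ht, ?_⟩
    have mt : t ∈ Icc p r := ⟨by linarith [ht.1], ht.2.le⟩
    have hr := h.right
    have h1 : τ / 2 ≤ (1 / ψ t ^ 2 - 1) * (r - u) := by linarith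
    have h2 : τ / 2 ≤ 1 / ψ t ^ 2 - 1 := by
      by_contra hc
      push Not at hc
      have : (1 / ψ t ^ 2 - 1) * (r - u) < τ / 2 := by
        rcases le_or_gt 0 (1 / ψ t ^ 2 - 1) with h3 | h3 <;> nlinarith
      linarith
    have hp := h.ψ_pos mt
    have h3 : (1 + τ / 2) * ψ t ^ 2 ≤ 1 := by
      have : 1 + τ / 2 ≤ 1 / ψ t ^ 2 := by linarith
      rwa [le_div_iff₀ (by positivity)] at this
    by_contra hc
    push Not at hc
    have h4 : (1 - τ / 6) ^ 2 < ψ t ^ 2 := by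
      apply pow_lt_pow_left₀ hc (by linarith) (by norm_num)
    have h5 : 1 ≤ (1 + τ / 2) * (1 - τ / 6) ^ 2 := by
      nlinarith [mul_nonneg hτ.le (by linarith : 0 ≤ 1 - τ), pow_nonneg hτ.le 3]
    nlinarith
  rcases le_total z y with hzy | hyz
  · rcases lt_or_ge (τ / 2) (G y - y) with hbig | hle
    · have : (y - z) ^ 2 ≤ 1 := by
        have : y - z ≤ 1 := by linarith [hy.2]
        nlinarith
      nlinarith
    have hyr : y < r := by
      rcases hy.2.eq_or_lt with rfl | h1
      · linarith [h.right]
      · exact h1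
    obtain ⟨t, ht, hψt⟩ := small y hzy hyr hle
    have mt : t ∈ Icc p r := ⟨by linarith [ht.1], ht.2.le⟩
    have hup : ∀ s ∈ Ioo z y, ψ s ≤ 1 - τ / 6 * (s - z) := by
      intro s hs
      have hst : s < t := hs.2.trans ht.1
      have hsl := h.convex.slope_mono_adjacent hz mt hs.1 hst
      rw [div_le_div_iff₀ (by linarith [hs.1]) (by linarith), hψz] at hsl
      have ht1 : t - z ≤ 1 := by linarith [ht.2]
      have hsz : 0 < s - z := by linarith [hs.1]
      have : (ψ s - 1) * (t - z) ≤ -(τ / 6) * (s - z) := by nlinarith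
      by_contra hc
      push Not at hc
      have h7 : -(τ / 6 * (s - z)) * (t - z) < (ψ s - 1) * (t - z) :=
        mul_lt_mul_of_pos_right (by linarith) (by linarith)
      nlinarith [mul_nonneg (mul_nonneg hτ.le hsz.le) (by linarith : 0 ≤ 1 - (t - z))]
    have hmono : MonotoneOn (fun s => (G s - s) - τ / 6 * (s - z) ^ 2) (Icc z y) := by
      have hd : ∀ s ∈ Icc z y, HasDerivAt (fun s => (G s - s) - τ / 6 * (s - z) ^ 2)
          ((1 / ψ s ^ 2 - 1) - τ / 6 * (2 * (s - z))) s := by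
        intro s hs
        have h1 := h.hasDerivAt (y := s) ⟨by linarith [hs.1], by linarith [hs.2]⟩
        have h2 := (((hasDerivAt_id s).sub_const z).pow 2).const_mul (τ / 6)
        refine (h1.sub h2).congr_deriv ?_
        simp
      apply monotoneOn_of_deriv_nonneg (convex_Icc _ _)
      · exact fun s hs => (hd s hs).continuousAt.continuousWithinAt
      · intro s hs
        rw [interior_Icc] at hs
        exact (hd s ⟨hs.1.le, hs.2.le⟩).differentiableAt.differentiableWithinAt
      · intro s hs
        rw [interior_Icc] at hs
        rw [(hd s ⟨hs.1.le, hs.2.le⟩).deriv]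
        have hu := hup s hs
        have hp := h.ψ_pos (y := s) ⟨by linarith [hs.1], by linarith [hs.2]⟩
        set v := τ / 6 * (s - z) with hv
        have hv0 : 0 ≤ v := by
          have : 0 < s - z := by linarith [hs.1]
          positivity
        have h1 : (1 + 2 * v) * ψ s ^ 2 ≤ 1 := by
          have h2 : ψ s ^ 2 ≤ (1 - v) ^ 2 := pow_le_pow_left₀ hp.le hu 2
          nlinarith [mul_le_mul_of_nonneg_left h2 (by linarith : 0 ≤ 1 + 2 * v), pow_nonneg hv0 2,
            pow_nonneg hv0 3, mul_nonneg (pow_nonneg hv0 2) (by linarith : 0 ≤ 1 - v)]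
        have h2 : 1 + 2 * v ≤ 1 / ψ s ^ 2 := by rwa [le_div_iff₀ (by positivity)]
        have : τ / 6 * (2 * (s - z)) = 2 * v := by rw [hv]; ring
        linarith
    have := hmono ⟨le_rfl, hzy⟩ ⟨hzy, le_rfl⟩ hzy
    simp only [sub_self] at this
    nlinarith [sq_nonneg (y - z)]
  · obtain ⟨t, ht, hψt⟩ := small z le_rfl hzr (by linarith)
    have mt : t ∈ Icc p r := ⟨by linarith [ht.1], ht.2.le⟩
    have hlo : ∀ s ∈ Ioo y z, 1 + τ / 6 * (z - s) ≤ ψ s := by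
      intro s hs
      have hsl := h.convex.slope_mono_adjacent (x := s)
        ⟨by linarith [hs.1, hy.1], by linarith [hs.2]⟩
        mt hs.2 ht.1
      rw [div_le_div_iff₀ (by linarith [hs.2]) (by linarith [ht.1]), hψz] at hsl
      have ht1 : t - z ≤ 1 := by linarith [ht.2]
      have hsz : 0 < z - s := by linarith [hs.2]
      have htz : 0 < t - z := by linarith [ht.1]
      have h6 : (1 - ψ s) * (t - z) ≤ -(τ / 6) * (z - s) := by nlinarith
      by_contra hc
      push Not at hc
      have h7 : -(τ / 6 * (z - s)) * (t - z) < (1 - ψ s) * (t - z) :=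
        mul_lt_mul_of_pos_right (by linarith) htz
      nlinarith [mul_nonneg (mul_nonneg hτ.le hsz.le) (by linarith : 0 ≤ 1 - (t - z))]
    have hanti : AntitoneOn (fun s => (G s - s) - τ / 24 * (s - z) ^ 2) (Icc y z) := by
      have hd : ∀ s ∈ Icc y z, HasDerivAt (fun s => (G s - s) - τ / 24 * (s - z) ^ 2)
          ((1 / ψ s ^ 2 - 1) - τ / 24 * (2 * (s - z))) s := by
        intro s hs
        have h1 := h.hasDerivAt (y := s) ⟨by linarith [hs.1, hy.1], by linarith [hs.2]⟩
        have h2 := (((hasDerivAt_id s).sub_const z).pow 2).const_mul (τ / 24)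
        refine (h1.sub h2).congr_deriv ?_
        simp
      apply antitoneOn_of_deriv_nonpos (convex_Icc _ _)
      · exact fun s hs => (hd s hs).continuousAt.continuousWithinAt
      · intro s hs
        rw [interior_Icc] at hs
        exact (hd s ⟨hs.1.le, hs.2.le⟩).differentiableAt.differentiableWithinAt
      · intro s hs
        rw [interior_Icc] at hs
        rw [(hd s ⟨hs.1.le, hs.2.le⟩).deriv]
        have hu := hlo s hs
        have hp := h.ψ_pos (y := s) ⟨by linarith [hs.1, hy.1], by linarith [hs.2]⟩
        set v := τ / 6 * (z - s) with hv
        have hsz : 0 < z - s := by linarith [hs.2]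
        have hv0 : 0 < v := by positivity
        have hv1 : v ≤ 1 / 6 := by
          have : z - s ≤ 1 := by linarith [hs.1, hy.1]
          nlinarith
        have h1 : 1 ≤ (1 - v / 2) * ψ s ^ 2 := by
          have h2 : (1 + v) ^ 2 ≤ ψ s ^ 2 := pow_le_pow_left₀ (by linarith) hu 2
          have h3 : 1 ≤ (1 - v / 2) * (1 + v) ^ 2 := by
            nlinarith [mul_pos hv0 hv0, mul_pos hv0 (mul_pos hv0 hv0)]
          linarith [mul_le_mul_of_nonneg_left h2 (by linarith : 0 ≤ 1 - v / 2)]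
        have h2 : 1 / ψ s ^ 2 ≤ 1 - v / 2 := by rwa [div_le_iff₀ (by positivity)]
        have : τ / 24 * (2 * (s - z)) = - v / 2 := by rw [hv]; ring
        linarith
    have := hanti ⟨le_rfl, hyz⟩ ⟨hyz, le_rfl⟩ hyz
    simp only [sub_self] at this
    nlinarith [sq_nonneg (y - z)]

/-- The orbit of `G` crossing the bridge. -/
structure Crossing (G : ℝ → ℝ) (p r : ℝ) (x : ℕ → ℝ) (m : ℕ) : Prop where
  zero : x 0 = p
  last : x m = r
  step : ∀ k < m, x (k + 1) = G (x k)
  mem : ∀ k ≤ m, x k ∈ Icc p r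

lemma le_mul_next (h : Bridge H τ G ψ p r) {x : ℕ → ℝ} {m : ℕ} (hx : Crossing G p r x m)
    {k : ℕ} (hk : k < m) : G (x k) - x k ≤ H ^ 2 * (G (x (k + 1)) - x (k + 1)) := by
  have h1 := hx.mem k hk.le
  have h2 := hx.mem (k + 1) hk
  have h3 := h.pos _ h1
  have h4 := hx.step k hk
  obtain ⟨ξ, hξ, he⟩ := h.exists_slope h1.1 (by linarith : x k < x (k + 1)) h2.2
  have h5 := h.le_slope (y := ξ) ⟨by linarith [hξ.1, h1.1], by linarith [hξ.2, h2.2]⟩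
  have h6 : G (x (k + 1)) - x (k + 1) = 1 / ψ ξ ^ 2 * (G (x k) - x k) := by
    have : x (k + 1) - x k = G (x k) - x k := by rw [h4]
    rw [this] at he
    linarith
  have hH := h.one_le
  have h7 := mul_le_mul_of_nonneg_right h5 h3.le
  rw [← h6] at h7
  calc G (x k) - x k = H ^ 2 * (1 / H ^ 2 * (G (x k) - x k)) := by field_simp
    _ ≤ _ := by gcongr

lemma inv_sqrt_step (h : Bridge H τ G ψ p r) {x : ℕ → ℝ} {m : ℕ} (hx : Crossing G p r x m)
    {k : ℕ} (hk : k < m) :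
    |(√(G (x (k + 1)) - x (k + 1)))⁻¹ - (√(G (x k) - x k))⁻¹| ≤ lip H τ * H := by
  have h1 := hx.mem k hk.le
  have h2 := hx.mem (k + 1) hk
  have h3 := h.pos _ h1
  have h4 := h.pos _ h2
  have hl := h.abs_sqrt_sub_le h1 h2
  have hn := h.le_mul_next hx hk
  have hH := h.one_le
  have hb : 0 ≤ lip H τ := Real.sqrt_nonneg _
  have hst : |x (k + 1) - x k| = G (x k) - x k := by
    rw [hx.step k hk, abs_of_pos h3]
  rw [hst] at hl
  set u := √(G (x k) - x k) with hu
  set v := √(G (x (k + 1)) - x (k + 1)) with hv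
  have hu0 : 0 < u := Real.sqrt_pos.2 h3
  have hv0 : 0 < v := Real.sqrt_pos.2 h4
  have huu : G (x k) - x k = u * u := (Real.mul_self_sqrt h3.le).symm
  have huv : u ≤ H * v := by
    rw [hu, hv]
    apply Real.sqrt_le_left (by positivity) |>.2
    rw [mul_pow, Real.sq_sqrt h4.le]
    exact hn
  have e : v⁻¹ - u⁻¹ = -(v - u) / (u * v) := by field_simp; ring
  rw [e, abs_div, abs_neg, abs_of_pos (mul_pos hu0 hv0), div_le_iff₀ (by positivity)]
  rw [huu] at hl
  calc |v - u| ≤ lip H τ * (u * u) := hl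
    _ ≤ lip H τ * (u * (H * v)) := by gcongr
    _ = _ := by ring

lemma inv_sqrt_le (h : Bridge H τ G ψ p r) {x : ℕ → ℝ} {m : ℕ} (hx : Crossing G p r x m)
    {k : ℕ} (hk : k ≤ m) :
    (√(G (x k) - x k))⁻¹ ≤ ((√τ)⁻¹ + lip H τ * H) * min (k + 1 : ℝ) (m - k + 1 : ℝ) := by
  have hH := h.one_le
  have hb : 0 ≤ lip H τ * H := mul_nonneg (Real.sqrt_nonneg _) (by linarith)
  have hτ := h.τ_pos
  have hsτ := Real.sqrt_pos.2 hτ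
  have hup : ∀ k ≤ m, (√(G (x k) - x k))⁻¹ ≤ (√τ)⁻¹ + k * (lip H τ * H) := by
    intro k
    induction k with
    | zero =>
      intro _
      rw [hx.zero]
      have : √τ ≤ √(G p - p) := Real.sqrt_le_sqrt h.left
      simpa using inv_anti₀ hsτ this
    | succ k ih =>
      intro hk
      have h1 := ih (by omega)
      have h2 := (abs_le.1 (h.inv_sqrt_step hx (k := k) (by omega))).2
      push_cast
      linarith
  have hdn : ∀ j ≤ m, (√(G (x (m - j)) - x (m - j)))⁻¹ ≤ (√τ)⁻¹ + j * (lip H τ * H) := by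
    intro j
    induction j with
    | zero =>
      intro _
      rw [Nat.sub_zero, hx.last]
      have : √τ ≤ √(G r - r) := Real.sqrt_le_sqrt h.right
      simpa using inv_anti₀ hsτ this
    | succ j ih =>
      intro hj
      have h1 := ih (by omega)
      have h2 := (abs_le.1 (h.inv_sqrt_step hx (k := m - (j + 1)) (by omega))).1
      have : m - (j + 1) + 1 = m - j := by omega
      rw [this] at h2
      push_cast
      linarith
  have hi : 0 < (√τ)⁻¹ := by positivity
  have h1 := hup k hk
  have h2 := hdn (m - k) (by omega)
  rw [show m - (m - k) = k by omega, Nat.cast_sub hk] at h2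
  have hkm : (k : ℝ) ≤ m := by exact_mod_cast hk
  have hk0 : (0 : ℝ) ≤ k := by positivity
  rcases min_choice (k + 1 : ℝ) (m - k + 1 : ℝ) with h3 | h3 <;> rw [h3] <;> nlinarith

lemma sqrt_mul_le (h : Bridge H τ G ψ p r) {x : ℕ → ℝ} {m : ℕ} (hx : Crossing G p r x m)
    {z : ℝ} (hz : z ∈ Icc p r)
    (hmin : ∀ y ∈ Icc p r, G z - z ≤ G y - y) (hsmall : G z - z ≤ τ / 4)
    {k : ℕ} (hk : k ≤ m) : √(G (x k) - x k) * min (k + 1 : ℝ) (m - k + 1 : ℝ) ≤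
      (1 + lip H τ) * (√(48 / τ) * (√(48 / τ) + 1)) := by
  have hτ := h.τ_pos
  have hτ1 := h.τ_le
  have hb : 0 ≤ lip H τ := Real.sqrt_nonneg _
  set a := √(48 / τ) with ha
  have ha1 : 1 ≤ a := by
    rw [ha, Real.one_le_sqrt, le_div_iff₀ hτ]; linarith
  have ha2 : a ^ 2 = 48 / τ := Real.sq_sqrt (by positivity)
  have hε := h.pos z hz
  set e := √(G z - z) with he
  have he0 : 0 < e := Real.sqrt_pos.2 hε
  have he2 : e ^ 2 = G z - z := Real.sq_sqrt hε.le
  have he1 : e ≤ 1 := by nlinarith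
  -- comparison of the two scales
  have hcomp : ∀ k ≤ m, e + |x k - z| ≤ a * √(G (x k) - x k) := by
    intro k hk
    have h1 := h.quadratic hz hmin hsmall (hx.mem k hk)
    have h2 := h.pos _ (hx.mem k hk)
    apply le_of_sq_le_sq _ (by positivity)
    rw [mul_pow, Real.sq_sqrt h2.le, ha2]
    have h3 : (e + |x k - z|) ^ 2 ≤ 2 * (e ^ 2 + (x k - z) ^ 2) := by
      rw [← sq_abs (x k - z)]
      nlinarith [sq_nonneg (e - |x k - z|)]
    refine h3.trans ?_
    rw [div_mul_eq_mul_div, le_div_iff₀ hτ, he2]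
    nlinarith
  have hsq : ∀ k ≤ m, 0 < √(G (x k) - x k) ∧ √(G (x k) - x k) ≤ 1 ∧
      √(G (x k) - x k) ^ 2 = G (x k) - x k := by
    intro k hk
    have h1 := hx.mem k hk
    refine ⟨Real.sqrt_pos.2 (h.pos _ h1), ?_, Real.sq_sqrt (h.pos _ h1).le⟩
    exact Real.sqrt_le_one.2 (h.le_one _ h1)
  have hκ0 : ∀ k ≤ m, 1 / (a * (a + 1)) ≤ 1 / (e + |x k - z|) := by
    intro k hk
    apply one_div_le_one_div_of_le (by positivity)
    have h1 : |x k - z| ≤ 1 := by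
      have := hx.mem k hk
      rw [abs_le]; constructor <;> linarith [h.len, this.1, this.2, hz.1, hz.2]
    nlinarith
  have hleft : ∀ k ≤ m, x k ≤ z → (k + 1 : ℝ) / (a * (a + 1)) ≤ 1 / (e + |x k - z|) := by
    intro k
    induction k with
    | zero => intro hk _; simpa using hκ0 0 hk
    | succ k ih =>
      intro hk hkz
      have h1 := hsq k (by omega)
      have hst := hx.step k (by omega)
      have hpos := h.pos _ (hx.mem k (by omega))
      have hxz : x k ≤ z := by linarith
      have h2 := ih (by omega) hxz
      have h3 := hcomp k (by omega)
      rw [abs_of_nonpos (by linarith)] at h2 h3 ⊢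
      set s := √(G (x k) - x k)
      have h4 : -(x (k + 1) - z) = -(x k - z) - s ^ 2 := by rw [h1.2.2, hst]; ring
      have h5 : 1 / (a * (a + 1)) ≤ 1 / (e + -(x (k + 1) - z)) - 1 / (e + -(x k - z)) := by
        have w0 : 0 < e + -(x (k + 1) - z) := by linarith
        rw [div_sub_div _ _ (by linarith) (by linarith), div_le_div_iff₀ (by positivity)
          (mul_pos w0 (by linarith))]
        have w1 : e + -(x (k + 1) - z) ≤ a * s := by
          rw [h4]; nlinarith [sq_nonneg s]
        have w2 : (e + -(x (k + 1) - z)) * (e + -(x k - z)) ≤ (a * s) * (a * s) :=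
          mul_le_mul w1 h3 (by linarith) (by have := h1.1; positivity)
        rw [h4] at w2 ⊢
        nlinarith [mul_pos h1.1 h1.1, mul_nonneg (by linarith : (0 : ℝ) ≤ a) (sq_nonneg s)]
      have : ((k + 1 : ℕ) + 1 : ℝ) / (a * (a + 1)) =
          (k + 1) / (a * (a + 1)) + 1 / (a * (a + 1)) := by
        push_cast; ring
      rw [this]; linarith
  have hright : ∀ j ≤ m, z ≤ x (m - j) →
      (j + 1 : ℝ) / (a * (a + 1)) ≤ 1 / (e + |x (m - j) - z|) := by
    intro j
    induction j with
    | zero => intro hk _; simpa using hκ0 m le_rfl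
    | succ j ih =>
      intro hk hkz
      have hkm : m - (j + 1) + 1 = m - j := by omega
      have h1 := hsq (m - (j + 1)) (by omega)
      have hst := hx.step (m - (j + 1)) (by omega)
      have hpos := h.pos _ (hx.mem (m - (j + 1)) (by omega))
      rw [hkm] at hst
      have hxz : z ≤ x (m - j) := by linarith
      have h2 := ih (by omega) hxz
      have h3 := hcomp (m - (j + 1)) (by omega)
      rw [abs_of_nonneg (by linarith)] at h2 h3 ⊢
      set y := x (m - (j + 1))
      set s := √(G y - y)
      have h4 : x (m - j) - z = (y - z) + s ^ 2 := by rw [h1.2.2, hst]; ring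
      have h5 : 1 / (a * (a + 1)) ≤ 1 / (e + (y - z)) - 1 / (e + (x (m - j) - z)) := by
        have w0 : 0 < e + (x (m - j) - z) := by linarith
        rw [div_sub_div _ _ (by linarith) (by linarith), div_le_div_iff₀ (by positivity)
          (mul_pos (by linarith) w0)]
        have w1 : e + (x (m - j) - z) ≤ (a + 1) * s := by
          rw [h4]; nlinarith [h1.1, h1.2.1]
        have w2 : (e + (y - z)) * (e + (x (m - j) - z)) ≤ (a * s) * ((a + 1) * s) :=
          mul_le_mul h3 w1 (by linarith) (by have := h1.1; positivity)
        rw [h4] at w2 ⊢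
        nlinarith
      have : ((j + 1 : ℕ) + 1 : ℝ) / (a * (a + 1)) =
          (j + 1) / (a * (a + 1)) + 1 / (a * (a + 1)) := by
        push_cast; ring
      rw [this]; linarith
  have hkey : min (k + 1 : ℝ) (m - k + 1 : ℝ) / (a * (a + 1)) ≤ 1 / (e + |x k - z|) := by
    rcases le_total (x k) z with h1 | h1
    · refine le_trans ?_ (hleft k hk h1)
      gcongr
      exact min_le_left _ _
    · have h2 := hright (m - k) (by omega)
      rw [show m - (m - k) = k by omega, Nat.cast_sub hk] at h2
      refine le_trans ?_ (h2 h1)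
      gcongr
      exact min_le_right _ _
  have hs : √(G (x k) - x k) ≤ (1 + lip H τ) * (e + |x k - z|) := by
    have h1 := (abs_le.1 (h.abs_sqrt_sub_le hz (hx.mem k hk))).2
    nlinarith [abs_nonneg (x k - z), mul_nonneg hb he0.le]
  have hw : 0 < e + |x k - z| := by positivity
  rw [div_le_div_iff₀ (by positivity) hw] at hkey
  have hm0 : 0 ≤ min (k + 1 : ℝ) (m - k + 1 : ℝ) := by
    have hkm : (k : ℝ) ≤ m := by exact_mod_cast hk
    apply le_min <;> [positivity; linarith]
  calc _ ≤ (1 + lip H τ) * (e + |x k - z|) * min (k + 1 : ℝ) (m - k + 1 : ℝ) := by gcongr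
    _ = (1 + lip H τ) * (min (k + 1 : ℝ) (m - k + 1 : ℝ) * (e + |x k - z|)) := by ring
    _ ≤ (1 + lip H τ) * (1 * (a * (a + 1))) := by gcongr
    _ = _ := by ring

end Bridge

/-- Passing through an almost parabolic bridge: the size of the `k`-th step is comparable to
the inverse square of the combinatorial distance to the ends. -/
theorem exists_bridge_bound (H τ : ℝ) : ∃ M, 1 ≤ M ∧ ∀ (G ψ : ℝ → ℝ) (p r : ℝ),
    Bridge H τ G ψ p r → ∀ (x : ℕ → ℝ) (m : ℕ), Bridge.Crossing G p r x m → ∀ k ≤ m,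
      1 ≤ M * ((G (x k) - x k) * min (k + 1 : ℝ) (m - k + 1 : ℝ) ^ 2) ∧
      (G (x k) - x k) * min (k + 1 : ℝ) (m - k + 1 : ℝ) ^ 2 ≤ M := by
  set M₁ := ((√τ)⁻¹ + Bridge.lip H τ * H) ^ 2
  set M₂ := ((1 + Bridge.lip H τ) * (√(48 / τ) * (√(48 / τ) + 1))) ^ 2
  set M₃ := (4 / τ + 1) ^ 2
  have hM₁ : 0 ≤ M₁ := sq_nonneg _
  have hM₂ : 0 ≤ M₂ := sq_nonneg _
  have hM₃ : 0 ≤ M₃ := sq_nonneg _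
  refine ⟨1 + M₁ + M₂ + M₃, by linarith, ?_⟩
  intro G ψ p r h x m hx k hk
  have hτ := h.τ_pos
  have hD := h.pos _ (hx.mem k hk)
  have hs := Real.sqrt_pos.2 hD
  have hsq := Real.sq_sqrt hD.le
  have hkm : (k : ℝ) ≤ m := by exact_mod_cast hk
  have hk0 : (0 : ℝ) ≤ k := by positivity
  have hmin0 : 1 ≤ min (k + 1 : ℝ) (m - k + 1 : ℝ) := by apply le_min <;> linarith
  constructor
  · have h1 := h.inv_sqrt_le hx hk
    have h2 := pow_le_pow_left₀ (by positivity) h1 2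
    rw [inv_pow, hsq, mul_pow, inv_le_iff_one_le_mul₀ hD] at h2
    refine h2.trans ?_
    rw [mul_comm _ (G (x k) - x k), ← mul_assoc, mul_comm _ M₁, mul_assoc]
    apply mul_le_mul_of_nonneg_right (by linarith) (by positivity)
  · obtain ⟨z, hz, hmin⟩ := isCompact_Icc.exists_isMinOn (nonempty_Icc.2 h.lt.le)
      (f := fun y => G y - y)
      (fun y hy => (h.hasDerivAt hy).continuousAt.continuousWithinAt)
    rcases le_or_gt (G z - z) (τ / 4) with h1 | h1
    · have h2 := h.sqrt_mul_le hx hz hmin h1 hk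
      have h3 := pow_le_pow_left₀ (by positivity) h2 2
      rw [mul_pow, hsq] at h3
      linarith
    · have h2 : ∀ j : ℕ, j ≤ m → x 0 + j * (τ / 4) ≤ x j := by
        intro j
        induction j with
        | zero => simp
        | succ j ih =>
          intro hj
          have h3 := ih (by omega)
          have h4 := hmin (hx.mem j (by omega))
          have h5 := hx.step j (by omega)
          simp only [mem_ofPred_eq] at h4
          push_cast
          linarith
      have h3 := h2 m le_rfl
      rw [hx.zero, hx.last] at h3
      have h4 : (m : ℝ) ≤ 4 / τ := by
        rw [le_div_iff₀ hτ]
        linarith [h.len]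
      have h5 : min (k + 1 : ℝ) (m - k + 1 : ℝ) ≤ 4 / τ + 1 := (min_le_left _ _).trans (by linarith)
      have h6 : min (k + 1 : ℝ) (m - k + 1 : ℝ) ^ 2 ≤ M₃ := pow_le_pow_left₀ (by linarith) h5 2
      have h7 := h.le_one _ (hx.mem k hk)
      nlinarith [sq_nonneg (min (k + 1 : ℝ) (m - k + 1 : ℝ))]

end MCircle

namespace MCircle

lemma IsNonFlatCritPt.translate {f : ℝ → ℝ} {c e k : ℝ} (h : IsNonFlatCritPt f c e)
    (hf : ∀ x, f (x + k) = f x + k) : IsNonFlatCritPt f (c + k) e := by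
  obtain ⟨he, W, φ, hW, hc, hs, h0, hd, hi, hx⟩ := h
  refine ⟨he, (fun x => x - k) ⁻¹' W, fun x => φ (x - k),
    hW.preimage (continuous_sub_right k), by simpa using hc,
    hs.comp (contDiff_id.sub contDiff_const).contDiffOn fun x hx => hx,
    by simpa using h0, ?_, ?_, ?_⟩
  · intro x hx
    rw [deriv_comp_sub_const]
    exact hd _ hx
  · intro x hx y hy hxy
    have := hi hx hy hxy
    linarith
  · intro x hx'
    have := hx _ hx'
    rw [hf c, ← sub_add_cancel x k, hf, this]
    simp only [sub_add_cancel]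
    ring

lemma IsNonFlatCritPt.reflect {f : ℝ → ℝ} {c e : ℝ} (h : IsNonFlatCritPt f c e) :
    IsNonFlatCritPt (fun x => -f (-x)) (-c) e := by
  obtain ⟨he, W, φ, hW, hc, hs, h0, hd, hi, hx⟩ := h
  refine ⟨he, (fun x => -x) ⁻¹' W, fun x => -φ (-x), hW.preimage continuous_neg, by simpa using hc,
    (hs.comp contDiff_neg.contDiffOn fun x hx => hx).neg, by simpa using h0, ?_, ?_, ?_⟩
  · intro x hx
    rw [deriv.fun_neg, deriv_comp_neg, neg_neg]
    exact hd _ hx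
  · intro x hx y hy hxy
    exact neg_injective (hi hx hy (neg_injective hxy))
  · intro x hx'
    have := hx _ hx'
    simp only [neg_neg, abs_neg]
    rw [this]
    ring

/-- A lift `f` of a multicritical circle map with at most `N` critical points, of criticalities
at most `d`, and irrational rotation number `ρ`. -/
structure Sys (f : ℝ → ℝ) (N : ℕ) (d ρ : ℝ) : Prop where
  smooth : ContDiff ℝ 3 f
  mono : StrictMono f
  periodic : ∀ x, f (x + 1) = f x + 1
  irr : Irrational ρ
  lt_iter : ∀ (n : ℕ) (m : ℤ) (x : ℝ), (m : ℝ) < n * ρ → x + m < f^[n] x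
  iter_lt : ∀ (n : ℕ) (m : ℤ) (x : ℝ), (n : ℝ) * ρ < m → f^[n] x < x + m
  crit : ∃ C : Finset ℝ, C.Nonempty ∧ C.card ≤ N ∧
    ∀ x, deriv f x = 0 ↔ ∃ c ∈ C, ∃ k : ℤ, x = c + k
  nonflat : ∀ x, deriv f x = 0 → ∃ e ≤ d, IsNonFlatCritPt f x e

lemma add_int_of_add_one {f : ℝ → ℝ} (hf : ∀ x, f (x + 1) = f x + 1) (x : ℝ) (k : ℤ) :
    f (x + k) = f x + k := by
  induction k using Int.induction_on with
  | zero => simp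
  | succ n ih => push_cast at ih ⊢; rw [← add_assoc, hf, ih, add_assoc]
  | pred n ih =>
    push_cast at ih ⊢
    have := hf (x + (-n - 1))
    rw [show x + (-(n : ℝ) - 1) + 1 = x + -n by ring, ih] at this
    linarith

lemma GoodMap.sys {f : ℝ → ℝ} {C : Finset ℝ} {dc : ℝ → ℝ} {ρ : ℝ} (h : GoodMap f C dc ρ) {N : ℕ}
    {d : ℝ} (hN : C.card ≤ N) (hd : ∀ c ∈ C, dc c ≤ d) : Sys f N d ρ := by
  obtain ⟨⟨⟨hs, hm, hp⟩, hne, -, hcrit, hnf⟩, hrot, hirr, -⟩ := h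
  let F : CircleDeg1Lift := ⟨⟨f, hm.monotone⟩, hp⟩
  have hF : ∀ n : ℕ, ⇑(F ^ n) = f^[n] := fun n => F.coe_pow n
  have hτ : F.translationNumber = ρ := by
    apply CircleDeg1Lift.translationNumber_eq_of_tendsto₀
    exact hrot
  refine ⟨hs, hm, hp, hirr, ?_, ?_, ⟨C, hne, hN, hcrit⟩, ?_⟩
  · intro n m x hmn
    rw [← hF]
    apply CircleDeg1Lift.lt_map_of_int_lt_translationNumber
    rwa [CircleDeg1Lift.translationNumber_pow, hτ]
  · intro n m x hmn
    rw [← hF]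
    apply CircleDeg1Lift.map_lt_of_translationNumber_lt_int
    rwa [CircleDeg1Lift.translationNumber_pow, hτ]
  · intro x hx
    obtain ⟨c, hc, k, rfl⟩ := (hcrit x).1 hx
    exact ⟨dc c, hd c hc, (hnf c hc).translate fun y => add_int_of_add_one hp y k⟩

namespace Sys

variable {f : ℝ → ℝ} {N : ℕ} {d ρ : ℝ}

lemma add_int (h : Sys f N d ρ) (x : ℝ) (k : ℤ) : f (x + k) = f x + k :=
  add_int_of_add_one h.periodic x k

lemma iter_add_int (h : Sys f N d ρ) (n : ℕ) (x : ℝ) (k : ℤ) : f^[n] (x + k) = f^[n] x + k := by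
  induction n generalizing x with
  | zero => rfl
  | succ n ih => rw [Function.iterate_succ_apply, Function.iterate_succ_apply, h.add_int, ih]

lemma reflect_iterate (f : ℝ → ℝ) (n : ℕ) (x : ℝ) :
    (fun x => -f (-x))^[n] x = -f^[n] (-x) := by
  induction n generalizing x with
  | zero => simp
  | succ n ih => rw [Function.iterate_succ_apply, Function.iterate_succ_apply, ih, neg_neg]

lemma deriv_reflect (f : ℝ → ℝ) (x : ℝ) : deriv (fun x => -f (-x)) x = deriv f (-x) := by
  rw [deriv.fun_neg, deriv_comp_neg, neg_neg]

/-- Reversing the orientation. -/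
lemma reflect (h : Sys f N d ρ) : Sys (fun x => -f (-x)) N d (-ρ) := by
  refine ⟨(h.smooth.comp contDiff_neg).neg, ?_, ?_, h.irr.neg, ?_, ?_, ?_, ?_⟩
  · intro x y hxy
    exact neg_lt_neg (h.mono (neg_lt_neg hxy))
  · intro x
    have := h.periodic (-(x + 1))
    rw [show -(x + 1) + 1 = -x by ring] at this
    simp only [this]; ring
  · intro n m x hm
    rw [reflect_iterate]
    have := h.iter_lt n (-m) (-x) (by push_cast; linarith)
    push_cast at this; linarith
  · intro n m x hm
    rw [reflect_iterate]
    have := h.lt_iter n (-m) (-x) (by push_cast; linarith)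
    push_cast at this; linarith
  · obtain ⟨C, hne, hN, hC⟩ := h.crit
    refine ⟨C.image Neg.neg, hne.image _, Finset.card_image_le.trans hN, ?_⟩
    intro x
    rw [deriv_reflect, hC]
    constructor
    · rintro ⟨c, hc, k, hk⟩
      exact ⟨-c, Finset.mem_image_of_mem _ hc, -k, by push_cast; linarith⟩
    · rintro ⟨c, hc, k, hk⟩
      obtain ⟨c', hc', rfl⟩ := Finset.mem_image.1 hc
      exact ⟨c', hc', -k, by push_cast; linarith⟩
  · intro x hx
    rw [deriv_reflect] at hx
    obtain ⟨e, he, h1⟩ := h.nonflat _ hx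
    exact ⟨e, he, by simpa using h1.reflect⟩

lemma surjective (h : Sys f N d ρ) : Function.Surjective f := by
  intro y
  set k := ⌊y - f 0⌋ with hk
  have h1 : f k ≤ y := by
    have := h.add_int 0 k
    rw [zero_add] at this
    rw [this]; linarith [Int.floor_le (y - f 0)]
  have h2 : y ≤ f (k + 1) := by
    rw [h.periodic]
    have := h.add_int 0 k
    rw [zero_add] at this
    rw [this]; linarith [Int.lt_floor_add_one (y - f 0)]
  obtain ⟨x, -, hx⟩ := intermediate_value_Icc (by linarith : (k : ℝ) ≤ k + 1)
    h.smooth.continuous.continuousOn ⟨h1, h2⟩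
  exact ⟨x, hx⟩

/-- The map as a permutation of the line. -/
def perm (h : Sys f N d ρ) : Equiv.Perm ℝ :=
  Equiv.ofBijective f ⟨h.mono.injective, h.surjective⟩

/-- The action of `ℤ²` generated by `f` and the unit translation. -/
def Φ (h : Sys f N d ρ) (a b : ℤ) (x : ℝ) : ℝ := (h.perm ^ a) x + b

lemma Φ_natCast (h : Sys f N d ρ) (n : ℕ) (b : ℤ) (x : ℝ) : h.Φ n b x = f^[n] x + b := by
  rw [Φ, zpow_natCast, Equiv.Perm.coe_pow]; rfl

lemma perm_zpow_add_int (h : Sys f N d ρ) (a b : ℤ) (x : ℝ) :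
    (h.perm ^ a) (x + b) = (h.perm ^ a) x + b := by
  rcases Int.eq_nat_or_neg a with ⟨n, rfl | rfl⟩
  · rw [zpow_natCast, Equiv.Perm.coe_pow]
    exact h.iter_add_int n x b
  · rw [zpow_neg, Equiv.Perm.inv_eq_iff_eq, zpow_natCast, Equiv.Perm.coe_pow]
    refine Eq.trans ?_ (h.iter_add_int n _ b).symm
    congr 1
    change x = (⇑h.perm)^[n] _
    rw [← Equiv.Perm.coe_pow]
    simp

lemma Φ_Φ (h : Sys f N d ρ) (a b a' b' : ℤ) (x : ℝ) :
    h.Φ a b (h.Φ a' b' x) = h.Φ (a + a') (b + b') x := by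
  rw [Φ, Φ, Φ, h.perm_zpow_add_int, zpow_add, Equiv.Perm.mul_apply]
  push_cast; ring

@[simp] lemma Φ_zero (h : Sys f N d ρ) (x : ℝ) : h.Φ 0 0 x = x := by simp [Φ]

lemma Φ_zero_left (h : Sys f N d ρ) (b : ℤ) (x : ℝ) : h.Φ 0 b x = x + b := by simp [Φ]

lemma iterate_Φ (h : Sys f N d ρ) (n : ℕ) (a b : ℤ) (x : ℝ) :
    f^[n] (h.Φ a b x) = h.Φ (n + a) b x := by
  have := h.Φ_natCast n 0 (h.Φ a b x)
  rw [h.Φ_Φ, zero_add] at this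
  simpa using this.symm

lemma lt_Φ (h : Sys f N d ρ) {a b : ℤ} (hab : 0 < a * ρ + b) (x : ℝ) : x < h.Φ a b x := by
  rcases Int.eq_nat_or_neg a with ⟨n, rfl | rfl⟩
  · rw [h.Φ_natCast]
    have := h.lt_iter n (-b) x (by push_cast at hab ⊢; linarith)
    push_cast at this; linarith
  · set y := h.Φ (-n) b x with hy
    have h1 : f^[n] y = x + b := by
      rw [hy, h.iterate_Φ, add_neg_cancel, h.Φ_zero_left]
    have := h.iter_lt n b y (by push_cast at hab ⊢; linarith)
    linarith

lemma Φ_lt_Φ (h : Sys f N d ρ) {a b a' b' : ℤ} (hab : a * ρ + b < a' * ρ + b') (x : ℝ) :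
    h.Φ a b x < h.Φ a' b' x := by
  have := h.lt_Φ (a := a' - a) (b := b' - b) (by push_cast; linarith) (h.Φ a b x)
  rwa [h.Φ_Φ, sub_add_cancel, sub_add_cancel] at this

lemma Φ_lt_Φ_iff (h : Sys f N d ρ) {a b a' b' : ℤ} {x : ℝ} :
    h.Φ a b x < h.Φ a' b' x ↔ a * ρ + b < a' * ρ + b' := by
  refine ⟨fun hlt => ?_, fun hlt => h.Φ_lt_Φ hlt x⟩
  by_contra hc
  push Not at hc
  rcases hc.lt_or_eq with h1 | h1
  · exact lt_asymm hlt (h.Φ_lt_Φ h1 x)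
  · by_cases ha : a = a'
    · subst ha
      have : b = b' := by
        have h2 : (b : ℝ) = b' := by linarith
        exact_mod_cast h2
      subst this
      exact lt_irrefl _ hlt
    · have h3 : ((a - a' : ℤ) : ℝ) ≠ 0 := by
        exact_mod_cast sub_ne_zero.2 ha
      have h4 : ρ = ((b' - b : ℤ) : ℝ) / ((a - a' : ℤ) : ℝ) := by
        rw [eq_div_iff h3]; push_cast; linarith
      apply h.irr
      exact ⟨(b' - b : ℤ) / (a - a' : ℤ), by rw [h4]; push_cast; rfl⟩

lemma Φ_le_Φ (h : Sys f N d ρ) {a b a' b' : ℤ} (hab : a * ρ + b ≤ a' * ρ + b') (x : ℝ) :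
    h.Φ a b x ≤ h.Φ a' b' x := by
  by_contra hc
  push Not at hc
  exact absurd (h.Φ_lt_Φ_iff.1 hc) (not_lt.2 hab)

lemma Φ_strictMono (h : Sys f N d ρ) (a b : ℤ) : StrictMono (h.Φ a b) := by
  intro x y hxy
  rcases Int.eq_nat_or_neg a with ⟨n, rfl | rfl⟩
  · rw [h.Φ_natCast, h.Φ_natCast]
    linarith [h.mono.iterate n hxy]
  · rw [← (h.mono.iterate n).lt_iff_lt, h.iterate_Φ, h.iterate_Φ]
    simpa [h.Φ_zero_left] using hxy

lemma Φ_reflect (h : Sys f N d ρ) (a b : ℤ) (x : ℝ) :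
    h.reflect.Φ a b x = -h.Φ a (-b) (-x) := by
  rcases Int.eq_nat_or_neg a with ⟨n, rfl | rfl⟩
  · rw [h.reflect.Φ_natCast, reflect_iterate, h.Φ_natCast]
    push_cast; ring
  · apply (h.reflect.mono.iterate n).injective
    rw [h.reflect.iterate_Φ, reflect_iterate, neg_neg, h.iterate_Φ, add_neg_cancel,
      h.reflect.Φ_zero_left, h.Φ_zero_left]
    push_cast; ring

lemma Φ_conj {g H : ℝ → ℝ} (h : Sys f N d ρ) (hg : Sys g N d ρ) (hp : ∀ x, H (x + 1) = H x + 1)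
    (hc : ∀ x, H (f x) = g (H x)) (a b : ℤ) (x : ℝ) : H (h.Φ a b x) = hg.Φ a b (H x) := by
  have hit : ∀ (n : ℕ) (x : ℝ), H (f^[n] x) = g^[n] (H x) := fun n =>
    (Function.Semiconj.iterate_right (f := H) hc n)
  rcases Int.eq_nat_or_neg a with ⟨n, rfl | rfl⟩
  · rw [h.Φ_natCast, hg.Φ_natCast, add_int_of_add_one hp, hit]
  · apply (hg.mono.iterate n).injective
    rw [← hit, h.iterate_Φ, hg.iterate_Φ, add_neg_cancel, h.Φ_zero_left, hg.Φ_zero_left,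
      add_int_of_add_one hp]

end Sys

end MCircle

namespace MCircle

lemma hasDerivAts_of_contDiffOn {φ : ℝ → ℝ} {W : Set ℝ} (hW : IsOpen W) (h : ContDiffOn ℝ 3 φ W) :
    ContinuousOn (deriv φ) W ∧ ContinuousOn (deriv (deriv φ)) W ∧
    ContinuousOn (deriv (deriv (deriv φ))) W ∧
    ∀ x ∈ W, HasDerivAt φ (deriv φ x) x ∧ HasDerivAt (deriv φ) (deriv (deriv φ) x) x ∧
      HasDerivAt (deriv (deriv φ)) (deriv (deriv (deriv φ)) x) x := by
  have h3 := (contDiffOn_succ_iff_deriv_of_isOpen (n := 2) hW).1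
    (by rw [show (2 : WithTop ℕ∞) + 1 = 3 by norm_num]; exact h)
  have h2 := (contDiffOn_succ_iff_deriv_of_isOpen (n := 1) hW).1
    (by rw [show (1 : WithTop ℕ∞) + 1 = 2 by norm_num]; exact h3.2.2)
  have h1 := (contDiffOn_succ_iff_deriv_of_isOpen (n := 0) hW).1
    (by rw [zero_add]; exact h2.2.2)
  refine ⟨h3.2.2.continuousOn, h2.2.2.continuousOn, h1.2.2.continuousOn, fun x hx => ⟨?_, ?_, ?_⟩⟩
  · exact ((h3.1 x hx).differentiableAt (hW.mem_nhds hx)).hasDerivAt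
  · exact ((h2.1 x hx).differentiableAt (hW.mem_nhds hx)).hasDerivAt
  · exact ((h1.1 x hx).differentiableAt (hW.mem_nhds hx)).hasDerivAt

/-- Normal form of an increasing map at a non-flat critical point. -/
structure NF (f φ φ1 φ2 φ3 : ℝ → ℝ) (c e r μ : ℝ) : Prop where
  r_pos : 0 < r
  μ_pos : 0 < μ
  one_lt : 1 < e
  d1 : ∀ x ∈ Ioo (c - r) (c + r), HasDerivAt φ (φ1 x) x
  d2 : ∀ x ∈ Ioo (c - r) (c + r), HasDerivAt φ1 (φ2 x) x
  d3 : ∀ x ∈ Ioo (c - r) (c + r), HasDerivAt φ2 (φ3 x) x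
  c3 : ContinuousAt φ3 c
  zero : φ c = 0
  slope : φ1 c = μ
  eq : ∀ x ∈ Ioo (c - r) (c + r), f x = f c + φ x * |φ x| ^ (e - 1)
  lower : ∀ x ∈ Ioo (c - r) (c + r), 2 / 3 * μ ≤ φ1 x
  upper : ∀ x ∈ Ioo (c - r) (c + r), φ1 x ≤ 4 / 3 * μ

lemma IsNonFlatCritPt.exists_nf {f : ℝ → ℝ} (hf : StrictMono f) {c e : ℝ}
    (h : IsNonFlatCritPt f c e) : ∃ φ φ1 φ2 φ3 r μ, NF f φ φ1 φ2 φ3 c e r μ := by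
  obtain ⟨he, W, φ, hW, hc, hs, h0, hd, -, hx⟩ := h
  obtain ⟨k1, k2, k3, hd'⟩ := hasDerivAts_of_contDiffOn hW hs
  have hμ := hd c hc
  set μ := deriv φ c with hμdef
  have hev : ∀ᶠ x in 𝓝 c, x ∈ W ∧ |deriv φ x - μ| < |μ| / 3 := by
    have := (k1.continuousAt (hW.mem_nhds hc))
    filter_upwards [hW.mem_nhds hc, Metric.tendsto_nhds.1 this (|μ| / 3) (by positivity)]
      with x h1 h2 using ⟨h1, by rwa [Real.dist_eq] at h2⟩
  obtain ⟨r, hr, hball⟩ := Metric.eventually_nhds_iff.1 hev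
  have hb : ∀ x ∈ Ioo (c - r) (c + r), x ∈ W ∧ |deriv φ x - μ| < |μ| / 3 := fun x hx =>
    hball (by rw [Real.dist_eq, abs_lt]; constructor <;> linarith [hx.1, hx.2])
  have hpos : 0 < μ := by
    by_contra hneg
    have hneg : μ < 0 := lt_of_le_of_ne (not_lt.1 hneg) hμ
    have hm : c + r / 2 ∈ Ioo (c - r) (c + r) := ⟨by linarith, by linarith⟩
    obtain ⟨ξ, hξ, he'⟩ := exists_hasDerivAt_eq_slope φ (deriv φ) (by linarith : c < c + r / 2)
      (fun x hx => ((hd' x (hb x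
        ⟨by linarith [hx.1], by linarith [hx.2]⟩).1).1).continuousAt.continuousWithinAt)
      (fun x hx => (hd' x (hb x ⟨by linarith [hx.1], by linarith [hx.2]⟩).1).1)
    have h1 := (hb ξ ⟨by linarith [hξ.1], by linarith [hξ.2]⟩).2
    rw [abs_of_neg hneg, abs_lt] at h1
    have h2 : deriv φ ξ < 0 := by linarith [h1.2]
    rw [he', div_neg_iff] at h2
    have h3 : φ (c + r / 2) < 0 := by
      rcases h2 with h2 | h2
      · linarith [h2.2]
      · linarith [h2.1]
    have h4 := hx _ (hb _ hm).1
    have h5 := hf (by linarith : c < c + r / 2)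
    have h6 : φ (c + r / 2) * |φ (c + r / 2)| ^ (e - 1) ≤ 0 :=
      mul_nonpos_of_nonpos_of_nonneg h3.le (by positivity)
    linarith
  refine ⟨φ, deriv φ, _, _, r, μ, hr, hpos, he, fun x hx => (hd' x (hb x hx).1).1,
    fun x hx => (hd' x (hb x hx).1).2.1, fun x hx => (hd' x (hb x hx).1).2.2,
    k3.continuousAt (hW.mem_nhds hc), h0, rfl, fun y hy => hx y (hb y hy).1, ?_, ?_⟩
  · intro x hx
    have := (hb x hx).2
    rw [abs_of_pos hpos, abs_lt] at this
    linarith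
  · intro x hx
    have := (hb x hx).2
    rw [abs_of_pos hpos, abs_lt] at this
    linarith

namespace NF

variable {f φ φ1 φ2 φ3 : ℝ → ℝ} {c e r μ : ℝ}

lemma mem_self (h : NF f φ φ1 φ2 φ3 c e r μ) : c ∈ Ioo (c - r) (c + r) :=
  ⟨by linarith [h.r_pos], by linarith [h.r_pos]⟩

lemma slopes (h : NF f φ φ1 φ2 φ3 c e r μ) {x y : ℝ} (hx : x ∈ Ioo (c - r) (c + r))
    (hy : y ∈ Ioo (c - r) (c + r)) (hxy : x ≤ y) :
    2 / 3 * μ * (y - x) ≤ φ y - φ x ∧ φ y - φ x ≤ 4 / 3 * μ * (y - x) := by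
  rcases hxy.eq_or_lt with rfl | hlt
  · simp
  obtain ⟨ξ, hξ, he⟩ := exists_hasDerivAt_eq_slope φ φ1 hlt
    (fun z hz => (h.d1 z
      ⟨by linarith [hx.1, hz.1], by linarith [hy.2, hz.2]⟩).continuousAt.continuousWithinAt)
    (fun z hz => h.d1 z ⟨by linarith [hx.1, hz.1], by linarith [hy.2, hz.2]⟩)
  have hm : ξ ∈ Ioo (c - r) (c + r) := ⟨by linarith [hx.1, hξ.1], by linarith [hy.2, hξ.2]⟩
  have h1 := h.lower ξ hm
  have h2 := h.upper ξ hm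
  have h3 : φ y - φ x = φ1 ξ * (y - x) := by rw [he]; field_simp [(by linarith : y - x ≠ 0)]
  rw [h3]
  constructor <;> apply mul_le_mul_of_nonneg_right _ (by linarith) <;> assumption

lemma φ_pos (h : NF f φ φ1 φ2 φ3 c e r μ) {x : ℝ} (hx : x ∈ Ioo (c - r) (c + r)) (hc : c < x) :
    0 < φ x := by
  have := (h.slopes h.mem_self hx hc.le).1
  rw [h.zero] at this
  have h2 : 0 < 2 / 3 * μ * (x - c) := mul_pos (by linarith [h.μ_pos]) (by linarith)
  linarith

lemma φ_ne (h : NF f φ φ1 φ2 φ3 c e r μ) {x : ℝ} (hx : x ∈ Ioo (c - r) (c + r)) (hc : x ≠ c) :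
    φ x ≠ 0 := by
  rcases hc.lt_or_gt with h1 | h1
  · have := (h.slopes hx h.mem_self h1.le).1
    rw [h.zero] at this
    have h2 : 0 < 2 / 3 * μ * (c - x) := mul_pos (by linarith [h.μ_pos]) (by linarith)
    linarith
  · exact (h.φ_pos hx h1).ne'

lemma hasDerivAt (h : NF f φ φ1 φ2 φ3 c e r μ) {x : ℝ} (hx : x ∈ Ioo (c - r) (c + r))
    (hc : x ≠ c) : HasDerivAt f (e * φ1 x * Real.exp (Real.log (φ x) * (e - 1))) x := by
  have hp := h.φ_ne hx hc
  have hE := (((h.d1 x hx).log hp).mul_const (e - 1)).exp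
  have h1 := ((h.d1 x hx).mul hE).const_add (f c)
  refine (h1.congr_of_eventuallyEq ?_).congr_deriv ?_
  · have hopen : IsOpen (Ioo (c - r) (c + r) ∩ {c}ᶜ) := isOpen_Ioo.inter isOpen_compl_singleton
    filter_upwards [hopen.mem_nhds ⟨hx, hc⟩] with y hy
    have hp' := h.φ_ne hy.1 hy.2
    simp only [Pi.mul_apply]
    rw [h.eq y hy.1, Real.rpow_def_of_pos (abs_pos.2 hp'), Real.log_abs]
  · field_simp; ring

lemma logD2_eq (h : NF f φ φ1 φ2 φ3 c e r μ) {x : ℝ} (hx : x ∈ Ioo (c - r) (c + r))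
    (hc : x ≠ c) : logD2 f x =
      φ3 x / φ1 x - (φ2 x / φ1 x) ^ 2 + (e - 1) * (φ2 x / φ x - (φ1 x / φ x) ^ 2) := by
  have hopen : IsOpen (Ioo (c - r) (c + r) ∩ {c}ᶜ) := isOpen_Ioo.inter isOpen_compl_singleton
  have e1 : ∀ y ∈ Ioo (c - r) (c + r) ∩ {c}ᶜ, deriv f y =
      e * φ1 y * Real.exp (Real.log (φ y) * (e - 1)) := fun y hy => (h.hasDerivAt hy.1 hy.2).deriv
  have d2 : ∀ y ∈ Ioo (c - r) (c + r) ∩ {c}ᶜ, HasDerivAt (deriv f)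
      (e * (φ2 y + (e - 1) * (φ1 y ^ 2 / φ y)) * Real.exp (Real.log (φ y) * (e - 1))) y := by
    intro y hy
    have hp := h.φ_ne hy.1 hy.2
    have hE := (((h.d1 y hy.1).log hp).mul_const (e - 1)).exp
    have h1 := ((h.d2 y hy.1).const_mul e).mul hE
    refine (h1.congr_of_eventuallyEq ?_).congr_deriv ?_
    · filter_upwards [hopen.mem_nhds hy] with z hz using e1 z hz
    · field_simp
  have d3 : HasDerivAt (deriv (deriv f))
      (e * ((φ3 x + (e - 1) * (2 * φ1 x * φ2 x / φ x - φ1 x ^ 3 / φ x ^ 2)) +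
        (φ2 x + (e - 1) * (φ1 x ^ 2 / φ x)) * (φ1 x / φ x * (e - 1)))
        * Real.exp (Real.log (φ x) * (e - 1))) x := by
    have hp := h.φ_ne hx hc
    have hE := (((h.d1 x hx).log hp).mul_const (e - 1)).exp
    have h1 := (((h.d3 x hx).add ((((h.d2 x hx).pow 2).div (h.d1 x hx) hp).const_mul
      (e - 1))).const_mul e).mul hE
    refine (h1.congr_of_eventuallyEq ?_).congr_deriv ?_
    · filter_upwards [hopen.mem_nhds ⟨hx, hc⟩] with z hz using (d2 z hz).deriv
    · simp only [Pi.add_apply, Pi.div_apply, Pi.pow_apply]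
      field_simp
      ring
  unfold logD2 logDD
  rw [d3.deriv, (d2 x ⟨hx, hc⟩).deriv, e1 x ⟨hx, hc⟩]
  have hp := h.φ_ne hx hc
  have hE := Real.exp_pos (Real.log (φ x) * (e - 1))
  have h1 : φ1 x ≠ 0 := by
    have := h.lower x hx
    have := h.μ_pos
    linarith
  have he : e ≠ 0 := by linarith [h.one_lt]
  field_simp
  ring

/-- Near the critical point, `(log f')''` is very negative. -/
lemma eventually_logD2_le (h : NF f φ φ1 φ2 φ3 c e r μ) (he : 2 ≤ e) :
    ∀ᶠ x in 𝓝[≠] c, (x - c) ^ 2 * logD2 f x ≤ -(1 / 2) := by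
  have hμ := h.μ_pos
  have t0 : Tendsto (fun x => x - c) (𝓝[≠] c) (𝓝 0) := by
    have : Tendsto (fun x => x - c) (𝓝 c) (𝓝 (c - c)) := (continuous_sub_right c).tendsto c
    rw [sub_self] at this
    exact this.mono_left nhdsWithin_le_nhds
  have t1 : Tendsto φ1 (𝓝[≠] c) (𝓝 μ) := by
    have := (h.d2 c h.mem_self).continuousAt.tendsto
    rw [h.slope] at this
    exact this.mono_left nhdsWithin_le_nhds
  have t2 : Tendsto φ2 (𝓝[≠] c) (𝓝 (φ2 c)) :=
    (h.d3 c h.mem_self).continuousAt.tendsto.mono_left nhdsWithin_le_nhds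
  have t3 : Tendsto φ3 (𝓝[≠] c) (𝓝 (φ3 c)) := h.c3.tendsto.mono_left nhdsWithin_le_nhds
  have tq : Tendsto (fun x => (x - c) / φ x) (𝓝[≠] c) (𝓝 μ⁻¹) := by
    have h1 := hasDerivAt_iff_tendsto_slope.1 (h.d1 c h.mem_self)
    rw [h.slope] at h1
    refine (h1.inv₀ hμ.ne').congr fun x => ?_
    rw [slope_def_field, h.zero, sub_zero, inv_div]
  have hlim : Tendsto (fun x => (x - c) ^ 2 * (φ3 x / φ1 x - (φ2 x / φ1 x) ^ 2)
      + (e - 1) * ((x - c) * (φ2 x * ((x - c) / φ x)) - (φ1 x * ((x - c) / φ x)) ^ 2)) (𝓝[≠] c)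
      (𝓝 (0 ^ 2 * (φ3 c / μ - (φ2 c / μ) ^ 2)
      + (e - 1) * (0 * (φ2 c * μ⁻¹) - (μ * μ⁻¹) ^ 2))) :=
    ((t0.pow 2).mul ((t3.div t1 hμ.ne').sub ((t2.div t1 hμ.ne').pow 2))).add
      (((t0.mul (t2.mul tq)).sub ((t1.mul tq).pow 2)).const_mul (e - 1))
  have hval : (0 : ℝ) ^ 2 * (φ3 c / μ - (φ2 c / μ) ^ 2)
      + (e - 1) * (0 * (φ2 c * μ⁻¹) - (μ * μ⁻¹) ^ 2) < -(1 / 2) := by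
    rw [mul_inv_cancel₀ hμ.ne']; linarith
  have hnb : Ioo (c - r) (c + r) ∈ 𝓝[≠] c :=
    nhdsWithin_le_nhds (Ioo_mem_nhds h.mem_self.1 h.mem_self.2)
  filter_upwards [hlim.eventually (gt_mem_nhds hval), hnb, self_mem_nhdsWithin] with x h1 h2 h3
  rw [h.logD2_eq h2 h3]
  refine le_trans (le_of_eq ?_) h1.le
  have := h.φ_ne h2 h3
  ring

/-- The criticality of a critical point of a map with Lipschitz derivative is at least two. -/
lemma two_le (h : NF f φ φ1 φ2 φ3 c e r μ) {M δ : ℝ} (hδ : 0 < δ)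
    (hM : ∀ x ∈ Ioo c (c + δ), f x - f c ≤ M * (x - c) ^ 2) : 2 ≤ e := by
  by_contra hlt
  push Not at hlt
  have hμ := h.μ_pos
  have hr := h.r_pos
  have ht : Tendsto (fun y : ℝ => M * y ^ (2 - e)) (𝓝[>] 0) (𝓝 (M * 0 ^ (2 - e))) :=
    ((Real.continuousAt_rpow_const 0 (2 - e) (Or.inr (by linarith))).tendsto.const_mul M).mono_left
      nhdsWithin_le_nhds
  rw [Real.zero_rpow (by linarith), mul_zero] at ht
  have hk : 0 < (2 / 3 * μ) ^ e := by positivity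
  have hev := (ht.eventually (gt_mem_nhds hk)).and
    (Ioo_mem_nhdsGT (show (0 : ℝ) < min r δ from lt_min hr hδ))
  obtain ⟨y, h1, h2⟩ := hev.exists
  have hy0 : 0 < y := h2.1
  have hyr := h2.2.trans_le (min_le_left _ _)
  have hyδ := h2.2.trans_le (min_le_right _ _)
  have hm : c + y ∈ Ioo (c - r) (c + r) := ⟨by linarith, by linarith⟩
  have h3 := hM (c + y) ⟨by linarith, by linarith⟩
  have h4 := h.φ_pos hm (by linarith)
  have h5 := (h.slopes h.mem_self hm (by linarith)).1
  rw [h.zero, sub_zero, add_sub_cancel_left] at h5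
  rw [h.eq _ hm, add_sub_cancel_left, add_sub_cancel_left, abs_of_pos h4] at h3
  have h6 : φ (c + y) * φ (c + y) ^ (e - 1) = φ (c + y) ^ e := by
    rw [Real.rpow_sub_one h4.ne']; field_simp
  rw [h6] at h3
  have h7 : (2 / 3 * μ * y) ^ e ≤ φ (c + y) ^ e :=
    Real.rpow_le_rpow (by positivity) h5 (by linarith [h.one_lt])
  rw [Real.mul_rpow (by positivity) hy0.le] at h7
  have h8 : M * y ^ 2 = M * y ^ (2 - e) * y ^ e := by
    rw [mul_assoc, ← Real.rpow_add hy0, sub_add_cancel, Real.rpow_two]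
  have h9 : 0 < y ^ e := by positivity
  have h10 := mul_lt_mul_of_pos_right h1 h9
  linarith

lemma image_le (h : NF f φ φ1 φ2 φ3 c e r μ) (he : 2 ≤ e) {d : ℝ} (hd : e ≤ d) {s t : ℝ}
    (hs : 0 < s) (hst : s ≤ t) (ht : t < r) :
    f (c + s) - f c ≤ 2 ^ d * (s / t) ^ 2 * (f (c + t) - f c) := by
  have hμ := h.μ_pos
  have ms : c + s ∈ Ioo (c - r) (c + r) := ⟨by linarith, by linarith⟩
  have mt : c + t ∈ Ioo (c - r) (c + r) := ⟨by linarith, by linarith⟩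
  have ps := h.φ_pos ms (by linarith)
  have pt := h.φ_pos mt (by linarith)
  have us := (h.slopes h.mem_self ms (by linarith)).2
  have lt := (h.slopes h.mem_self mt (by linarith)).1
  rw [h.zero, sub_zero, add_sub_cancel_left] at us lt
  rw [h.eq _ ms, h.eq _ mt, add_sub_cancel_left, add_sub_cancel_left, abs_of_pos ps, abs_of_pos pt]
  have hr : ∀ z : ℝ, 0 < z → z * z ^ (e - 1) = z ^ e := fun z hz => by
    rw [Real.rpow_sub_one hz.ne']; field_simp
  rw [hr _ ps, hr _ pt]
  have ht0 : 0 < t := by linarith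
  have h1 : φ (c + s) ≤ 2 * (s / t) * φ (c + t) := by
    have : s / t * (2 / 3 * μ * t) ≤ s / t * φ (c + t) := by gcongr
    have h2 : s / t * (2 / 3 * μ * t) = 2 / 3 * μ * s := by field_simp
    linarith
  have hst1 : s / t ≤ 1 := by rw [div_le_one ht0]; exact hst
  have hst0 : 0 < s / t := by positivity
  calc φ (c + s) ^ e ≤ (2 * (s / t) * φ (c + t)) ^ e :=
        Real.rpow_le_rpow ps.le h1 (by linarith)
    _ = 2 ^ e * (s / t) ^ e * φ (c + t) ^ e := by
        rw [Real.mul_rpow (by positivity) pt.le, Real.mul_rpow (by norm_num) hst0.le]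
    _ ≤ 2 ^ d * (s / t) ^ 2 * φ (c + t) ^ e := by
        have h3 : (s / t) ^ e ≤ (s / t) ^ (2 : ℝ) := Real.rpow_le_rpow_of_exponent_ge hst0 hst1 he
        rw [Real.rpow_two] at h3
        have h4 : (2 : ℝ) ^ e ≤ 2 ^ d := Real.rpow_le_rpow_of_exponent_le (by norm_num) hd
        gcongr

end NF

/-- A lower bound for the increments of the signed power. -/
lemma half_mul_le_signed_rpow {k a b ξ : ℝ} (hk : 0 ≤ k) (h1 : a ≤ ξ) (h2 : ξ ≤ b) :
    (b - a) * |ξ| ^ k ≤ 2 * (b * |b| ^ k - a * |a| ^ k) := by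
  -- reduce to the case where `b` has the larger absolute value
  have main : ∀ a b ξ : ℝ, a ≤ ξ → ξ ≤ b → -b ≤ a →
      (b - a) * |ξ| ^ k ≤ 2 * (b * |b| ^ k - a * |a| ^ k) := by
    intro a b ξ h1 h2 h3
    have hb : 0 ≤ b := by linarith
    have hξ : |ξ| ≤ b := abs_le.2 ⟨by linarith, h2⟩
    have h4 : |ξ| ^ k ≤ b ^ k := Real.rpow_le_rpow (abs_nonneg _) hξ hk
    have h5 : (b - a) * |ξ| ^ k ≤ (b - a) * b ^ k := by
      apply mul_le_mul_of_nonneg_left h4; linarith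
    have hbk : 0 ≤ b ^ k := by positivity
    rw [abs_of_nonneg hb]
    rcases le_or_gt 0 a with ha | ha
    · have h6 : |a| ^ k ≤ b ^ k := by
        rw [abs_of_nonneg ha]; exact Real.rpow_le_rpow ha (by linarith) hk
      have h7 : a * |a| ^ k ≤ a * b ^ k := mul_le_mul_of_nonneg_left h6 ha
      have h8 : 0 ≤ (b - a) * b ^ k := mul_nonneg (by linarith) hbk
      linarith
    · have h7 : a * |a| ^ k ≤ 0 := mul_nonpos_of_nonpos_of_nonneg ha.le (by positivity)
      nlinarith
  rcases le_total (-b) a with h3 | h3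
  · exact main a b ξ h1 h2 h3
  · have := main (-b) (-a) (-ξ) (by linarith) (by linarith) (by linarith)
    simp only [abs_neg] at this
    linarith

lemma NF.deriv_mul_le {f φ φ1 φ2 φ3 : ℝ → ℝ} {c e r μ : ℝ} (h : NF f φ φ1 φ2 φ3 c e r μ)
    (h0 : deriv f c = 0) {u ξ v : ℝ} (hu : c - r < u) (h1 : u ≤ ξ) (h2 : ξ ≤ v) (hv : v < c + r) :
    deriv f ξ * (v - u) ≤ 4 * e * (f v - f u) := by
  have hμ := h.μ_pos
  have he := h.one_lt
  have mu : u ∈ Ioo (c - r) (c + r) := ⟨by linarith, by linarith⟩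
  have mv : v ∈ Ioo (c - r) (c + r) := ⟨by linarith, by linarith⟩
  have mξ : ξ ∈ Ioo (c - r) (c + r) := ⟨by linarith, by linarith⟩
  have s1 := h.slopes mu mξ h1
  have s2 := h.slopes mξ mv h2
  have s3 := h.slopes mu mv (by linarith)
  have p1 : 0 ≤ 2 / 3 * μ * (ξ - u) := mul_nonneg (by linarith) (by linarith)
  have p2 : 0 ≤ 2 / 3 * μ * (v - ξ) := mul_nonneg (by linarith) (by linarith)
  have key := half_mul_le_signed_rpow (k := e - 1) (by linarith) (by linarith : φ u ≤ φ ξ)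
    (by linarith : φ ξ ≤ φ v)
  have hf : f v - f u = φ v * |φ v| ^ (e - 1) - φ u * |φ u| ^ (e - 1) := by
    rw [h.eq v mv, h.eq u mu]; ring
  rw [← hf] at key
  have hd : deriv f ξ ≤ e * (4 / 3 * μ) * |φ ξ| ^ (e - 1) := by
    by_cases hξ : ξ = c
    · rw [hξ, h0]; positivity
    · rw [(h.hasDerivAt mξ hξ).deriv, Real.rpow_def_of_pos (abs_pos.2 (h.φ_ne mξ hξ)), Real.log_abs]
      have := h.upper ξ mξ
      gcongr
  have hp : 0 ≤ |φ ξ| ^ (e - 1) := by positivity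
  calc deriv f ξ * (v - u) ≤ e * (4 / 3 * μ) * |φ ξ| ^ (e - 1) * (v - u) := by
        apply mul_le_mul_of_nonneg_right hd; linarith
    _ = 2 * e * ((2 / 3 * μ * (v - u)) * |φ ξ| ^ (e - 1)) := by ring
    _ ≤ 2 * e * ((φ v - φ u) * |φ ξ| ^ (e - 1)) := by gcongr; exact s3.1
    _ ≤ 2 * e * (2 * (f v - f u)) := by gcongr
    _ = _ := by ring

end MCircle

namespace MCircle

lemma exists_pos_forall_mem (C : Finset ℝ) (Q : ℝ → ℝ → Prop)
    (hanti : ∀ s t c, s ≤ t → Q t c → Q s c) (h : ∀ c ∈ C, ∃ t > 0, Q t c) :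
    ∃ t > 0, ∀ c ∈ C, Q t c := by
  induction C using Finset.induction_on with
  | empty => exact ⟨1, one_pos, by simp⟩
  | insert a s ha ih =>
    obtain ⟨t1, h1, h2⟩ := ih fun c hc => h c (Finset.mem_insert_of_mem hc)
    obtain ⟨t3, h3, h4⟩ := h a (Finset.mem_insert_self _ _)
    refine ⟨min t1 t3, lt_min h1 h3, fun c hc => ?_⟩
    rcases Finset.mem_insert.1 hc with rfl | hc
    · exact hanti _ _ _ (min_le_right _ _) h4
    · exact hanti _ _ _ (min_le_left _ _) (h2 c hc)

/-- A local property of short intervals holds uniformly, by compactness and periodicity. -/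
lemma exists_pos_forall_interval (P : ℝ → ℝ → Prop)
    (hper : ∀ u v (k : ℤ), P u v → P (u + k) (v + k))
    (h : ∀ x, ∃ δ > 0, ∀ u v, x - δ < u → u ≤ v → v < x + δ → P u v) :
    ∃ t > 0, ∀ u v, u ≤ v → v - u ≤ t → P u v := by
  have key : ∃ t > 0, ∀ u ∈ Icc (0 : ℝ) 1, ∀ v, u ≤ v → v - u ≤ t → P u v := by
    refine isCompact_Icc.induction_on
      (p := fun s => ∃ t > 0, ∀ u ∈ s, ∀ v, u ≤ v → v - u ≤ t → P u v)
      ⟨1, one_pos, by simp⟩ ?_ ?_ ?_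
    · rintro s s' hs ⟨t, ht, h1⟩
      exact ⟨t, ht, fun u hu => h1 u (hs hu)⟩
    · rintro s s' ⟨t, ht, h1⟩ ⟨t', ht', h1'⟩
      refine ⟨min t t', lt_min ht ht', fun u hu v huv hv => ?_⟩
      rcases hu with hu | hu
      · exact h1 u hu v huv (hv.trans (min_le_left _ _))
      · exact h1' u hu v huv (hv.trans (min_le_right _ _))
    · intro x _
      obtain ⟨δ, hδ, h1⟩ := h x
      refine ⟨Ioo (x - δ / 2) (x + δ / 2),
        nhdsWithin_le_nhds (Ioo_mem_nhds (by linarith) (by linarith)),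
        δ / 2, by positivity, fun u hu v huv hv => h1 u v ?_ huv ?_⟩
      · linarith [hu.1]
      · linarith [hu.2]
  obtain ⟨t, ht, h1⟩ := key
  refine ⟨t, ht, fun u v huv hv => ?_⟩
  have := hper _ _ ⌊u⌋ (h1 (Int.fract u) ⟨Int.fract_nonneg u, (Int.fract_lt_one u).le⟩ (v - ⌊u⌋)
    (by rw [← Int.self_sub_floor]; linarith) (by rw [← Int.self_sub_floor]; linarith))
  simpa using this

namespace Sys

variable {f : ℝ → ℝ} {N : ℕ} {d ρ : ℝ}

lemma hasDerivAts (h : Sys f N d ρ) :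
    Continuous (deriv f) ∧ Continuous (deriv (deriv f)) ∧ Continuous (deriv (deriv (deriv f))) ∧
    ∀ x, HasDerivAt f (deriv f x) x ∧ HasDerivAt (deriv f) (deriv (deriv f) x) x ∧
      HasDerivAt (deriv (deriv f)) (deriv (deriv (deriv f)) x) x := by
  obtain ⟨h1, h2, h3, h4⟩ := hasDerivAts_of_contDiffOn isOpen_univ h.smooth.contDiffOn
  rw [continuousOn_univ] at h1 h2 h3
  exact ⟨h1, h2, h3, fun x => h4 x (mem_univ x)⟩

lemma deriv_add_int (h : Sys f N d ρ) (x : ℝ) (k : ℤ) : deriv f (x + k) = deriv f x := by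
  rw [← deriv_comp_add_const]
  simp only [h.add_int, deriv_add_const]

lemma logD2_add_int (h : Sys f N d ρ) (x : ℝ) (k : ℤ) : logD2 f (x + k) = logD2 f x := by
  have h2 : ∀ x, deriv (deriv f) (x + k) = deriv (deriv f) x := fun x => by
    rw [← deriv_comp_add_const]
    simp only [h.deriv_add_int]
  have h3 : deriv (deriv (deriv f)) (x + k) = deriv (deriv (deriv f)) x := by
    rw [← deriv_comp_add_const]
    simp only [h2]
  simp only [logD2, logDD, h2, h3, h.deriv_add_int]

lemma exists_crit_pt (h : Sys f N d ρ) : ∃ c, deriv f c = 0 := by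
  obtain ⟨C, ⟨c, hc⟩, -, hC⟩ := h.crit
  exact ⟨c, (hC c).2 ⟨c, hc, 0, by simp⟩⟩

lemma one_lt_d (h : Sys f N d ρ) : 1 < d := by
  obtain ⟨c, hc⟩ := h.exists_crit_pt
  obtain ⟨e, he, h1⟩ := h.nonflat c hc
  exact h1.1.trans_le he

lemma exists_nf (h : Sys f N d ρ) {c : ℝ} (hc : deriv f c = 0) :
    ∃ φ φ1 φ2 φ3 e r μ, e ≤ d ∧ 2 ≤ e ∧ NF f φ φ1 φ2 φ3 c e r μ := by
  obtain ⟨e, he, h1⟩ := h.nonflat c hc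
  obtain ⟨φ, φ1, φ2, φ3, r, μ, hn⟩ := h1.exists_nf h.mono
  refine ⟨φ, φ1, φ2, φ3, e, r, μ, he, ?_, hn⟩
  obtain ⟨k1, k2, k3, hd⟩ := h.hasDerivAts
  obtain ⟨δ, hδ, hb⟩ := Metric.eventually_nhds_iff.1
    ((k2.tendsto c).eventually (gt_mem_nhds (lt_add_one (deriv (deriv f) c))))
  refine hn.two_le (M := |deriv (deriv f) c| + 1) hδ fun x hx => ?_
  have hM := le_abs_self (deriv (deriv f) c)
  obtain ⟨ξ, hξ, e1⟩ := exists_hasDerivAt_eq_slope f (deriv f) hx.1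
    h.smooth.continuous.continuousOn fun y _ => (hd y).1
  obtain ⟨ζ, hζ, e2⟩ := exists_hasDerivAt_eq_slope (deriv f) (deriv (deriv f)) hξ.1
    k1.continuousOn fun y _ => (hd y).2.1
  have h2 : deriv (deriv f) ζ < deriv (deriv f) c + 1 :=
    hb (by rw [Real.dist_eq, abs_of_pos (by linarith [hζ.1])]; linarith [hζ.2, hξ.2, hx.2])
  have p1 : 0 < x - c := by linarith [hx.1]
  have p2 : 0 < ξ - c := by linarith [hξ.1]
  rw [eq_div_iff p1.ne'] at e1
  rw [eq_div_iff p2.ne', hc, sub_zero] at e2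
  rw [← e1, ← e2, sq, ← mul_assoc]
  have p3 : 0 ≤ |deriv (deriv f) c| + 1 := by positivity
  have p4 : ξ - c ≤ x - c := by linarith [hξ.2]
  apply mul_le_mul_of_nonneg_right _ p1.le
  exact mul_le_mul (by linarith) p4 p2.le p3

/-- `(log f')''` is bounded above off the critical points. -/
lemma exists_reg (h : Sys f N d ρ) : ∃ A, Reg f A := by
  obtain ⟨k1, k2, k3, hd⟩ := h.hasDerivAts
  have key : ∃ A ≥ 0, ∀ x ∈ Icc (0 : ℝ) 1, deriv f x ≠ 0 → logD2 f x ≤ A := by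
    refine isCompact_Icc.induction_on
      (p := fun s => ∃ A ≥ 0, ∀ x ∈ s, deriv f x ≠ 0 → logD2 f x ≤ A) ⟨0, le_rfl, by simp⟩ ?_ ?_ ?_
    · rintro s s' hs ⟨A, hA, h1⟩
      exact ⟨A, hA, fun x hx => h1 x (hs hx)⟩
    · rintro s s' ⟨A, hA, h1⟩ ⟨A', hA', h1'⟩
      refine ⟨max A A', le_max_of_le_left hA, fun x hx hx' => ?_⟩
      rcases hx with hx | hx
      · exact (h1 x hx hx').trans (le_max_left _ _)
      · exact (h1' x hx hx').trans (le_max_right _ _)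
    · intro x _
      by_cases hx : deriv f x = 0
      · obtain ⟨φ, φ1, φ2, φ3, e, r, μ, -, he, hn⟩ := h.exists_nf hx
        have hev := hn.eventually_logD2_le he
        rw [eventually_nhdsWithin_iff] at hev
        refine ⟨_, nhdsWithin_le_nhds hev, 0, le_rfl, fun y hy hy' => ?_⟩
        have hyx : y ≠ x := fun e => hy' (e ▸ hx)
        have h1 := hy hyx
        have h2 : 0 < (y - x) ^ 2 := by
          have := sub_ne_zero.2 hyx
          positivity
        by_contra hc
        push Not at hc
        have := mul_pos h2 hc
        linarith
      · have hcont : ContinuousAt (logD2 f) x :=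
          ((k3.continuousAt.div k1.continuousAt hx).sub
            ((k2.continuousAt.div k1.continuousAt hx).pow 2))
        refine ⟨_, nhdsWithin_le_nhds (hcont.eventually (gt_mem_nhds (lt_add_one (logD2 f x)))),
          max 0 (logD2 f x + 1), le_max_left _ _, fun y hy _ => ?_⟩
        exact le_max_of_le_right (le_of_lt hy)
  obtain ⟨A, hA, h1⟩ := key
  refine ⟨A, fun x => (hd x).1, fun x => (hd x).2.1, fun x => (hd x).2.2, h.mono, hA,
    fun x hx => ?_⟩
  have h2 : x = Int.fract x + ⌊x⌋ := (Int.fract_add_floor x).symm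
  rw [h2, h.deriv_add_int] at hx
  rw [h2, h.logD2_add_int]
  exact h1 _ ⟨Int.fract_nonneg x, (Int.fract_lt_one x).le⟩ hx

lemma slopeBd_of_deriv {K ℓ : ℝ} (hd : ∀ x, HasDerivAt f (deriv f x) x)
    (h : ∀ u v, u ≤ v → v - u ≤ ℓ → ∀ ξ ∈ Icc u v, deriv f ξ * (v - u) ≤ K * (f v - f u)) :
    SlopeBd f K ℓ := by
  intro u s t v h1 h2 h3 h4
  obtain ⟨ξ, hξ, e1⟩ := exists_hasDerivAt_eq_slope f (deriv f) h2
    (fun z _ => (hd z).continuousAt.continuousWithinAt) fun y _ => hd y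
  rw [eq_div_iff (by linarith)] at e1
  have := h u v (by linarith) h4 ξ ⟨by linarith [hξ.1], by linarith [hξ.2]⟩
  rw [← e1]
  calc deriv f ξ * (t - s) * (v - u) = deriv f ξ * (v - u) * (t - s) := by ring
    _ ≤ K * (f v - f u) * (t - s) := by
      apply mul_le_mul_of_nonneg_right this; linarith

lemma exists_slopeBd (h : Sys f N d ρ) : ∃ t > 0, SlopeBd f (4 * d) t := by
  obtain ⟨k1, k2, k3, hd⟩ := h.hasDerivAts
  have h1d := h.one_lt_d
  refine (exists_pos_forall_interval
    (fun u v => ∀ ξ ∈ Icc u v, deriv f ξ * (v - u) ≤ 4 * d * (f v - f u)) ?_ ?_).imp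
    fun t ht => ⟨ht.1, slopeBd_of_deriv (fun x => (hd x).1) ht.2⟩
  · intro u v k h2 ξ hξ
    have := h2 (ξ - k) ⟨by linarith [hξ.1], by linarith [hξ.2]⟩
    rw [h.add_int, h.add_int]
    have e := h.deriv_add_int (ξ - k) k
    rw [sub_add_cancel] at e
    rw [e]
    linarith
  · intro x
    by_cases hx : deriv f x = 0
    · obtain ⟨φ, φ1, φ2, φ3, e, r, μ, hed, he, hn⟩ := h.exists_nf hx
      refine ⟨r, hn.r_pos, fun u v hu huv hv ξ hξ => ?_⟩
      refine (hn.deriv_mul_le hx hu hξ.1 hξ.2 hv).trans ?_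
      have : f u ≤ f v := h.mono.monotone huv
      gcongr
    · have hp : 0 < deriv f x := (h.mono.monotone.deriv_nonneg).lt_of_ne (Ne.symm hx)
      obtain ⟨δ, hδ, hb⟩ := Metric.eventually_nhds_iff.1
        (((k1.tendsto x).eventually
          (lt_mem_nhds (show 2 / 3 * deriv f x < deriv f x by linarith))).and
        ((k1.tendsto x).eventually (gt_mem_nhds (show deriv f x < 4 / 3 * deriv f x by linarith))))
      refine ⟨δ, hδ, fun u v hu huv hv ξ hξ => ?_⟩
      have hb' : ∀ y ∈ Icc u v, 2 / 3 * deriv f x < deriv f y ∧ deriv f y < 4 / 3 * deriv f x := by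
        intro y hy
        apply hb
        rw [Real.dist_eq, abs_lt]
        constructor <;> linarith [hy.1, hy.2]
      rcases huv.eq_or_lt with rfl | huv
      · simp
      obtain ⟨η, hη, e1⟩ := exists_hasDerivAt_eq_slope f (deriv f) huv
        h.smooth.continuous.continuousOn fun y _ => (hd y).1
      rw [eq_div_iff (by linarith)] at e1
      rw [← e1, ← mul_assoc]
      apply mul_le_mul_of_nonneg_right _ (by linarith)
      have h2 := (hb' ξ hξ).2
      have h3 := (hb' η (Ioo_subset_Icc_self hη)).1
      have h4 : 4 * deriv f η ≤ 4 * d * deriv f η := by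
        apply mul_le_mul_of_nonneg_right <;> linarith
      linarith

lemma exists_slopeBd_three (h : Sys f N d ρ) : ∃ K ≥ 1, SlopeBd f K 3 := by
  obtain ⟨k1, k2, k3, hd⟩ := h.hasDerivAts
  obtain ⟨t, ht, hs⟩ := h.exists_slopeBd
  have h1d := h.one_lt_d
  obtain ⟨M, hM⟩ : ∃ M, ∀ x, deriv f x ≤ M := by
    obtain ⟨z, -, hz⟩ := isCompact_Icc.exists_isMaxOn (nonempty_Icc.2 zero_le_one)
      (k1.continuousOn (s := Icc (0:ℝ) 1))
    refine ⟨deriv f z, fun x => ?_⟩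
    rw [← Int.fract_add_floor x, h.deriv_add_int]
    exact hz ⟨Int.fract_nonneg x, (Int.fract_lt_one x).le⟩
  obtain ⟨m, hm, hm'⟩ : ∃ m > 0, ∀ x, m ≤ f (x + t) - f x := by
    have hc : Continuous fun x => f (x + t) - f x :=
      (h.smooth.continuous.comp (continuous_add_const t)).sub h.smooth.continuous
    obtain ⟨z, -, hz⟩ := isCompact_Icc.exists_isMinOn (nonempty_Icc.2 zero_le_one)
      (hc.continuousOn (s := Icc (0:ℝ) 1))
    refine ⟨f (z + t) - f z, sub_pos.2 (h.mono (by linarith)), fun x => ?_⟩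
    have := hz (show Int.fract x ∈ _ from ⟨Int.fract_nonneg x, (Int.fract_lt_one x).le⟩)
    have e1 := h.add_int (Int.fract x) ⌊x⌋
    have e2 := h.add_int (Int.fract x + t) ⌊x⌋
    rw [Int.fract_add_floor] at e1
    rw [show Int.fract x + t + ⌊x⌋ = x + t by linarith [Int.fract_add_floor x]] at e2
    simp only [mem_ofPred_eq] at this
    linarith
  have hM0 : 0 ≤ M := (h.mono.monotone.deriv_nonneg (x := 0)).trans (hM 0)
  refine ⟨max (4 * d) (3 * M / m), le_max_of_le_left (by linarith), ?_⟩
  intro u s' t' v h1 h2 h3 h4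
  have hfuv : 0 < f v - f u := sub_pos.2 (h.mono (by linarith))
  have hst : 0 < t' - s' := by linarith
  rcases le_or_gt (v - u) t with h5 | h5
  · refine (hs u s' t' v h1 h2 h3 h5).trans ?_
    gcongr
    exact le_max_left _ _
  · obtain ⟨ξ, hξ, e1⟩ := exists_hasDerivAt_eq_slope f (deriv f) h2
      h.smooth.continuous.continuousOn fun y _ => (hd y).1
    rw [eq_div_iff (by linarith)] at e1
    have h6 : m ≤ f v - f u := (hm' u).trans (by linarith [h.mono (show u + t < v by linarith)])
    calc (f t' - f s') * (v - u) ≤ (M * (t' - s')) * 3 := by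
          rw [← e1]
          have := hM ξ
          gcongr
          linarith
      _ = 3 * M / m * m * (t' - s') := by field_simp
      _ ≤ max (4 * d) (3 * M / m) * (f v - f u) * (t' - s') := by
          gcongr
          exact le_max_right _ _

/-- Uniform local estimates at the critical points. -/
lemma exists_crit (h : Sys f N d ρ) : ∃ t > 0, ∀ c, deriv f c = 0 →
    (∀ x, x ≠ c → |x - c| < t → (x - c) ^ 2 * logD2 f x ≤ -(1 / 2)) ∧
    ∀ s r, 0 < s → s ≤ r → r < t → f (c + s) - f c ≤ 2 ^ d * (s / r) ^ 2 * (f (c + r) - f c) := by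
  obtain ⟨C, -, -, hC⟩ := h.crit
  refine Exists.elim (exists_pos_forall_mem C (fun t c =>
    (∀ x, x ≠ c → |x - c| < t → (x - c) ^ 2 * logD2 f x ≤ -(1 / 2)) ∧
    ∀ s r, 0 < s → s ≤ r → r < t → f (c + s) - f c ≤ 2 ^ d * (s / r) ^ 2 * (f (c + r) - f c))
    (fun s t c hst h2 => ⟨fun x hx hx' => h2.1 x hx (hx'.trans_le hst),
      fun s' r hs' hr hrs => h2.2 s' r hs' hr (hrs.trans_le hst)⟩) ?_) fun t ⟨ht, h1⟩ => ?_
  · intro c hc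
    have hc0 : deriv f c = 0 := (hC c).2 ⟨c, hc, 0, by simp⟩
    obtain ⟨φ, φ1, φ2, φ3, e, r, μ, hed, he, hn⟩ := h.exists_nf hc0
    have hev := hn.eventually_logD2_le he
    rw [eventually_nhdsWithin_iff] at hev
    obtain ⟨δ, hδ, hb⟩ := Metric.eventually_nhds_iff.1 hev
    refine ⟨min δ r, lt_min hδ hn.r_pos, fun x hx hx' => ?_, fun s r' hs hr hrs => ?_⟩
    · exact hb (by rw [Real.dist_eq]; exact hx'.trans_le (min_le_left _ _)) hx
    · exact hn.image_le he hed hs hr (hrs.trans_le (min_le_right _ _))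
  · refine ⟨t, ht, fun c hc => ?_⟩
    obtain ⟨c', hc', k, rfl⟩ := (hC c).1 hc
    obtain ⟨h2, h3⟩ := h1 c' hc'
    constructor
    · intro x hx hxt
      have := h2 (x - k) (fun e => hx (by linarith)) (by convert hxt using 2; ring)
      have e := h.logD2_add_int (x - k) k
      rw [sub_add_cancel] at e
      rw [e]
      convert this using 2
      ring
    · intro s r hs hr hrt
      have := h3 s r hs hr hrt
      rw [show c' + k + s = c' + s + k by ring, show c' + k + r = c' + r + k by ring, h.add_int,
        h.add_int, h.add_int]
      simpa using this

end Sys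
end MCircle

namespace MCircle

/-- Two consecutive closest returns of a multicritical circle map, the first one to the left and
the second one to the right. -/
structure Cfg (f : ℝ → ℝ) (N : ℕ) (d ρ : ℝ) (q : ℕ) (p : ℤ) (q' : ℕ) (p' : ℤ) : Prop where
  sys : Sys f N d ρ
  lev : Lev ρ q p q' p'
  small : 8 * (p - q * ρ) ≤ 1

lemma exists_min_translate (n : ℕ) (hn : 0 < n) (y : ℕ → ℝ) (z : ℝ) :
    ∃ i < n, ∃ b : ℤ, z ≤ y i + b ∧ ∀ k < n, ∀ b' : ℤ, z ≤ y k + b' → y i + b ≤ y k + b' := by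
  obtain ⟨i, hi, hmin⟩ := (Finset.range n).exists_min_image (fun i => y i + ⌈z - y i⌉)
    ⟨0, by simpa using hn⟩
  refine ⟨i, by simpa using hi, ⌈z - y i⌉, by linarith [Int.le_ceil (z - y i)],
    fun k hk b' hb => ?_⟩
  refine (hmin k (by simpa using hk)).trans ?_
  have : ⌈z - y k⌉ ≤ b' := Int.ceil_le.2 (by linarith)
  have : ((⌈z - y k⌉ : ℤ) : ℝ) ≤ b' := by exact_mod_cast this
  linarith

namespace Cfg

variable {f : ℝ → ℝ} {N : ℕ} {d ρ : ℝ} {q : ℕ} {p : ℤ} {q' : ℕ} {p' : ℤ}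

/-- The combination of `i` left moves and `j` right moves of the two returns, up to translation. -/
def mv (X : Cfg f N d ρ q p q' p') (i j : ℤ) : ℝ → ℝ :=
  X.sys.Φ (-i * q + j * q') (i * p - j * p')

/-- The displacement of the first return. -/
def β (_ : Cfg f N d ρ q p q' p') : ℝ := p - q * ρ

/-- The displacement of the second return. -/
def α (_ : Cfg f N d ρ q p q' p') : ℝ := q' * ρ - p'

variable (X : Cfg f N d ρ q p q' p')

lemma α_pos : 0 < X.α := sub_pos.2 X.lev.right_pos
lemma α_lt : X.α < X.β := X.lev.lt
lemma β_pos : 0 < X.β := sub_pos.2 X.lev.left_pos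

lemma disp (i j : ℤ) : ((-i * q + j * q' : ℤ) : ℝ) * ρ + ((i * p - j * p' : ℤ) : ℝ) =
    i * X.β + j * X.α := by
  unfold β α; push_cast; ring

lemma mv_mv (i j i' j' : ℤ) (x : ℝ) : X.mv i j (X.mv i' j' x) = X.mv (i + i') (j + j') x := by
  unfold mv
  rw [X.sys.Φ_Φ]
  congr 1 <;> ring

@[simp] lemma mv_zero (x : ℝ) : X.mv 0 0 x = x := by simp [mv]

lemma mv_lt_mv {i j i' j' : ℤ} (h : i * X.β + j * X.α < i' * X.β + j' * X.α) (x : ℝ) :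
    X.mv i j x < X.mv i' j' x := by
  apply X.sys.Φ_lt_Φ
  rwa [X.disp, X.disp]

lemma mv_le_mv {i j i' j' : ℤ} (h : i * X.β + j * X.α ≤ i' * X.β + j' * X.α) (x : ℝ) :
    X.mv i j x ≤ X.mv i' j' x := by
  apply X.sys.Φ_le_Φ
  rwa [X.disp, X.disp]

lemma lt_mv {i j : ℤ} (h : 0 < i * X.β + j * X.α) (x : ℝ) : x < X.mv i j x := by
  have := X.mv_lt_mv (i := 0) (j := 0) (i' := i) (j' := j) (by simpa using h) x
  rwa [mv_zero] at this

lemma mv_lt {i j : ℤ} (h : i * X.β + j * X.α < 0) (x : ℝ) : X.mv i j x < x := by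
  have := X.mv_lt_mv (i := i) (j := j) (i' := 0) (j' := 0) (by simpa using h) x
  rwa [mv_zero] at this

lemma mv_strictMono (i j : ℤ) : StrictMono (X.mv i j) := X.sys.Φ_strictMono _ _

lemma mv_add_int (i j : ℤ) (x : ℝ) (k : ℤ) : X.mv i j (x + k) = X.mv i j x + k := by
  have h : ∀ x, x + (k : ℝ) = X.sys.Φ 0 k x := fun x => (X.sys.Φ_zero_left k x).symm
  rw [h, h]
  unfold mv
  rw [X.sys.Φ_Φ, X.sys.Φ_Φ]
  congr 1 <;> ring

lemma iter_mv (k : ℕ) (i j : ℤ) (x : ℝ) : f^[k] (X.mv i j x) = X.mv i j (f^[k] x) := by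
  have h : ∀ x, f^[k] x = X.sys.Φ k 0 x := fun x => by rw [X.sys.Φ_natCast]; simp
  rw [h, h]
  unfold mv
  rw [X.sys.Φ_Φ, X.sys.Φ_Φ]
  congr 1 <;> ring

lemma iter_q (x : ℝ) : f^[q] x = X.mv (-1) 0 x + p := by
  unfold mv
  have : X.sys.Φ (-(-1) * q + 0 * q') (-1 * p - 0 * p') x = X.sys.Φ (q : ℤ) (-p) x := by
    congr 1 <;> ring
  rw [this, X.sys.Φ_natCast]; push_cast; ring

lemma iter_q' (x : ℝ) : f^[q'] x = X.mv 0 1 x + p' := by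
  unfold mv
  have : X.sys.Φ (-0 * q + 1 * q') (0 * p - 1 * p') x = X.sys.Φ (q' : ℤ) (-p') x := by
    congr 1 <;> ring
  rw [this, X.sys.Φ_natCast]; push_cast; ring

lemma Φ_eq_of_mv (a b i j : ℤ) (x : ℝ) : X.mv i j (X.sys.Φ a b x) =
    X.sys.Φ (a - i * q + j * q') (b + i * p - j * p') x := by
  unfold mv
  rw [X.sys.Φ_Φ]
  congr 1 <;> ring

lemma mv_eight_le (x : ℝ) : X.mv 8 0 x ≤ x + 1 := by
  have := X.sys.Φ_le_Φ (a := -8 * q + 0 * q') (b := 8 * p - 0 * p') (a' := 0) (b' := 1)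
    (by have := X.small; push_cast; linarith) x
  simpa [mv, X.sys.Φ_zero_left] using this

lemma exists_iterate_mem (x z : ℝ) :
    ∃ i < q + q', ∃ b : ℤ, z ≤ f^[i] x + b ∧ f^[i] x + b < X.mv 1 0 z := by
  have hq := X.lev.q_pos
  have hqq := X.lev.q_lt
  obtain ⟨i, hi, b, h1, h2⟩ := exists_min_translate (q + q') (by omega) (fun i => f^[i] x) z
  refine ⟨i, hi, b, h1, ?_⟩
  by_contra hc
  push Not at hc
  have hE : z ≤ X.mv (-1) 0 (f^[i] x + b) := by
    have := (X.mv_strictMono (-1) 0).monotone hc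
    rw [X.mv_mv] at this
    simpa using this
  rcases lt_or_ge i q' with h3 | h3
  · have e : f^[q + i] x + ((b - p : ℤ) : ℝ) = X.mv (-1) 0 (f^[i] x + b) := by
      rw [Function.iterate_add_apply, X.iter_q, X.mv_add_int]; push_cast; ring
    have := h2 (q + i) (by omega) (b - p) (by rw [e]; exact hE)
    rw [e] at this
    have h5 := X.mv_lt (i := -1) (j := 0) (by have := X.β_pos; push_cast; linarith) (f^[i] x + b)
    linarith
  · have e : f^[i - q'] x + ((b + p' : ℤ) : ℝ) = X.mv 0 (-1) (f^[i] x + b) := by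
      conv_rhs => rw [← Nat.add_sub_cancel' h3, Function.iterate_add_apply, X.iter_q', X.mv_add_int,
        X.mv_add_int, X.mv_mv]
      push_cast; simp; ring
    have h5 := X.mv_lt_mv (i := -1) (j := 0) (i' := 0) (j' := -1)
      (by have := X.α_lt; push_cast; linarith) (f^[i] x + b)
    have := h2 (i - q') (by omega) (b + p') (by rw [e]; linarith)
    rw [e] at this
    have h6 := X.mv_lt (i := 0) (j := -1) (by have := X.α_pos; push_cast; linarith) (f^[i] x + b)
    linarith

lemma exists_preimage_mem (c x : ℝ) :
    ∃ i < q', ∃ b : ℤ, x ≤ X.sys.Φ (-(i : ℤ)) b c ∧ X.sys.Φ (-(i : ℤ)) b c < X.mv 1 1 x := by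
  have hq := X.lev.q_pos
  have hqq := X.lev.q_lt
  have hα := X.α_pos
  have hβ := X.β_pos
  have hadd : ∀ (a b : ℤ), X.sys.Φ a b c = X.sys.Φ a 0 c + b := fun a b => by simp [Sys.Φ]
  obtain ⟨i, hi, b, h1, h2⟩ :=
    exists_min_translate q' (by omega) (fun i => X.sys.Φ (-(i : ℤ)) 0 c) x
  simp only [← hadd] at h1 h2
  refine ⟨i, hi, b, h1, ?_⟩
  by_contra hc
  push Not at hc
  rcases lt_or_ge i q with h3 | h3
  · have h4 := (X.mv_strictMono (-1) (-1)).monotone hc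
    rw [X.mv_mv] at h4
    simp only [Int.reduceNeg, neg_add_cancel, mv_zero] at h4
    have h5 := X.mv_lt (i := -1) (j := -1) (by push_cast; linarith) (X.sys.Φ (-(i : ℤ)) b c)
    have e : X.mv (-1) (-1) (X.sys.Φ (-(i : ℤ)) b c) =
        X.sys.Φ (-((i + (q' - q) : ℕ) : ℤ)) (b - p + p') c := by
      rw [X.Φ_eq_of_mv]
      congr 1
      · push_cast [hqq.le]; ring
      · ring
    rw [e] at h4 h5
    have := h2 _ (by omega) _ h4
    linarith
  · have h4 := (X.mv_strictMono (-1) 0).monotone hc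
    rw [X.mv_mv] at h4
    simp only [Int.reduceNeg, neg_add_cancel, zero_add] at h4
    have h6 := X.lt_mv (i := 0) (j := 1) (by push_cast; linarith) x
    have h5 := X.mv_lt (i := -1) (j := 0) (by push_cast; linarith) (X.sys.Φ (-(i : ℤ)) b c)
    have e : X.mv (-1) 0 (X.sys.Φ (-(i : ℤ)) b c) =
        X.sys.Φ (-((i - q : ℕ) : ℤ)) (b - p) c := by
      rw [X.Φ_eq_of_mv]
      congr 1
      · push_cast [h3]; ring
      · ring
    rw [e] at h4 h5
    have := h2 _ (by omega) _ (h6.le.trans h4)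
    linarith

/-- The first `q'` images of a fundamental interval are disjoint modulo one. -/
lemma eq_of_mem {x u v : ℝ} {i i' : ℕ} {b : ℤ} (hi : i < q') (hi' : i' < q')
    (hu : u ∈ Ico (f^[i] x) (f^[i] (X.mv 1 0 x))) (hv : v ∈ Ico (f^[i'] x) (f^[i'] (X.mv 1 0 x)))
    (h : u + b = v) : i = i' := by
  have main : ∀ (u v : ℝ) (i i' : ℕ) (b : ℤ), i < i' → i' < q' →
      u ∈ Ico (f^[i] x) (f^[i] (X.mv 1 0 x)) → v ∈ Ico (f^[i'] x) (f^[i'] (X.mv 1 0 x)) →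
      u + b = v → False := by
    intro u v i i' b hlt hi' hu hv h
    rw [X.iter_mv] at hu hv
    set y := f^[i] x with hy
    set k := i' - i with hk
    have e : f^[i'] x = X.sys.Φ k 0 y := by
      rw [X.sys.Φ_natCast, hy, ← Function.iterate_add_apply]; simp; congr 2; omega
    rw [e, ← h] at hv
    obtain ⟨h1, h2⟩ := hv
    have hb := X.lev.best k (by omega) (by omega) b
    change X.β ≤ _ at hb
    have e2 : X.mv 1 0 (X.sys.Φ k 0 y) = X.sys.Φ (k - q) p y := by
      rw [X.Φ_eq_of_mv]; congr 1 <;> ring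
    rw [e2] at h2
    have e3 : ∀ (a b : ℤ) (x : ℝ), X.sys.Φ a b x + ((-b : ℤ) : ℝ) = X.sys.Φ a 0 x := fun a b x => by
      simp [Sys.Φ]
    have hadd : ∀ (a b b' : ℤ) (x : ℝ), X.sys.Φ a (b + b') x = X.sys.Φ a b x + b' :=
      fun a b b' x => by simp [Sys.Φ, add_assoc]
    rcases le_abs.1 hb with hb | hb
    · have h3 := X.sys.Φ_le_Φ (a := -q) (b := p) (a' := k) (b' := 0 + -b)
        (by unfold β at hb; push_cast; linarith) y
      rw [hadd] at h3
      have e4 : X.mv 1 0 y = X.sys.Φ (-q) p y := by unfold mv; congr 1 <;> ring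
      push_cast at h3
      rw [e4] at hu
      linarith [hu.2]
    · have h3 := X.sys.Φ_le_Φ (a := k - q) (b := p + -b) (a' := 0) (b' := 0)
        (by unfold β at hb; push_cast; linarith) y
      rw [hadd, X.sys.Φ_zero] at h3
      push_cast at h3
      linarith [hu.1]
  rcases lt_trichotomy i i' with h1 | h1 | h1
  · exact (main u v i i' b h1 hi' hu hv h).elim
  · exact h1
  · exact (main v u i' i (-b) h1 hi hv hu (by push_cast; linarith)).elim

end Cfg
end MCircle

namespace MCircle
namespace Cfg

variable {f : ℝ → ℝ} {N : ℕ} {d ρ : ℝ} {q : ℕ} {p : ℤ} {q' : ℕ} {p' : ℤ}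
variable (X : Cfg f N d ρ q p q' p')

lemma lt_mv_one (x : ℝ) : x < X.mv 1 0 x :=
  X.lt_mv (by have := X.β_pos; push_cast; linarith) x

lemma sum_length_le (x : ℝ) :
    ∑ i ∈ Finset.range q', (f^[i] (X.mv 1 0 x) - f^[i] x) ≤ 1 := by
  have hβ := X.β_pos
  -- move all intervals next to `x`
  set y : ℕ → ℝ := fun i => f^[i] x - ⌊f^[i] x - x⌋ with hy
  have hy0 : ∀ i, x ≤ y i ∧ y i < x + 1 := fun i => by
    have h1 := Int.floor_le (f^[i] x - x)
    have h2 := Int.lt_floor_add_one (f^[i] x - x)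
    simp only [hy]
    constructor <;> linarith
  have hE : ∀ i, X.mv 1 0 (y i) = f^[i] (X.mv 1 0 x) - ⌊f^[i] x - x⌋ := fun i => by
    have := X.mv_add_int 1 0 (f^[i] x) (-⌊f^[i] x - x⌋)
    push_cast at this
    rw [X.iter_mv]; simpa [hy, sub_eq_add_neg] using this
  have hle1 : X.mv 1 0 x ≤ x + 1 :=
    (X.mv_le_mv (i' := 8) (j' := 0) (by push_cast; linarith) x).trans
    (X.mv_eight_le x)
  have hle : ∀ i < q', X.mv 1 0 (y i) ≤ x + 1 := by
    intro i hi
    by_contra hc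
    push Not at hc
    have h0 : i = 0 := by
      refine (X.eq_of_mem (x := x) (u := x) (v := x + 1 + ⌊f^[i] x - x⌋)
        (b := 1 + ⌊f^[i] x - x⌋) (i := 0) (i' := i) (by omega) hi ?_ ?_ ?_).symm
      · exact ⟨le_rfl, X.lt_mv_one x⟩
      · rw [hE] at hc
        refine ⟨?_, by linarith⟩
        have := (hy0 i).2
        simp only [hy] at this
        linarith
      · push_cast; ring
    subst h0
    have : y 0 = x := by simp [hy]
    rw [this] at hc
    linarith
  have hdisj : (Finset.range q' : Set ℕ).PairwiseDisjoint fun i => Ico (y i) (X.mv 1 0 (y i)) := by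
    intro i hi j hj hij
    rw [Function.onFun, Set.disjoint_left]
    intro z hz hz'
    rw [hE] at hz hz'
    simp only [hy, mem_Ico] at hz hz'
    refine hij (X.eq_of_mem (x := x) (u := z + ⌊f^[i] x - x⌋) (v := z + ⌊f^[j] x - x⌋)
      (b := ⌊f^[j] x - x⌋ - ⌊f^[i] x - x⌋) (by simpa using hi) (by simpa using hj) ?_ ?_ ?_)
    · exact ⟨by linarith [hz.1], by linarith [hz.2]⟩
    · exact ⟨by linarith [hz'.1], by linarith [hz'.2]⟩
    · push_cast; ring
  have hvol := MeasureTheory.measure_biUnion_finset (μ := MeasureTheory.volume) hdisj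
    (fun i _ => measurableSet_Ico)
  have hsub : (⋃ i ∈ Finset.range q', Ico (y i) (X.mv 1 0 (y i))) ⊆ Ico x (x + 1) := by
    intro z hz
    simp only [mem_iUnion] at hz
    obtain ⟨i, hi, hz⟩ := hz
    exact ⟨(hy0 i).1.trans hz.1, hz.2.trans_le (hle i (by simpa using hi))⟩
  have h1 := MeasureTheory.measure_mono (μ := MeasureTheory.volume) hsub
  rw [hvol] at h1
  simp only [Real.volume_Ico, add_sub_cancel_left] at h1
  rw [← ENNReal.ofReal_sum_of_nonneg (fun i _ => by linarith [X.lt_mv_one (y i)]),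
    ENNReal.ofReal_le_ofReal_iff zero_le_one] at h1
  refine le_trans (le_of_eq (Finset.sum_congr rfl fun i _ => ?_)) h1
  rw [hE]; simp [hy]

open Classical in
lemma card_crit_le (x : ℝ) :
    ((Finset.range q').filter fun i => ∃ z ∈ Ico (f^[i] x) (f^[i] (X.mv 1 0 x)),
      deriv f z = 0).card ≤ N := by
  obtain ⟨C, -, hN, hC⟩ := X.sys.crit
  refine le_trans ?_ hN
  have h1 : ∀ i : ℕ, (∃ z ∈ Ico (f^[i] x) (f^[i] (X.mv 1 0 x)), deriv f z = 0) →
      ∃ c ∈ C, ∃ k : ℤ, c + (k : ℝ) ∈ Ico (f^[i] x) (f^[i] (X.mv 1 0 x)) := by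
    rintro i ⟨z, hz, h0⟩
    obtain ⟨c, hc, k, rfl⟩ := (hC z).1 h0
    exact ⟨c, hc, k, hz⟩
  choose! g hg k hk using h1
  refine Finset.card_le_card_of_injOn g (fun i hi => hg i (Finset.mem_filter.1 hi).2) ?_
  intro i hi j hj hij
  have hi := Finset.mem_filter.1 hi
  have hj := Finset.mem_filter.1 hj
  refine X.eq_of_mem (x := x) (b := k j - k i) (by simpa using hi.1) (by simpa using hj.1)
    (hk i hi.2) (hk j hj.2) ?_
  rw [hij]; push_cast; ring

/-- Orbit sums of subadditive functions of intervals. -/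
lemma sum_subadditive_le {g : ℝ → ℝ → ℝ} {B : ℝ}
    (hadd : ∀ u v w, u ≤ v → v ≤ w → g u w ≤ g u v + g v w)
    (h0 : ∀ u, g u u = 0)
    (hB : ∀ x, ∑ i ∈ Finset.range q', g (f^[i] x) (f^[i] (X.mv 1 0 x)) ≤ B) (r s : ℕ) (x : ℝ) :
    ∑ i ∈ Finset.range (s * q'), g (f^[i] x) (f^[i] (X.mv r 0 x)) ≤ r * s * B := by
  have hβ := X.β_pos
  have hr : ∀ x, ∑ i ∈ Finset.range q', g (f^[i] x) (f^[i] (X.mv r 0 x)) ≤ r * B := by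
    intro x
    induction r with
    | zero => simp [h0]
    | succ r ih =>
      have h1 : ∑ i ∈ Finset.range q', g (f^[i] x) (f^[i] (X.mv ((r + 1 : ℕ) : ℤ) 0 x)) ≤
          ∑ i ∈ Finset.range q', (g (f^[i] x) (f^[i] (X.mv r 0 x)) +
            g (f^[i] (X.mv r 0 x)) (f^[i] (X.mv 1 0 (X.mv r 0 x)))) := by
        refine Finset.sum_le_sum fun i _ => ?_
        rw [X.mv_mv, zero_add, add_comm (1 : ℤ)]
        have hm := (X.sys.mono.iterate i).monotone
        push_cast
        apply hadd
        · apply hm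
          rw [← X.mv_zero x, X.mv_mv]
          apply X.mv_le_mv
          push_cast; nlinarith
        · apply hm
          apply X.mv_le_mv
          push_cast; linarith
      rw [Finset.sum_add_distrib] at h1
      have := hB (X.mv r 0 x)
      push_cast at h1 ⊢
      linarith
  induction s with
  | zero => simp
  | succ s ih =>
    rw [add_mul, one_mul, Finset.sum_range_add]
    have := hr (f^[s * q'] x)
    simp only [← X.iter_mv, ← Function.iterate_add_apply] at this
    simp only [add_comm (s * q')]
    push_cast
    linarith

/-- Cross ratios in windows are expanded at most by the factor `B`. -/
def CR (B : ℝ) : Prop :=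
  1 ≤ B ∧ ∀ (a b c e : ℝ) (m : ℕ), a < b → b < c → c < e → e ≤ X.mv 8 0 a → m ≤ 4 * q' →
    crossRatio (f^[m] a) (f^[m] b) (f^[m] c) (f^[m] e) ≤ B * crossRatio a b c e

lemma sum_window_le {a e : ℝ} {m : ℕ} (he : e ≤ X.mv 8 0 a) (hm : m ≤ 4 * q') :
    ∑ i ∈ Finset.range m, (f^[i] e - f^[i] a) ≤ 32 := by
  have h1 := X.sum_subadditive_le (g := fun u v => v - u) (B := 1)
    (fun u v w _ _ => by linarith) (fun u => by simp) X.sum_length_le 8 4 a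
  rw [show ((8 : ℕ) : ℝ) * (4 : ℕ) * 1 = 32 by norm_num, Nat.cast_ofNat] at h1
  refine le_trans ?_ h1
  have hβ := X.β_pos
  refine le_trans (Finset.sum_le_sum fun i _ => ?_) (Finset.sum_le_sum_of_subset_of_nonneg
    (Finset.range_mono hm) fun i _ _ => ?_)
  · have := (X.sys.mono.iterate i).monotone he
    linarith
  · have := (X.sys.mono.iterate i) (X.lt_mv (i := 8) (j := 0) (by push_cast; linarith) a)
    linarith

open Classical in
lemma card_window_le {a e : ℝ} {m : ℕ} (he : e ≤ X.mv 8 0 a) (hm : m ≤ 4 * q') :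
    ((Finset.range m).filter fun i => ¬ CritFree f (f^[i] a) (f^[i] e)).card ≤ 32 * N := by
  set g : ℝ → ℝ → ℝ := fun u v => if ∃ z ∈ Ico u v, deriv f z = 0 then 1 else 0 with hg
  have hg0 : ∀ u v, 0 ≤ g u v := fun u v => by simp only [hg]; split_ifs <;> norm_num
  have h1 := X.sum_subadditive_le (g := g) (B := N) ?_ (fun u => by simp [hg]) ?_ 8 4 a
  · norm_num at h1
    have h2 : (((Finset.range m).filter fun i => ¬ CritFree f (f^[i] a) (f^[i] e)).card : ℝ) ≤
        ∑ i ∈ Finset.range (4 * q'), g (f^[i] a) (f^[i] (X.mv 8 0 a)) := by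
      rw [Finset.card_filter]
      push_cast
      refine le_trans (Finset.sum_le_sum fun i _ => ?_) (Finset.sum_le_sum_of_subset_of_nonneg
        (Finset.range_mono hm) fun i _ _ => hg0 _ _)
      by_cases h3 : CritFree f (f^[i] a) (f^[i] e)
      · rw [if_neg (not_not.2 h3)]
        exact hg0 _ _
      · have : ∃ z ∈ Ico (f^[i] a) (f^[i] (X.mv 8 0 a)), deriv f z = 0 := by
          unfold CritFree at h3
          push Not at h3
          obtain ⟨z, hz, h0⟩ := h3
          exact ⟨z, ⟨hz.1.le, hz.2.trans_le ((X.sys.mono.iterate i).monotone he)⟩, h0⟩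
        simp only [hg]
        rw [if_pos h3, if_pos this]
    have h3 := h2.trans h1
    exact_mod_cast h3
  · intro u v w h1 h2
    by_cases h3 : ∃ z ∈ Ico u w, deriv f z = 0
    · have e : g u w = 1 := by simp only [hg]; rw [if_pos h3]
      obtain ⟨z, hz, h0⟩ := h3
      rcases lt_or_ge z v with h4 | h4
      · have : g u v = 1 := by simp only [hg]; rw [if_pos ⟨z, ⟨hz.1, h4⟩, h0⟩]
        linarith [hg0 v w]
      · have : g v w = 1 := by simp only [hg]; rw [if_pos ⟨z, ⟨h4, hz.2⟩, h0⟩]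
        linarith [hg0 u v]
    · have e : g u w = 0 := by simp only [hg]; rw [if_neg h3]
      linarith [hg0 v w, hg0 u v]
  · intro x
    have := X.card_crit_le x
    rw [Finset.card_filter] at this
    have h2 : ((∑ i ∈ Finset.range q', if ∃ z ∈ Ico (f^[i] x) (f^[i] (X.mv 1 0 x)), deriv f z = 0
      then 1 else 0 : ℕ) : ℝ) ≤ N := by exact_mod_cast this
    push_cast at h2
    exact h2

lemma cr_of_slopeBd {A K ℓ : ℝ} (hA : Reg f A) (hK : 1 ≤ K) (hs : SlopeBd f K ℓ)
    (hl : ∀ x, X.mv 8 0 x - x ≤ ℓ) : X.CR (K ^ (64 * N) * Real.exp (A * (32 * ℓ))) := by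
  classical
  have hβ := X.β_pos
  have hℓ : 0 ≤ ℓ := by
    have := X.lt_mv (i := 8) (j := 0) (by push_cast; linarith) 0
    linarith [hl 0]
  have hA0 := hA.nonneg
  refine ⟨one_le_mul_of_one_le_of_one_le (one_le_pow₀ hK) (Real.one_le_exp (by positivity)), ?_⟩
  intro a b c e m h1 h2 h3 he hm
  have hlen : ∀ i, 0 ≤ f^[i] e - f^[i] a ∧ f^[i] e - f^[i] a ≤ ℓ := fun i => by
    have h4 := (X.sys.mono.iterate i).monotone he
    rw [X.iter_mv] at h4
    have := X.sys.mono.iterate i (h1.trans (h2.trans h3))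
    constructor <;> linarith [hl (f^[i] a)]
  refine (hA.crossRatio_iterate_le hs hK h1 h2 h3 m fun i _ => (hlen i).2).trans ?_
  have hc0 := (crossRatio_pos h1 h2 h3).le
  have hcard := X.card_window_le he hm
  have hsum : ∑ i ∈ Finset.range m, (f^[i] e - f^[i] a) ^ 2 ≤ 32 * ℓ := by
    calc _ ≤ ∑ i ∈ Finset.range m, (f^[i] e - f^[i] a) * ℓ := Finset.sum_le_sum fun i _ => by
          rw [sq]; exact mul_le_mul_of_nonneg_left (hlen i).2 (hlen i).1
      _ = (∑ i ∈ Finset.range m, (f^[i] e - f^[i] a)) * ℓ := by rw [Finset.sum_mul]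
      _ ≤ 32 * ℓ := mul_le_mul_of_nonneg_right (X.sum_window_le he hm) hℓ
  apply mul_le_mul_of_nonneg_right _ hc0
  apply mul_le_mul (pow_le_pow_right₀ hK (by omega)) _ (Real.exp_pos _).le (by positivity)
  exact Real.exp_le_exp.2 (mul_le_mul_of_nonneg_left hsum hA0)

end Cfg
end MCircle

namespace MCircle

namespace Sys

variable {f : ℝ → ℝ} {N : ℕ} {d ρ : ℝ}

/-- The distance by which a point is moved. -/
def len (h : Sys f N d ρ) (a b : ℤ) (x : ℝ) : ℝ := |h.Φ a b x - x|

/-- Consecutive moves are comparable. -/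
def RB (h : Sys f N d ρ) (a b : ℤ) (C : ℝ) : Prop :=
  ∀ x, h.len a b (h.Φ a b x) ≤ C * h.len a b x ∧ h.len a b x ≤ C * h.len a b (h.Φ a b x)

lemma len_neg (h : Sys f N d ρ) (a b : ℤ) (x : ℝ) :
    h.len (-a) (-b) (h.Φ a b x) = h.len a b x := by
  unfold len
  rw [h.Φ_Φ, neg_add_cancel, neg_add_cancel, h.Φ_zero, abs_sub_comm]

lemma RB.neg {h : Sys f N d ρ} {a b : ℤ} {C : ℝ} (hr : h.RB a b C) : h.RB (-a) (-b) C := by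
  intro x
  have e : ∀ y, h.len (-a) (-b) y = h.len a b (h.Φ (-a) (-b) y) := fun y => by
    have := h.len_neg a b (h.Φ (-a) (-b) y)
    rwa [h.Φ_Φ, add_neg_cancel, add_neg_cancel, h.Φ_zero] at this
  rw [e, e x]
  have := hr (h.Φ (-a) (-b) (h.Φ (-a) (-b) x))
  have e2 : h.Φ a b (h.Φ (-a) (-b) (h.Φ (-a) (-b) x)) = h.Φ (-a) (-b) x := by
    rw [h.Φ_Φ, add_neg_cancel, add_neg_cancel, h.Φ_zero]
  rw [e2] at this
  exact ⟨this.2, this.1⟩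

lemma len_reflect (h : Sys f N d ρ) (a b : ℤ) (x : ℝ) :
    h.reflect.len a b x = h.len a (-b) (-x) := by
  unfold len
  rw [h.Φ_reflect, ← abs_neg]
  congr 1
  ring

lemma RB.reflect {h : Sys f N d ρ} {a b : ℤ} {C : ℝ} (hr : h.RB a b C) :
    h.reflect.RB a (-b) C := by
  intro x
  have := hr (-x)
  rw [h.len_reflect, h.len_reflect, h.Φ_reflect, neg_neg, neg_neg]
  exact this

lemma RB.of_reflect {h : Sys f N d ρ} {a b : ℤ} {C : ℝ} (hr : h.reflect.RB a b C) :
    h.RB a (-b) C := by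
  intro x
  have := hr (-x)
  rwa [h.len_reflect, h.len_reflect, h.Φ_reflect, neg_neg, neg_neg] at this

lemma Φ_continuous (h : Sys f N d ρ) (a b : ℤ) : Continuous (h.Φ a b) := by
  have hs : Function.Surjective (h.Φ a b) := fun y => ⟨h.Φ (-a) (-b) y, by simp [h.Φ_Φ]⟩
  exact (h.Φ_strictMono a b).monotone.continuous_of_surjective hs

end Sys

lemma crossRatio_le_left {a b c d : ℝ} (h1 : a < b) (h2 : b < c) (h3 : c < d) :
    crossRatio a b c d * (c - a) ≤ b - a := by
  unfold crossRatio
  rw [div_mul_eq_mul_div, div_le_iff₀ (mul_pos (by linarith) (by linarith))]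
  have : (b - a) * (c - a) * (d - c) ≤ (b - a) * (c - a) * (d - b) := by
    apply mul_le_mul_of_nonneg_left (by linarith)
    exact mul_nonneg (by linarith) (by linarith)
  linarith

lemma crossRatio_le_right {a b c d : ℝ} (h1 : a < b) (h2 : b < c) (h3 : c < d) :
    crossRatio a b c d * (d - b) ≤ d - c := by
  unfold crossRatio
  rw [div_mul_eq_mul_div, div_le_iff₀ (mul_pos (by linarith) (by linarith))]
  have : (d - c) * (d - b) * (b - a) ≤ (d - c) * (d - b) * (c - a) := by
    apply mul_le_mul_of_nonneg_left (by linarith)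
    exact mul_nonneg (by linarith) (by linarith)
  linarith

/-- A lower bound for a cross ratio whose gaps are comparable. -/
lemma le_crossRatio {a b c d s t : ℝ} (h1 : a < b) (h2 : b < c) (h3 : c < d)
    (ht : 0 ≤ t) (h4 : s * (c - a) ≤ b - a) (h5 : t * (d - b) ≤ d - c) :
    s * t ≤ crossRatio a b c d := by
  unfold crossRatio
  rw [le_div_iff₀ (mul_pos (by linarith) (by linarith))]
  calc s * t * ((c - a) * (d - b)) = (s * (c - a)) * (t * (d - b)) := by ring
    _ ≤ (b - a) * (d - c) := mul_le_mul h4 h5 (mul_nonneg ht (by linarith)) (by linarith)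

lemma crossRatio_add (a b c d k : ℝ) :
    crossRatio (a + k) (b + k) (c + k) (d + k) = crossRatio a b c d := by
  simp only [crossRatio, add_sub_add_right_eq_sub]

namespace Cfg

variable {f : ℝ → ℝ} {N : ℕ} {d ρ : ℝ} {q : ℕ} {p : ℤ} {q' : ℕ} {p' : ℤ}
variable (X : Cfg f N d ρ q p q' p')

/-- The length of the fundamental interval at `x`. -/
def gap (x : ℝ) : ℝ := X.mv 1 0 x - x

lemma gap_pos (x : ℝ) : 0 < X.gap x := sub_pos.2 (X.lt_mv_one x)

lemma gap_eq_len (x : ℝ) : X.gap x = X.sys.len (-q) p x := by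
  unfold Sys.len
  have e : X.sys.Φ (-q) p x = X.mv 1 0 x := by unfold mv; congr 1 <;> ring
  rw [e]; exact (abs_of_pos (X.gap_pos x)).symm

lemma gap_mv (n : ℤ) (x : ℝ) : X.gap (X.mv n 0 x) = X.mv (n + 1) 0 x - X.mv n 0 x := by
  unfold gap
  rw [X.mv_mv, zero_add, add_comm]

lemma exists_min_gap : ∃ z, ∀ x, X.gap z ≤ X.gap x := by
  have hc : Continuous X.gap := (X.sys.Φ_continuous _ _).sub continuous_id
  obtain ⟨z, -, hz⟩ := isCompact_Icc.exists_isMinOn (nonempty_Icc.2 zero_le_one)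
    (hc.continuousOn (s := Icc (0 : ℝ) 1))
  refine ⟨z, fun x => ?_⟩
  have h1 := hz (show Int.fract x ∈ _ from ⟨Int.fract_nonneg x, (Int.fract_lt_one x).le⟩)
  have h2 : X.gap (Int.fract x) = X.gap x := by
    conv_rhs => rw [← Int.fract_add_floor x]
    unfold gap
    rw [X.mv_add_int]; ring
  rw [← h2]; exact h1

lemma CR.gap_mv_one_le {X : Cfg f N d ρ q p q' p'} {B : ℝ} (hB : X.CR B) (x : ℝ) :
    X.gap (X.mv 1 0 x) ≤ B * (2 + 4 * B) ^ 2 * X.gap x ∧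
      X.gap (X.mv 1 0 x) ≤ B * (2 + 4 * B) ^ 2 * X.gap (X.mv 2 0 x) := by
  obtain ⟨hB1, hB⟩ := hB
  have hβ := X.β_pos
  have hqq := X.lev.q_lt
  obtain ⟨z, hz⟩ := X.exists_min_gap
  have hlt : ∀ (n : ℤ) (x : ℝ), X.mv n 0 x < X.mv (n + 1) 0 x := fun n x =>
    X.mv_lt_mv (by push_cast; linarith) x
  have hw : ∀ x, X.mv 3 0 x ≤ X.mv 8 0 x := fun x => X.mv_le_mv (by push_cast; linarith) x
  -- cross ratios of consecutive points
  set Q : ℝ → ℝ := fun x => crossRatio x (X.mv 1 0 x) (X.mv 2 0 x) (X.mv 3 0 x) with hQ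
  have hl1 : ∀ x, x < X.mv 1 0 x := X.lt_mv_one
  have hl2 : ∀ x, X.mv 1 0 x < X.mv 2 0 x := hlt 1
  have hl3 : ∀ x, X.mv 2 0 x < X.mv 3 0 x := hlt 2
  have hpull : ∀ (x : ℝ) (m : ℕ) (k : ℤ), m ≤ 4 * q' → Q (f^[m] x + k) ≤ B * Q x := by
    intro x m k hm
    have := hB x _ _ _ m (hl1 x) (hl2 x) (hl3 x) (hw x) hm
    simp only [hQ, X.mv_add_int, crossRatio_add]
    rwa [X.iter_mv, X.iter_mv, X.iter_mv] at this
  have hlow : ∀ x t, 0 ≤ t → X.gap (X.mv 1 0 x) ≤ t * X.gap z → 1 / (1 + t) ^ 2 ≤ Q x := by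
    intro x t ht hg
    have h1 := hz x
    have h2 := hz (X.mv 2 0 x)
    have e1 : X.gap x = X.mv 1 0 x - x := rfl
    have e2 : X.gap (X.mv 1 0 x) = X.mv 2 0 x - X.mv 1 0 x := X.gap_mv 1 x
    have e3 : X.gap (X.mv 2 0 x) = X.mv 3 0 x - X.mv 2 0 x := X.gap_mv 2 x
    have h3 : t * X.gap z ≤ t * X.gap x := by gcongr
    have h4 : t * X.gap z ≤ t * X.gap (X.mv 2 0 x) := by gcongr
    rw [e1] at h3
    rw [e3] at h4
    rw [e2] at hg
    have e : 1 / (1 + t) ^ 2 = 1 / (1 + t) * (1 / (1 + t)) := by field_simp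
    rw [e]
    apply le_crossRatio (hl1 x) (hl2 x) (hl3 x) (by positivity)
    · rw [one_div_mul_eq_div, div_le_iff₀ (by linarith)]; nlinarith
    · rw [one_div_mul_eq_div, div_le_iff₀ (by linarith)]; nlinarith
  have hgz := X.gap_pos z
  -- the interval after the minimal one
  have hz1 : X.gap (X.mv 1 0 z) ≤ 4 * B * X.gap z := by
    have h1 := hpull z q (-p) (by omega)
    rw [X.iter_q] at h1
    push_cast at h1
    rw [add_neg_cancel_right] at h1
    have h2 := hlow (X.mv (-1) 0 z) 1 zero_le_one (by rw [X.mv_mv]; simp)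
    have h3 := crossRatio_le_left (hl1 z) (hl2 z) (hl3 z)
    change Q z * _ ≤ _ at h3
    have e2 : X.gap (X.mv 1 0 z) = X.mv 2 0 z - X.mv 1 0 z := X.gap_mv 1 z
    rw [e2]
    have h4 : 1 ≤ 4 * B * Q z := by linarith
    have h5 := hl1 z
    have h6 := hl2 z
    have h7 : X.gap z = X.mv 1 0 z - z := rfl
    calc X.mv 2 0 z - X.mv 1 0 z ≤ 1 * (X.mv 2 0 z - z) := by linarith
      _ ≤ 4 * B * Q z * (X.mv 2 0 z - z) := by
        apply mul_le_mul_of_nonneg_right h4; linarith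
      _ = 4 * B * (Q z * (X.mv 2 0 z - z)) := by ring
      _ ≤ 4 * B * X.gap z := by rw [h7]; gcongr
  have hy : ∀ y, z ≤ y → y < X.mv 1 0 z → X.gap y ≤ (1 + 4 * B) * X.gap z := by
    intro y h1 h2
    have h3 := (X.mv_strictMono 1 0) h2
    have h4 : X.gap y = X.mv 1 0 y - y := rfl
    have h5 : X.gap z = X.mv 1 0 z - z := rfl
    have h6 : X.gap (X.mv 1 0 z) = X.mv 1 0 (X.mv 1 0 z) - X.mv 1 0 z := rfl
    linarith
  obtain ⟨i, hi, b, h1, h2⟩ := X.exists_iterate_mem (X.mv 1 0 x) z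
  have h3 := hlow (f^[i] x + b) (1 + 4 * B) (by linarith) (by
    rw [X.mv_add_int, ← X.iter_mv]; exact hy _ h1 h2)
  have h4 := hpull x i b (by omega)
  have h5 : 1 ≤ B * (2 + 4 * B) ^ 2 * Q x := by
    have : 1 / (1 + (1 + 4 * B)) ^ 2 ≤ B * Q x := h3.trans h4
    rw [div_le_iff₀ (by positivity)] at this
    calc (1 : ℝ) ≤ B * Q x * (1 + (1 + 4 * B)) ^ 2 := this
      _ = _ := by ring
  have h6 := crossRatio_le_left (hl1 x) (hl2 x) (hl3 x)
  have h7 := crossRatio_le_right (hl1 x) (hl2 x) (hl3 x)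
  change Q x * _ ≤ _ at h6 h7
  have k1 := hl1 x
  have k2 := hl2 x
  have k3 := hl3 x
  have e1 : X.gap x = X.mv 1 0 x - x := rfl
  have e2 : X.gap (X.mv 1 0 x) = X.mv 2 0 x - X.mv 1 0 x := X.gap_mv 1 x
  have hC : 0 ≤ B * (2 + 4 * B) ^ 2 := by positivity
  constructor
  · calc X.gap (X.mv 1 0 x) ≤ 1 * (X.mv 2 0 x - x) := by linarith
      _ ≤ B * (2 + 4 * B) ^ 2 * Q x * (X.mv 2 0 x - x) := by
        apply mul_le_mul_of_nonneg_right h5; linarith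
      _ = B * (2 + 4 * B) ^ 2 * (Q x * (X.mv 2 0 x - x)) := by ring
      _ ≤ _ := mul_le_mul_of_nonneg_left (by linarith) hC
  · have e3 : X.gap (X.mv 2 0 x) = X.mv 3 0 x - X.mv 2 0 x := X.gap_mv 2 x
    calc X.gap (X.mv 1 0 x) ≤ 1 * (X.mv 3 0 x - X.mv 1 0 x) := by linarith
      _ ≤ B * (2 + 4 * B) ^ 2 * Q x * (X.mv 3 0 x - X.mv 1 0 x) := by
        apply mul_le_mul_of_nonneg_right h5; linarith
      _ = B * (2 + 4 * B) ^ 2 * (Q x * (X.mv 3 0 x - X.mv 1 0 x)) := by ring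
      _ ≤ _ := mul_le_mul_of_nonneg_left (by linarith) hC

/-- Consecutive fundamental intervals are comparable. -/
lemma CR.gap_le {X : Cfg f N d ρ q p q' p'} {B : ℝ} (hB : X.CR B) (x : ℝ) :
    X.gap (X.mv 1 0 x) ≤ B * (2 + 4 * B) ^ 2 * X.gap x ∧
      X.gap x ≤ B * (2 + 4 * B) ^ 2 * X.gap (X.mv 1 0 x) := by
  refine ⟨(hB.gap_mv_one_le x).1, ?_⟩
  have := (hB.gap_mv_one_le (X.mv (-1) 0 x)).2
  rw [X.mv_mv, X.mv_mv] at this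
  simpa using this

lemma CR.rb {X : Cfg f N d ρ q p q' p'} {B : ℝ} (hB : X.CR B) :
    X.sys.RB (-q) p (B * (2 + 4 * B) ^ 2) := by
  intro x
  have e : X.sys.Φ (-q) p x = X.mv 1 0 x := by unfold mv; congr 1 <;> ring
  rw [e, ← X.gap_eq_len, ← X.gap_eq_len]
  exact hB.gap_le x

lemma rb_gap {C : ℝ} (hE : X.sys.RB (-q) p C) (x : ℝ) :
    X.gap (X.mv 1 0 x) ≤ C * X.gap x ∧ X.gap x ≤ C * X.gap (X.mv 1 0 x) := by
  have e : X.sys.Φ (-q) p x = X.mv 1 0 x := by unfold mv; congr 1 <;> ring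
  have := hE x
  rwa [e, ← X.gap_eq_len, ← X.gap_eq_len] at this

/-- Fundamental intervals based at points of one of them are comparable. -/
lemma rb_gap_mem {C : ℝ} (hE : X.sys.RB (-q) p C) {w y : ℝ} (h1 : w ≤ y)
    (h2 : y ≤ X.mv 1 0 w) :
    X.gap w ≤ (1 + C) * X.gap y ∧ X.gap y ≤ (1 + C) * X.gap w := by
  have h3 := (X.mv_strictMono 1 0).monotone h1
  have h4 := (X.mv_strictMono 1 0).monotone h2
  have h5 := (X.rb_gap hE (X.mv (-1) 0 y)).2
  have h7 := (X.mv_strictMono (-1) 0).monotone h2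
  rw [X.mv_mv] at h5 h7
  norm_num at h5 h7
  have h6 := (X.rb_gap hE w).1
  have e1 : X.gap y = X.mv 1 0 y - y := rfl
  have e2 : X.gap w = X.mv 1 0 w - w := rfl
  have e3 : X.gap (X.mv 1 0 w) = X.mv 1 0 (X.mv 1 0 w) - X.mv 1 0 w := rfl
  have e4 : X.gap (X.mv (-1) 0 y) = y - X.mv (-1) 0 y := by
    unfold gap; rw [X.mv_mv]; norm_num
  constructor <;> linarith

end Cfg
end MCircle

namespace MCircle
namespace Cfg

variable {f : ℝ → ℝ} {N : ℕ} {d ρ : ℝ} {q : ℕ} {p : ℤ} {q' : ℕ} {p' : ℤ}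
variable (X : Cfg f N d ρ q p q' p')

/-- The length of the second fundamental interval at `x`. -/
def ggap (x : ℝ) : ℝ := X.mv 0 1 x - x

lemma lt_mv_one' (x : ℝ) : x < X.mv 0 1 x :=
  X.lt_mv (by have := X.α_pos; push_cast; linarith) x

lemma ggap_pos (x : ℝ) : 0 < X.ggap x := sub_pos.2 (X.lt_mv_one' x)

lemma ggap_lt_gap (x : ℝ) : X.ggap x < X.gap x := by
  have : X.mv 0 1 x < X.mv 1 0 x := X.mv_lt_mv (by have := X.α_lt; push_cast; linarith) x
  unfold ggap gap
  linarith

lemma ggap_eq_len (x : ℝ) : X.ggap x = X.sys.len q' (-p') x := by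
  unfold Sys.len
  have e : X.sys.Φ q' (-p') x = X.mv 0 1 x := by unfold mv; congr 1 <;> ring
  rw [e]; exact (abs_of_pos (X.ggap_pos x)).symm

/-- The standing estimates on a configuration. -/
structure Fine (B C A t ℓ : ℝ) : Prop where
  cr : X.CR B
  one_le : 1 ≤ C
  rbE : X.sys.RB (-q) p C
  rbG : X.sys.RB q' (-p') C
  reg : Reg f A
  crit : ∀ c, deriv f c = 0 → (∀ x, x ≠ c → |x - c| < t → (x - c) ^ 2 * logD2 f x ≤ -(1 / 2)) ∧
    ∀ s r, 0 < s → s ≤ r → r < t → f (c + s) - f c ≤ 2 ^ d * (s / r) ^ 2 * (f (c + r) - f c)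
  win : ∀ x, X.mv 8 0 x - x ≤ ℓ
  lt : ℓ < t

/-- The second fundamental interval at `y` contains a critical point of the second return. -/
def Spot (y : ℝ) : Prop := ∃ u ∈ Ico y (X.mv 0 1 y), ∃ i < q', deriv f (f^[i] u) = 0

variable {X} {B C A t ℓ : ℝ}

namespace Fine

lemma gap (F : X.Fine B C A t ℓ) (x : ℝ) :
    X.gap (X.mv 1 0 x) ≤ C * X.gap x ∧ X.gap x ≤ C * X.gap (X.mv 1 0 x) := X.rb_gap F.rbE x

lemma ggap (F : X.Fine B C A t ℓ) (x : ℝ) :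
    X.ggap (X.mv 0 1 x) ≤ C * X.ggap x ∧ X.ggap x ≤ C * X.ggap (X.mv 0 1 x) := by
  have e : X.sys.Φ q' (-p') x = X.mv 0 1 x := by unfold mv; congr 1 <;> ring
  have := F.rbG x
  rwa [e, ← X.ggap_eq_len, ← X.ggap_eq_len] at this

lemma ggap_iter (F : X.Fine B C A t ℓ) (n : ℕ) : ∀ x,
    X.ggap (X.mv 0 n x) ≤ C ^ n * X.ggap x ∧ X.ggap x ≤ C ^ n * X.ggap (X.mv 0 n x) := by
  have hC := F.one_le
  induction n with
  | zero => intro x; simp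
  | succ n ih =>
    intro x
    obtain ⟨h1, h2⟩ := ih x
    obtain ⟨h3, h4⟩ := F.ggap (X.mv 0 n x)
    have e : X.mv 0 1 (X.mv 0 n x) = X.mv 0 ((n + 1 : ℕ) : ℤ) x := by
      rw [X.mv_mv, zero_add]; push_cast; rw [add_comm]
    rw [e] at h3 h4
    constructor
    · calc _ ≤ C * X.ggap (X.mv 0 n x) := h3
        _ ≤ C * (C ^ n * X.ggap x) := by gcongr
        _ = _ := by ring
    · calc _ ≤ C ^ n * X.ggap (X.mv 0 n x) := h2
        _ ≤ C ^ n * (C * X.ggap (X.mv 0 ((n + 1 : ℕ) : ℤ) x)) := by gcongr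
        _ = _ := by ring

lemma gap_near (F : X.Fine B C A t ℓ) (n : ℕ) : ∀ y z, y ≤ z → z ≤ X.mv n 0 y →
    X.gap y ≤ (1 + C) ^ n * X.gap z ∧ X.gap z ≤ (1 + C) ^ n * X.gap y := by
  have hC := F.one_le
  induction n with
  | zero =>
    intro y z h1 h2
    have : y = z := le_antisymm h1 (by simpa using h2)
    simp [this]
  | succ n ih =>
    intro y z h1 h2
    have e : X.mv n 0 (X.mv 1 0 y) = X.mv ((n + 1 : ℕ) : ℤ) 0 y := by
      rw [X.mv_mv, zero_add]; push_cast; rfl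
    have hn : 1 ≤ (1 + C) ^ n := one_le_pow₀ (by linarith)
    have py := X.gap_pos y
    have pz := X.gap_pos z
    rcases le_total z (X.mv 1 0 y) with hz | hz
    · obtain ⟨h3, h4⟩ := X.rb_gap_mem F.rbE h1 hz
      constructor
      · calc _ ≤ 1 * ((1 + C) * X.gap z) := by linarith
          _ ≤ (1 + C) ^ n * ((1 + C) * X.gap z) := by gcongr
          _ = _ := by ring
      · calc _ ≤ 1 * ((1 + C) * X.gap y) := by linarith
          _ ≤ (1 + C) ^ n * ((1 + C) * X.gap y) := by gcongr
          _ = _ := by ring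
    · obtain ⟨h3, h4⟩ := ih _ z hz (by rw [e]; exact h2)
      obtain ⟨h5, h6⟩ := F.gap y
      constructor
      · calc _ ≤ C * X.gap (X.mv 1 0 y) := h6
          _ ≤ (1 + C) * ((1 + C) ^ n * X.gap z) := by
            apply mul_le_mul (by linarith) h3 (X.gap_pos _).le (by linarith)
          _ = _ := by ring
      · calc _ ≤ (1 + C) ^ n * X.gap (X.mv 1 0 y) := h4
          _ ≤ (1 + C) ^ n * ((1 + C) * X.gap y) := by gcongr; linarith
          _ = _ := by ring

lemma mv_sub_le (F : X.Fine B C A t ℓ) (n : ℕ) (y : ℝ) :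
    X.mv n 0 y - y ≤ n * (1 + C) ^ n * X.gap y := by
  have hC := F.one_le
  have hβ := X.β_pos
  have : ∀ m ≤ n, X.mv m 0 y - y ≤ m * (1 + C) ^ n * X.gap y := by
    intro m
    induction m with
    | zero => intro _; simp
    | succ m ih =>
      intro hm
      have h1 := ih (by omega)
      have h2 := (F.gap_near n y (X.mv m 0 y) ?_ ?_).2
      · rw [X.gap_mv] at h2
        push_cast at h1 ⊢
        linarith
      · have := X.mv_le_mv (i := 0) (j := 0) (i' := m) (j' := 0) (by push_cast; nlinarith) y
        rwa [X.mv_zero] at this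
      · apply X.mv_le_mv
        have : (m : ℝ) ≤ n := by exact_mod_cast (by omega : m ≤ n)
        push_cast; nlinarith
  exact this n le_rfl

/-- At a critical point the second fundamental interval is not small. -/
lemma crit_gap (F : X.Fine B C A t ℓ) {c : ℝ} (hc : deriv f c = 0) :
    X.gap c ≤ C * (1 + C) ^ 2 * B * 2 ^ d * X.ggap c := by
  obtain ⟨hB1, hB⟩ := F.cr
  have hC := F.one_le
  have hα := X.α_pos
  have hαβ := X.α_lt
  have hq := X.lev.q_pos
  have hqq := X.lev.q_lt
  have hβ := X.β_pos
  have l1 := X.lt_mv_one' c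
  have l2 : X.mv 0 1 c < X.mv 1 0 c := X.mv_lt_mv (by push_cast; linarith) c
  have l3 : X.mv 1 0 c < X.mv 2 0 c := X.mv_lt_mv (by push_cast; linarith) c
  have l4 : X.mv 2 0 c ≤ X.mv 8 0 c := X.mv_le_mv (by push_cast; linarith) c
  have pc := X.gap_pos c
  have pg := X.ggap_pos c
  have hw := F.win c
  have ht := F.lt
  have mono := F.reg.mono
  -- the cross ratio after one iterate
  have k1 := (F.crit c hc).2 (X.ggap c) (X.gap c) pg (X.ggap_lt_gap c).le
    (by unfold Cfg.gap; linarith)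
  have e1 : c + X.ggap c = X.mv 0 1 c := by unfold Cfg.ggap; ring
  have e2 : c + X.gap c = X.mv 1 0 c := by unfold Cfg.gap; ring
  rw [e1, e2] at k1
  set η := X.ggap c / X.gap c with hη
  have pη : 0 < η := div_pos pg pc
  have f1 := mono l1
  have f2 := mono l2
  have f3 := mono l3
  have k2 : crossRatio (f c) (f (X.mv 0 1 c)) (f (X.mv 1 0 c)) (f (X.mv 2 0 c)) ≤
      2 ^ d * η ^ 2 := by
    unfold crossRatio
    rw [div_le_iff₀ (mul_pos (by linarith) (by linarith)), ← mul_assoc]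
    apply mul_le_mul k1 (by linarith) (by linarith)
    have : 0 ≤ f (X.mv 1 0 c) - f c := by linarith
    positivity
  -- the cross ratio at the return time
  have k3 := hB _ _ _ _ (q' - 1) f1 f2 f3 (by
    rw [← (show f (X.mv 8 0 c) = X.mv 8 0 (f c) from X.iter_mv 1 8 0 c)]
    exact mono.monotone l4) (by omega)
  have e3 : ∀ x, f^[q' - 1] (f x) = X.mv 0 1 x + p' := fun x => by
    rw [← Function.iterate_succ_apply, Nat.succ_eq_add_one, Nat.sub_add_cancel (by omega),
      X.iter_q']
  simp only [e3, crossRatio_add] at k3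
  set z := X.mv 0 1 c with hz
  have m1 := (X.mv_strictMono 0 1) l1
  have m2 := (X.mv_strictMono 0 1) l2
  have m3 := (X.mv_strictMono 0 1) l3
  have c1 : X.mv 0 1 (X.mv 1 0 c) = X.mv 1 0 z := by rw [hz, X.mv_mv, X.mv_mv]; rfl
  have c2 : X.mv 0 1 (X.mv 2 0 c) = X.mv 1 0 (X.mv 1 0 z) := by
    rw [hz, X.mv_mv, X.mv_mv, X.mv_mv]; rfl
  rw [c1] at m2
  rw [c1, c2] at m3
  rw [c1, c2] at k3
  have g1 : X.gap z = X.mv 1 0 z - z := rfl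
  have g2 : X.gap (X.mv 1 0 z) = X.mv 1 0 (X.mv 1 0 z) - X.mv 1 0 z := rfl
  have g3 : X.ggap z = X.mv 0 1 z - z := rfl
  have g4 := F.gap z
  have g5 := F.ggap c
  have g6 := (X.rb_gap_mem F.rbE l1.le l2.le).2
  rw [← hz] at g5
  have pz := X.gap_pos z
  have pz' := X.gap_pos (X.mv 1 0 z)
  have e4 : X.ggap c = η * X.gap c := by rw [hη]; field_simp
  have k4 := le_crossRatio (s := η / (C * (1 + C))) (t := 1 / (1 + C)) m1 m2 m3 (by positivity)
    (by
      rw [div_mul_eq_mul_div, div_le_iff₀ (by positivity), ← g1, ← g3]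
      calc η * X.gap z ≤ η * ((1 + C) * X.gap c) := by gcongr
        _ = (1 + C) * X.ggap c := by rw [e4]; ring
        _ ≤ (1 + C) * (C * X.ggap z) := by gcongr; exact g5.2
        _ = _ := by ring)
    (by rw [div_mul_eq_mul_div, div_le_iff₀ (by positivity), ← g2]; linarith)
  have k5 : η / (C * (1 + C)) * (1 / (1 + C)) ≤ B * (2 ^ d * η ^ 2) :=
    (k4.trans k3).trans (by gcongr)
  have k6 : 1 ≤ C * (1 + C) ^ 2 * B * 2 ^ d * η := by
    rw [div_mul_div_comm, mul_one, div_le_iff₀ (by positivity)] at k5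
    have : η * 1 ≤ η * (C * (1 + C) ^ 2 * B * 2 ^ d * η) := by linarith
    exact le_of_mul_le_mul_left this pη
  calc X.gap c = 1 * X.gap c := by ring
    _ ≤ C * (1 + C) ^ 2 * B * 2 ^ d * η * X.gap c := by gcongr
    _ = _ := by rw [e4]; ring

/-- Near a critical spot the second fundamental interval is not small. -/
lemma spot_gap (F : X.Fine B C A t ℓ) {y : ℝ} (hy : X.Spot y) :
    X.gap y ≤ (1 + C) ^ 5 * C * B ^ 2 * 2 ^ d * X.ggap y := by
  obtain ⟨hB1, hB⟩ := F.cr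
  have hC := F.one_le
  have hα := X.α_pos
  have hαβ := X.α_lt
  have hβ := X.β_pos
  obtain ⟨u, hu, i, hi, hc⟩ := hy
  have l1 := X.lt_mv_one' u
  have l2 : X.mv 0 1 u < X.mv 1 0 u := X.mv_lt_mv (by push_cast; linarith) u
  have l3 : X.mv 1 0 u < X.mv 2 0 u := X.mv_lt_mv (by push_cast; linarith) u
  have l4 : X.mv 2 0 u ≤ X.mv 8 0 u := X.mv_le_mv (by push_cast; linarith) u
  have k1 := hB u _ _ _ i l1 l2 l3 l4 (by omega)
  have mono := F.reg.mono.iterate i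
  have m1 := mono l1
  have m2 := mono l2
  have m3 := mono l3
  simp only [X.iter_mv] at k1 m1 m2 m3
  set c := f^[i] u
  have g1 : X.gap c = X.mv 1 0 c - c := rfl
  have g2 : X.gap (X.mv 1 0 c) = X.mv 2 0 c - X.mv 1 0 c := X.gap_mv 1 c
  have g3 : X.ggap c = X.mv 0 1 c - c := rfl
  have h1 := F.crit_gap hc
  have h2 := F.gap c
  set K := C * (1 + C) ^ 2 * B * 2 ^ d with hK
  have pK : 0 < K := by positivity
  have k2 := le_crossRatio (s := 1 / K) (t := 1 / (1 + C)) m1 m2 m3 (by positivity)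
    (by rw [div_mul_eq_mul_div, div_le_iff₀ pK, ← g1, ← g3]; linarith)
    (by rw [div_mul_eq_mul_div, div_le_iff₀ (by positivity), ← g2]; linarith)
  have k3 := crossRatio_le_left l1 l2 l3
  have k4 := k2.trans k1
  set Q := crossRatio u (X.mv 0 1 u) (X.mv 1 0 u) (X.mv 2 0 u)
  have pu : X.gap u = X.mv 1 0 u - u := rfl
  have pg : X.ggap u = X.mv 0 1 u - u := rfl
  have k5 : X.gap u ≤ K * (1 + C) * B * X.ggap u := by
    rw [div_mul_div_comm, one_mul, div_le_iff₀ (by positivity)] at k4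
    have h3 := X.gap_pos u
    calc X.gap u = 1 * X.gap u := by ring
      _ ≤ B * Q * (K * (1 + C)) * X.gap u := by gcongr
      _ = K * (1 + C) * B * (Q * X.gap u) := by ring
      _ ≤ _ := by rw [pg, pu]; gcongr
  have k6 : X.gap y ≤ (1 + C) * X.gap u := by
    have : X.mv 0 1 y < X.mv 1 0 y := X.mv_lt_mv (by push_cast; linarith) y
    exact (X.rb_gap_mem F.rbE hu.1 (hu.2.trans this).le).1
  have k7 : X.ggap u ≤ (1 + C) * X.ggap y := by
    have h4 := (X.mv_strictMono 0 1) hu.2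
    have h5 := (F.ggap y).1
    have e1 : X.ggap y = X.mv 0 1 y - y := rfl
    have e2 : X.ggap (X.mv 0 1 y) = X.mv 0 1 (X.mv 0 1 y) - X.mv 0 1 y := rfl
    have := hu.1
    linarith
  calc X.gap y ≤ (1 + C) * X.gap u := k6
    _ ≤ (1 + C) * (K * (1 + C) * B * X.ggap u) := by gcongr
    _ ≤ (1 + C) * (K * (1 + C) * B * ((1 + C) * X.ggap y)) := by gcongr
    _ = _ := by rw [hK]; ring

end Fine
end Cfg
end MCircle

namespace MCircle
namespace Cfg

variable {f : ℝ → ℝ} {N : ℕ} {d ρ : ℝ} {q : ℕ} {p : ℤ} {q' : ℕ} {p' : ℤ}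
variable (X : Cfg f N d ρ q p q' p')

/-- The orbit under the second return, starting at `w`. -/
def orb (w : ℝ) (k : ℕ) : ℝ := X.mv 0 k w

lemma orb_lt (w : ℝ) {j k : ℕ} (h : j < k) : X.orb w j < X.orb w k := by
  apply X.mv_lt_mv
  have : (j : ℝ) < k := by exact_mod_cast h
  have := mul_lt_mul_of_pos_right this X.α_pos
  simpa using this

lemma orb_le (w : ℝ) {j k : ℕ} (h : j ≤ k) : X.orb w j ≤ X.orb w k := by
  rcases h.lt_or_eq with h | h
  · exact (X.orb_lt w h).le
  · rw [h]

lemma mv_orb (w : ℝ) (k : ℕ) : X.mv 0 1 (X.orb w k) = X.orb w (k + 1) := by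
  unfold orb
  rw [X.mv_mv, zero_add]; push_cast; rw [add_comm]

lemma ggap_orb (w : ℝ) (k : ℕ) : X.ggap (X.orb w k) = X.orb w (k + 1) - X.orb w k := by
  rw [← X.mv_orb]; rfl

lemma orb_zero (w : ℝ) : X.orb w 0 = w := X.mv_zero w

lemma orb_orb (w : ℝ) (j k : ℕ) : X.orb (X.orb w j) k = X.orb w (j + k) := by
  unfold orb
  rw [X.mv_mv, zero_add]; push_cast; rw [add_comm]

lemma orb_mem (w : ℝ) {n k : ℕ} (hn : n * X.α ≤ 8 * X.β) (hk : k ≤ n) :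
    w ≤ X.orb w k ∧ X.orb w k ≤ X.mv 8 0 w := by
  refine ⟨by simpa only [X.orb_zero] using X.orb_le w (Nat.zero_le k), X.mv_le_mv ?_ w⟩
  have h1 : (k : ℝ) ≤ n := by exact_mod_cast hk
  have := mul_le_mul_of_nonneg_right h1 X.α_pos.le
  push_cast
  linarith

/-- A stretch of the orbit between two spots, with one more interval on each side. -/
structure Stretch (w : ℝ) (m : ℕ) : Prop where
  short : (m + 2 : ℕ) * X.α ≤ 8 * X.β
  left : X.Spot (X.orb w 1)
  right : X.Spot (X.orb w (m + 1))
  free : ∀ k, 1 < k → k < m + 1 → ¬ X.Spot (X.orb w k)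

/-- Comparability of the extreme intervals with the first fundamental interval. -/
def endK (B C d : ℝ) : ℝ := (1 + C) ^ 13 * C ^ 7 * B ^ 2 * 2 ^ d

/-- Lower bound for cross ratios of points of the chain. -/
def crK (B C d : ℝ) : ℝ := 1 / (B * (8 * (1 + C) ^ 8 * endK B C d) ^ 2)

variable {X} {B C A t ℓ w : ℝ} {m : ℕ}

namespace Fine

lemma one_le_endK (F : X.Fine B C A t ℓ) : 1 ≤ endK B C d := by
  have hB := F.cr.1
  have hC := F.one_le
  have hd : (1 : ℝ) ≤ 2 ^ d := Real.one_le_rpow (by norm_num) (by linarith [X.sys.one_lt_d])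
  unfold endK
  have h1 : 1 ≤ (1 + C) ^ 13 := one_le_pow₀ (by linarith)
  have h2 : 1 ≤ C ^ 7 := one_le_pow₀ (by linarith)
  have h3 : 1 ≤ B ^ 2 := one_le_pow₀ (by linarith)
  exact one_le_mul_of_one_le_of_one_le (one_le_mul_of_one_le_of_one_le
    (one_le_mul_of_one_le_of_one_le h1 h2) h3) hd

lemma crK_pos (F : X.Fine B C A t ℓ) : 0 < crK B C d := by
  have hB := F.cr.1
  have hC := F.one_le
  have := F.one_le_endK
  unfold crK
  positivity

lemma crK_le_one (F : X.Fine B C A t ℓ) : crK B C d ≤ 1 := by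
  have hB := F.cr.1
  have hC := F.one_le
  have h1 := F.one_le_endK
  have h2 : 1 ≤ (1 + C) ^ 8 := one_le_pow₀ (by linarith)
  unfold crK
  refine div_le_one_of_le₀ ?_ (by positivity)
  exact one_le_mul_of_one_le_of_one_le hB
    (one_le_pow₀ (one_le_mul_of_one_le_of_one_le (by linarith) h1))

lemma ggap_orb_le (F : X.Fine B C A t ℓ) (S : X.Stretch w m) {k : ℕ} (hk : k ≤ m + 2) :
    X.ggap (X.orb w k) ≤ (1 + C) ^ 8 * X.gap w := by
  obtain ⟨h1, h2⟩ := X.orb_mem w S.short hk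
  exact (X.ggap_lt_gap _).le.trans (F.gap_near 8 w _ h1 h2).2

lemma le_ggap_of_spot (F : X.Fine B C A t ℓ) (S : X.Stretch w m) {j k i : ℕ} (hj : j ≤ m + 2)
    (hs : X.Spot (X.orb w j)) (hi : i ≤ 6) (hjk : j + i = k ∨ k + i = j) :
    X.gap w ≤ endK B C d * X.ggap (X.orb w k) := by
  have hB := F.cr.1
  have hC := F.one_le
  obtain ⟨h1, h2⟩ := X.orb_mem w S.short hj
  have h3 := (F.gap_near 8 w _ h1 h2).1
  have h4 := F.spot_gap hs
  have h5 : X.ggap (X.orb w j) ≤ C ^ i * X.ggap (X.orb w k) := by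
    rcases hjk with h | h
    · have := (F.ggap_iter i (X.orb w j)).2
      rwa [show X.mv 0 i (X.orb w j) = X.orb w k by rw [← h, ← X.orb_orb]; rfl] at this
    · have := (F.ggap_iter i (X.orb w k)).1
      rwa [show X.mv 0 i (X.orb w k) = X.orb w j by rw [← h, ← X.orb_orb]; rfl] at this
  have h6 : C ^ i ≤ C ^ 6 := pow_le_pow_right₀ hC hi
  have h7 := X.ggap_pos (X.orb w k)
  calc X.gap w ≤ (1 + C) ^ 8 * X.gap (X.orb w j) := h3
    _ ≤ (1 + C) ^ 8 * ((1 + C) ^ 5 * C * B ^ 2 * 2 ^ d * X.ggap (X.orb w j)) := by gcongr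
    _ ≤ (1 + C) ^ 8 * ((1 + C) ^ 5 * C * B ^ 2 * 2 ^ d * (C ^ 6 * X.ggap (X.orb w k))) := by
      gcongr
      exact h5.trans (by gcongr)
    _ = _ := by unfold endK; ring

lemma le_ggap_orb (F : X.Fine B C A t ℓ) (S : X.Stretch w m) {k : ℕ} (hk : k ≤ m + 2)
    (h : k ≤ 7 ∨ m ≤ k + 5) : X.gap w ≤ endK B C d * X.ggap (X.orb w k) := by
  rcases h with h | h
  · rcases Nat.lt_or_ge k 1 with h1 | h1
    · exact F.le_ggap_of_spot S (i := 1) (by omega) S.left (by omega) (by omega)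
    · exact F.le_ggap_of_spot S (i := k - 1) (by omega) S.left (by omega) (by omega)
  · rcases Nat.lt_or_ge k (m + 1) with h1 | h1
    · exact F.le_ggap_of_spot S (i := m + 1 - k) (by omega) S.right (by omega) (by omega)
    · exact F.le_ggap_of_spot S (i := k - (m + 1)) (by omega) S.right (by omega) (by omega)

lemma orb_sub_le (F : X.Fine B C A t ℓ) (S : X.Stretch w m) {j k : ℕ} (hk : k ≤ m + 2) :
    X.orb w k - X.orb w j ≤ 8 * (1 + C) ^ 8 * X.gap w := by
  have h1 := (X.orb_mem w S.short hk).2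
  have h2 := X.orb_le w (Nat.zero_le j)
  rw [X.orb_zero] at h2
  have h3 := F.mv_sub_le 8 w
  push_cast at h3
  linarith

/-- Cross ratios of points of the chain stay bounded below along the way. -/
lemma le_crossRatio_orb (F : X.Fine B C A t ℓ) (S : X.Stretch w m) {a b c e i : ℕ} (hab : a < b)
    (hbc : b < c) (hce : c < e) (ha : a ≤ 6) (he : m ≤ e + 5) (he' : e ≤ m + 1) (hi : i ≤ q') :
    crK B C d ≤ crossRatio (f^[i] (X.orb w a)) (f^[i] (X.orb w b)) (f^[i] (X.orb w c))
      (f^[i] (X.orb w e)) := by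
  obtain ⟨hB1, hB⟩ := F.cr
  have hC := F.one_le
  have hK := F.one_le_endK
  have mono := F.reg.mono.iterate i
  have win : X.orb w e ≤ X.mv 8 0 (X.orb w a) := by
    obtain ⟨k, rfl⟩ := Nat.exists_eq_add_of_lt (hab.trans (hbc.trans hce))
    rw [show a + k + 1 = a + (k + 1) by ring, ← X.orb_orb]
    exact (X.orb_mem _ S.short (by omega)).2
  have h1 := hB _ _ _ _ (q' - i) (mono (X.orb_lt w hab)) (mono (X.orb_lt w hbc))
    (mono (X.orb_lt w hce)) (by rw [← X.iter_mv]; exact mono.monotone win) (by omega)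
  simp only [← Function.iterate_add_apply] at h1
  rw [Nat.sub_add_cancel hi] at h1
  simp only [X.iter_q', X.mv_orb, crossRatio_add] at h1
  have g1 := F.le_ggap_orb S (k := a + 1) (by omega) (by omega)
  have g2 := F.le_ggap_orb S (k := e) (by omega) (by omega)
  rw [X.ggap_orb] at g1 g2
  have t1 := F.orb_sub_le S (j := a + 1) (k := c + 1) (by omega)
  have t2 := F.orb_sub_le S (j := b + 1) (k := e + 1) (by omega)
  have o1 := X.orb_le w (show a + 1 + 1 ≤ b + 1 by omega)
  have o2 := X.orb_le w (show c + 1 ≤ e by omega)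
  set K := 8 * (1 + C) ^ 8 * endK B C d with hKdef
  have pK : 0 < K := by positivity
  have h2 := le_crossRatio (s := 1 / K) (t := 1 / K) (X.orb_lt w (show a + 1 < b + 1 by omega))
    (X.orb_lt w (show b + 1 < c + 1 by omega)) (X.orb_lt w (show c + 1 < e + 1 by omega))
    (by positivity)
    (by
      rw [div_mul_eq_mul_div, div_le_iff₀ pK, one_mul]
      calc _ ≤ 8 * (1 + C) ^ 8 * X.gap w := t1
        _ ≤ 8 * (1 + C) ^ 8 * (endK B C d * (X.orb w (a + 1 + 1) - X.orb w (a + 1))) := by gcongr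
        _ = K * (X.orb w (a + 1 + 1) - X.orb w (a + 1)) := by rw [hKdef]; ring
        _ ≤ K * (X.orb w (b + 1) - X.orb w (a + 1)) := by gcongr
        _ = _ := by ring)
    (by
      rw [div_mul_eq_mul_div, div_le_iff₀ pK, one_mul]
      calc _ ≤ 8 * (1 + C) ^ 8 * X.gap w := t2
        _ ≤ 8 * (1 + C) ^ 8 * (endK B C d * (X.orb w (e + 1) - X.orb w e)) := by gcongr
        _ = K * (X.orb w (e + 1) - X.orb w e) := by rw [hKdef]; ring
        _ ≤ K * (X.orb w (e + 1) - X.orb w (c + 1)) := by gcongr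
        _ = _ := by ring)
  have h3 := h2.trans h1
  unfold crK
  rw [← hKdef, div_le_iff₀ (by positivity)]
  rw [div_mul_div_comm, div_le_iff₀ (by positivity)] at h3
  linarith

end Fine

/-- No critical point of the iterates up to the second return in the free part. -/
lemma Stretch.deriv_ne_zero (S : X.Stretch w m) {u : ℝ} (h1 : X.orb w 2 ≤ u)
    (h2 : u < X.orb w (m + 1)) {i : ℕ} (hi : i < q') : deriv f (f^[i] u) ≠ 0 := by
  intro hc
  have key : ∀ n, u < X.orb w (n + 2) → n + 2 ≤ m + 1 → False := by
    intro n
    induction n with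
    | zero => intro h; exact absurd h (not_lt.2 h1)
    | succ n ih =>
      intro h3 h4
      by_cases h5 : u < X.orb w (n + 2)
      · exact ih h5 (by omega)
      · refine S.free (n + 2) (by omega) (by omega) ⟨u, ⟨not_lt.1 h5, ?_⟩, i, hi, hc⟩
        rw [X.mv_orb]; exact h3
  rcases Nat.lt_or_ge m 1 with h | h
  · have := X.orb_le w (show m + 1 ≤ 2 by omega)
    linarith
  · obtain ⟨n, rfl⟩ := Nat.exists_eq_add_of_le h
    exact key n (by rwa [show n + 2 = 1 + n + 1 by ring]) (by omega)

end Cfg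
end MCircle

namespace MCircle

/-- The derivative of the iterates. -/
def itD (f : ℝ → ℝ) : ℕ → ℝ → ℝ
  | 0, _ => 1
  | m + 1, x => deriv f (f^[m] x) * itD f m x

/-- The logarithmic derivative of `itD`. -/
def itN (f : ℝ → ℝ) : ℕ → ℝ → ℝ
  | 0, _ => 0
  | m + 1, x => deriv (deriv f) (f^[m] x) / deriv f (f^[m] x) * itD f m x + itN f m x

/-- The Schwarzian derivative of the iterates. -/
def itS (f : ℝ → ℝ) : ℕ → ℝ → ℝ
  | 0, _ => 0
  | m + 1, x => (logD2 f (f^[m] x) -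
      1 / 2 * (deriv (deriv f) (f^[m] x) / deriv f (f^[m] x)) ^ 2) * itD f m x ^ 2 + itS f m x

namespace Reg

variable {f : ℝ → ℝ} {A : ℝ}

lemma hasDerivAt_iterate (h : Reg f A) (m : ℕ) (x : ℝ) : HasDerivAt f^[m] (itD f m x) x := by
  induction m with
  | zero => exact hasDerivAt_id x
  | succ m ih =>
    rw [Function.iterate_succ']
    exact (h.d1 _).comp x ih

lemma itD_pos (h : Reg f A) (m : ℕ) (x : ℝ) (hx : ∀ i < m, deriv f (f^[i] x) ≠ 0) :
    0 < itD f m x := by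
  induction m with
  | zero => exact one_pos
  | succ m ih =>
    exact mul_pos ((h.deriv_nonneg _).lt_of_ne (hx m (by omega)).symm)
      (ih fun i hi => hx i (by omega))

lemma hasDerivAt_itD (h : Reg f A) (m : ℕ) (x : ℝ) (hx : ∀ i < m, deriv f (f^[i] x) ≠ 0) :
    HasDerivAt (itD f m) (itD f m x * itN f m x) x := by
  induction m with
  | zero =>
    show HasDerivAt (fun _ => (1 : ℝ)) _ x
    refine (hasDerivAt_const x (1 : ℝ)).congr_deriv ?_
    simp [itN]
  | succ m ih =>
    have h1 := ih fun i hi => hx i (by omega)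
    have h2 := hx m (by omega)
    have h3 := ((h.d2 (f^[m] x)).comp x (h.hasDerivAt_iterate m x)).mul h1
    show HasDerivAt (fun x => deriv f (f^[m] x) * itD f m x) _ x
    refine h3.congr_deriv ?_
    simp only [itD, itN, Function.comp_apply]
    field_simp
    try ring

lemma hasDerivAt_itN (h : Reg f A) (m : ℕ) (x : ℝ) (hx : ∀ i < m, deriv f (f^[i] x) ≠ 0) :
    HasDerivAt (itN f m) (itS f m x + itN f m x ^ 2 / 2) x := by
  induction m with
  | zero =>
    show HasDerivAt (fun _ => (0 : ℝ)) _ x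
    refine (hasDerivAt_const x (0 : ℝ)).congr_deriv ?_
    simp [itN, itS]
  | succ m ih =>
    have h1 := ih fun i hi => hx i (by omega)
    have h2 := hx m (by omega)
    have h3 := h.hasDerivAt_iterate m x
    have h4 := ((((h.d3 (f^[m] x)).comp x h3).div ((h.d2 (f^[m] x)).comp x h3) h2).mul
      (h.hasDerivAt_itD m x fun i hi => hx i (by omega))).add h1
    show HasDerivAt (fun x => deriv (deriv f) (f^[m] x) / deriv f (f^[m] x) * itD f m x
      + itN f m x) _ x
    refine h4.congr_deriv ?_
    simp only [itN, itS, Function.comp_apply, logD2, logDD, Pi.div_apply]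
    field_simp
    ring

/-- Negative Schwarzian derivative makes the inverse square root of the derivative convex. -/
lemma convexOn_itD (h : Reg f A) (m : ℕ) (p r : ℝ)
    (hx : ∀ x ∈ Icc p r, ∀ i < m, deriv f (f^[i] x) ≠ 0) (hS : ∀ x ∈ Icc p r, itS f m x ≤ 0) :
    ConvexOn ℝ (Icc p r) fun x => (√(itD f m x))⁻¹ := by
  have d1 : ∀ x ∈ Icc p r, HasDerivAt (fun x => (√(itD f m x))⁻¹)
      (-(1 / 2) * itN f m x * (√(itD f m x))⁻¹) x := by
    intro x hxm
    have pos := h.itD_pos m x (hx x hxm)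
    have ps := Real.sqrt_pos.2 pos
    refine (((h.hasDerivAt_itD m x (hx x hxm)).sqrt pos.ne').inv ps.ne').congr_deriv ?_
    have hs := Real.sq_sqrt pos.le
    have : itD f m x = √(itD f m x) ^ 2 := hs.symm
    rw [hs]
    field_simp
  have d2 : ∀ x ∈ Icc p r, HasDerivAt (fun x => -(1 / 2) * itN f m x * (√(itD f m x))⁻¹)
      (-(1 / 2) * itS f m x * (√(itD f m x))⁻¹) x := by
    intro x hxm
    refine (((h.hasDerivAt_itN m x (hx x hxm)).const_mul (-(1 / 2))).mul (d1 x hxm)).congr_deriv ?_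
    ring
  refine convexOn_of_hasDerivWithinAt2_nonneg (convex_Icc p r)
    (fun x hxm => (d1 x hxm).continuousAt.continuousWithinAt)
    (fun x hxm => (d1 x (interior_subset hxm)).hasDerivWithinAt)
    (fun x hxm => (d2 x (interior_subset hxm)).hasDerivWithinAt) fun x hxm => ?_
  have := hS x (interior_subset hxm)
  exact mul_nonneg (by linarith) (by positivity)

/-- An upper bound for the Schwarzian derivative in which one term is singled out. -/
lemma itS_le (h : Reg f A) (x : ℝ) {E : ℕ → ℝ} {i₀ : ℕ} {v : ℝ} (m : ℕ)
    (hx : ∀ i < m, deriv f (f^[i] x) ≠ 0) (hE : ∀ i < m, itD f i x ^ 2 ≤ E i)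
    (hv : logD2 f (f^[i₀] x) * itD f i₀ x ^ 2 ≤ v) :
    itS f m x ≤ A * ∑ i ∈ Finset.range m, E i + if i₀ < m then v else 0 := by
  induction m with
  | zero => simp [itS]
  | succ m ih =>
    have h1 := ih (fun i hi => hx i (by omega)) (fun i hi => hE i (by omega))
    have h2 := h.le _ (hx m (by omega))
    have h3 := hE m (by omega)
    have hA := h.nonneg
    have h4 : itS f (m + 1) x ≤ logD2 f (f^[m] x) * itD f m x ^ 2 + itS f m x := by
      simp only [itS]
      have : 0 ≤ (deriv (deriv f) (f^[m] x) / deriv f (f^[m] x)) ^ 2 * itD f m x ^ 2 := by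
        positivity
      linarith
    rw [Finset.sum_range_succ, mul_add]
    have h5 : 0 ≤ A * E m := mul_nonneg hA ((sq_nonneg _).trans h3)
    rcases lt_trichotomy i₀ m with hi | hi | hi
    · rw [if_pos hi] at h1
      rw [if_pos (by omega)]
      have : logD2 f (f^[m] x) * itD f m x ^ 2 ≤ A * E m :=
        (mul_le_mul_of_nonneg_right h2 (sq_nonneg _)).trans (mul_le_mul_of_nonneg_left h3 hA)
      linarith
    · rw [if_neg (by omega)] at h1
      rw [if_pos (by omega)]
      rw [hi] at hv
      linarith
    · rw [if_neg (by omega)] at h1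
      rw [if_neg (by omega)]
      have : logD2 f (f^[m] x) * itD f m x ^ 2 ≤ A * E m :=
        (mul_le_mul_of_nonneg_right h2 (sq_nonneg _)).trans (mul_le_mul_of_nonneg_left h3 hA)
      linarith

end Reg

lemma deriv_le_of_forall_right {g : ℝ → ℝ} {y g' M δ : ℝ} (h : HasDerivAt g g' y) (hδ : 0 < δ)
    (hM : ∀ s, 0 < s → s < δ → g (y + s) - g y ≤ M * s) : g' ≤ M := by
  have h1 := h.tendsto_slope_zero_right
  refine le_of_tendsto h1 ?_
  filter_upwards [Ioo_mem_nhdsGT hδ] with s hs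
  rw [smul_eq_mul, inv_mul_le_iff₀ hs.1, mul_comm]
  exact hM s hs.1 hs.2

lemma le_deriv_of_forall_right {g : ℝ → ℝ} {y g' M δ : ℝ} (h : HasDerivAt g g' y) (hδ : 0 < δ)
    (hM : ∀ s, 0 < s → s < δ → M * s ≤ g (y + s) - g y) : M ≤ g' := by
  have := deriv_le_of_forall_right (M := -M) h.neg hδ fun s h1 h2 => by
    have := hM s h1 h2
    simp only [Pi.neg_apply]
    linarith
  linarith

end MCircle

namespace MCircle
namespace Cfg

variable {f : ℝ → ℝ} {N : ℕ} {d ρ : ℝ} {q : ℕ} {p : ℤ} {q' : ℕ} {p' : ℤ}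
variable {X : Cfg f N d ρ q p q' p'} {B C A t ℓ w : ℝ} {s : ℕ}

/-- Comparability constant for the chain and its extreme intervals. -/
def koeK (B C d : ℝ) : ℝ := 8 * (1 + C) ^ 8 * endK B C d

/-- Smallness required for the negativity of the Schwarzian derivative. -/
def epsK (B C d : ℝ) : ℝ := crK B C d ^ 14 / (16384 * (B * koeK B C d) ^ 2)

namespace Fine

lemma one_le_koeK (F : X.Fine B C A t ℓ) : 1 ≤ koeK B C d := by
  have hC := F.one_le
  have h1 := F.one_le_endK
  have h2 : 1 ≤ (1 + C) ^ 8 := one_le_pow₀ (by linarith)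
  exact one_le_mul_of_one_le_of_one_le (by linarith) h1

lemma ℓ_nonneg (F : X.Fine B C A t ℓ) : 0 ≤ ℓ := by
  have := F.win 0
  have h : (0 : ℝ) ≤ X.mv 8 0 0 := (X.lt_mv (by have := X.β_pos; push_cast; linarith) 0).le
  linarith

lemma image_left (F : X.Fine B C A t ℓ) (S : X.Stretch w (s + 8)) {i : ℕ} (hi : i ≤ q') :
    crK B C d ^ 2 * (f^[i] (X.orb w (s + 8)) - f^[i] (X.orb w 2)) ≤
      2 * (f^[i] (X.orb w 3) - f^[i] (X.orb w 2)) := by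
  have mono := F.reg.mono.iterate i
  have m1 := mono (X.orb_lt w (show 2 < 3 by omega))
  have m2 := mono (X.orb_lt w (show 3 < s + 7 by omega))
  have m3 := mono (X.orb_lt w (show s + 7 < s + 8 by omega))
  have m4 := mono (X.orb_lt w (show s + 8 < s + 9 by omega))
  have c1 := F.le_crossRatio_orb S (a := 2) (b := 3) (c := s + 7) (e := s + 8) (i := i)
    (by omega) (by omega) (by omega) (by omega) (by omega) (by omega) hi
  have c2 := F.le_crossRatio_orb S (a := 3) (b := s + 7) (c := s + 8) (e := s + 9) (i := i)
    (by omega) (by omega) (by omega) (by omega) (by omega) (by omega) hi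
  have k0 := F.crK_pos
  have k1 := F.crK_le_one
  have l1 := (mul_le_mul_of_nonneg_right c1 (by linarith)).trans (crossRatio_le_left m1 m2 m3)
  have l2 := (mul_le_mul_of_nonneg_right c2 (by linarith)).trans (crossRatio_le_left m2 m3 m4)
  have l3 := mul_le_mul_of_nonneg_left l2 k0.le
  have l4 := mul_le_mul_of_nonneg_right (pow_le_one₀ (n := 2) k0.le k1) (sub_pos.2 m1).le
  nlinarith

lemma image_right (F : X.Fine B C A t ℓ) (S : X.Stretch w (s + 8)) {i : ℕ} (hi : i ≤ q') :
    crK B C d ^ 2 * (f^[i] (X.orb w (s + 8)) - f^[i] (X.orb w 2)) ≤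
      2 * (f^[i] (X.orb w (s + 8)) - f^[i] (X.orb w (s + 7))) := by
  have mono := F.reg.mono.iterate i
  have m0 := mono (X.orb_lt w (show 1 < 2 by omega))
  have m1 := mono (X.orb_lt w (show 2 < 3 by omega))
  have m2 := mono (X.orb_lt w (show 3 < s + 7 by omega))
  have m3 := mono (X.orb_lt w (show s + 7 < s + 8 by omega))
  have c1 := F.le_crossRatio_orb S (a := 2) (b := 3) (c := s + 7) (e := s + 8) (i := i)
    (by omega) (by omega) (by omega) (by omega) (by omega) (by omega) hi
  have c2 := F.le_crossRatio_orb S (a := 1) (b := 2) (c := 3) (e := s + 7) (i := i)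
    (by omega) (by omega) (by omega) (by omega) (by omega) (by omega) hi
  have k0 := F.crK_pos
  have k1 := F.crK_le_one
  have l1 := (mul_le_mul_of_nonneg_right c1 (by linarith)).trans (crossRatio_le_right m1 m2 m3)
  have l2 := (mul_le_mul_of_nonneg_right c2 (by linarith)).trans (crossRatio_le_right m0 m1 m2)
  have l3 := mul_le_mul_of_nonneg_left l2 k0.le
  have l4 := mul_le_mul_of_nonneg_right (pow_le_one₀ (n := 2) k0.le k1) (sub_pos.2 m3).le
  have l5 := mul_le_mul_of_nonneg_left (show f^[i] (X.orb w (s + 7)) - f^[i] (X.orb w 3) ≤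
    f^[i] (X.orb w (s + 8)) - f^[i] (X.orb w 3) by linarith) k0.le
  nlinarith

lemma image_outer (F : X.Fine B C A t ℓ) (S : X.Stretch w (s + 8)) {i : ℕ} (hi : i ≤ q') :
    crK B C d * (f^[i] (X.orb w (s + 8)) - f^[i] (X.orb w 1)) ≤
      f^[i] (X.orb w (s + 8)) - f^[i] (X.orb w 2) := by
  have mono := F.reg.mono.iterate i
  have m0 := mono (X.orb_lt w (show 0 < 1 by omega))
  have m1 := mono (X.orb_lt w (show 1 < 2 by omega))
  have m2 := mono (X.orb_lt w (show 2 < s + 8 by omega))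
  have c1 := F.le_crossRatio_orb S (a := 0) (b := 1) (c := 2) (e := s + 8) (i := i)
    (by omega) (by omega) (by omega) (by omega) (by omega) (by omega) hi
  exact (mul_le_mul_of_nonneg_right c1 (by linarith)).trans (crossRatio_le_right m0 m1 m2)

lemma image_le (F : X.Fine B C A t ℓ) (S : X.Stretch w (s + 8)) {j : ℕ} (i : ℕ) (hj : j ≤ s + 8) :
    f^[i] (X.orb w (s + 8)) - f^[i] (X.orb w j) ≤ ℓ := by
  have mono := F.reg.mono.iterate i
  have h := F.win (f^[i] (X.orb w j))
  have h2 : X.orb w (s + 8) ≤ X.mv 8 0 (X.orb w j) := by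
    obtain ⟨k, hk⟩ := Nat.exists_eq_add_of_le hj
    rw [hk, ← X.orb_orb]
    exact (X.orb_mem _ S.short (by omega)).2
  have h3 := mono.monotone h2
  rw [X.iter_mv] at h3
  linarith

lemma sum_sq_le (F : X.Fine B C A t ℓ) (S : X.Stretch w (s + 8)) {m : ℕ} (hm : m ≤ q') :
    ∑ i ∈ Finset.range m, (f^[i] (X.orb w (s + 8)) - f^[i] (X.orb w 2)) ^ 2 ≤ 32 * ℓ := by
  have h1 := X.sum_window_le (a := X.orb w 2) (e := X.orb w (s + 8)) (m := m)
    (by rw [show s + 8 = 2 + (s + 6) by ring, ← X.orb_orb]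
        exact (X.orb_mem _ S.short (by omega)).2) (by omega)
  have h2 : ∑ i ∈ Finset.range m, (f^[i] (X.orb w (s + 8)) - f^[i] (X.orb w 2)) ^ 2 ≤
      ∑ i ∈ Finset.range m, (f^[i] (X.orb w (s + 8)) - f^[i] (X.orb w 2)) * ℓ := by
    refine Finset.sum_le_sum fun i _ => ?_
    have h3 := F.image_le S (j := 2) i (by omega)
    have h4 := (F.reg.mono.iterate i) (X.orb_lt w (show 2 < s + 8 by omega))
    rw [sq]
    exact mul_le_mul_of_nonneg_left h3 (by linarith)
  rw [← Finset.sum_mul] at h2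
  have := mul_le_mul_of_nonneg_right h1 F.ℓ_nonneg
  linarith

lemma chain_le (F : X.Fine B C A t ℓ) (S : X.Stretch w (s + 8)) {k : ℕ} (hk : k ≤ s + 10)
    (h : k ≤ 7 ∨ s + 8 ≤ k + 5) {a e : ℕ} (he : e ≤ s + 10) :
    X.orb w e - X.orb w a ≤ koeK B C d * (X.orb w (k + 1) - X.orb w k) := by
  have h1 := F.orb_sub_le S (j := a) (k := e) he
  have h2 := F.le_ggap_orb S hk h
  rw [X.ggap_orb] at h2
  have hC := F.one_le
  calc _ ≤ 8 * (1 + C) ^ 8 * X.gap w := h1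
    _ ≤ 8 * (1 + C) ^ 8 * (endK B C d * (X.orb w (k + 1) - X.orb w k)) := by gcongr
    _ = _ := by unfold koeK; ring

/-- Upper derivative bound of Koebe type. -/
lemma itD_le (F : X.Fine B C A t ℓ) (S : X.Stretch w (s + 8)) {i : ℕ} (hi : i ≤ q') {y : ℝ}
    (hy : y ∈ Icc (X.orb w 4) (X.orb w (s + 6))) :
    itD f i y ≤ 2 * (B * koeK B C d) / crK B C d ^ 2 *
      ((f^[i] (X.orb w (s + 8)) - f^[i] (X.orb w 2)) / (X.orb w (s + 8) - X.orb w 2)) := by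
  obtain ⟨hB1, hB⟩ := F.cr
  have mono := F.reg.mono.iterate i
  have o0 := X.orb_lt w (show 2 < 4 by omega)
  have o1 := X.orb_lt w (show s + 6 < s + 7 by omega)
  have o2 := X.orb_lt w (show s + 7 < s + 8 by omega)
  have o3 := X.orb_lt w (show 2 < s + 8 by omega)
  have hyr : y < X.orb w (s + 7) := lt_of_le_of_lt hy.2 o1
  have k0 := F.crK_pos
  have hK := F.one_le_koeK
  refine deriv_le_of_forall_right (F.reg.hasDerivAt_iterate i y) (sub_pos.2 hyr) fun h h0 hh => ?_
  have hl : X.orb w (s + 8) ≤ X.mv 8 0 y := by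
    have : X.orb w (s + 8) ≤ X.mv 8 0 (X.orb w 4) := by
      rw [show s + 8 = 4 + (s + 4) by ring, ← X.orb_orb]
      exact (X.orb_mem _ S.short (by omega)).2
    exact this.trans ((X.mv_strictMono 8 0).monotone hy.1)
  have h1 := hB y (y + h) (X.orb w (s + 7)) (X.orb w (s + 8)) i (by linarith) (by linarith) o2 hl
    (by omega)
  have m0 := mono (show X.orb w 2 < y by linarith [hy.1])
  have m1 := mono (show y < y + h by linarith)
  have m2 := mono (show y + h < X.orb w (s + 7) by linarith)
  have m3 := mono o2
  have h2 := F.image_right S hi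
  have hr := F.chain_le S (k := s + 6) (a := 2) (e := s + 8) (by omega) (by omega) (by omega)
  set T := X.orb w (s + 8) - X.orb w 2
  set U := f^[i] (X.orb w (s + 8)) - f^[i] (X.orb w 2) with hU
  set κ := crK B C d
  set K := koeK B C d
  have pT : 0 < T := sub_pos.2 o3
  have pU : 0 < U := sub_pos.2 (mono o3)
  have e1 : (f^[i] (y + h) - f^[i] y) * (κ ^ 2 / (2 * U)) ≤
      crossRatio (f^[i] y) (f^[i] (y + h)) (f^[i] (X.orb w (s + 7))) (f^[i] (X.orb w (s + 8))) := by
    unfold crossRatio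
    rw [mul_div_assoc]
    refine mul_le_mul_of_nonneg_left ?_ (by linarith)
    rw [div_le_div_iff₀ (by positivity) (mul_pos (by linarith) (by linarith))]
    have a1 : (f^[i] (X.orb w (s + 7)) - f^[i] y) * (f^[i] (X.orb w (s + 8)) - f^[i] (y + h)) ≤
      U * U := mul_le_mul (by linarith) (by linarith) (by linarith) pU.le
    calc _ ≤ κ ^ 2 * (U * U) := mul_le_mul_of_nonneg_left a1 (by positivity)
      _ = κ ^ 2 * U * U := by ring
      _ ≤ 2 * (f^[i] (X.orb w (s + 8)) - f^[i] (X.orb w (s + 7))) * U := by gcongr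
      _ = _ := by ring
  have e2 : crossRatio y (y + h) (X.orb w (s + 7)) (X.orb w (s + 8)) ≤ h * (K / T) := by
    unfold crossRatio
    rw [mul_div_assoc, show y + h - y = h by ring]
    refine mul_le_mul_of_nonneg_left ?_ h0.le
    rw [div_le_div_iff₀ (mul_pos (by linarith) (by linarith)) pT]
    have a1 : T ≤ K * (X.orb w (s + 7) - y) := hr.trans
      (mul_le_mul_of_nonneg_left (by linarith [hy.2]) (by linarith))
    calc _ ≤ (X.orb w (s + 8) - (y + h)) * (K * (X.orb w (s + 7) - y)) :=
          mul_le_mul (by linarith) a1 pT.le (by linarith)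
      _ = _ := by ring
  have e3 := e1.trans (h1.trans (mul_le_mul_of_nonneg_left e2 (by linarith)))
  rw [← mul_div_assoc, div_le_iff₀ (by positivity), ← le_div_iff₀ (by positivity)] at e3
  refine e3.trans (le_of_eq ?_)
  field_simp

/-- Lower derivative bound of Koebe type. -/
lemma le_itD (F : X.Fine B C A t ℓ) (S : X.Stretch w (s + 8)) (hA : A * ℓ ≤ 1 / 64)
    {i : ℕ} (hi : i ≤ q') {y : ℝ} (hy : y ∈ Icc (X.orb w 4) (X.orb w (s + 6))) :
    crK B C d ^ 4 / 8 *
      ((f^[i] (X.orb w (s + 8)) - f^[i] (X.orb w 2)) / (X.orb w (s + 8) - X.orb w 2)) ≤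
      itD f i y := by
  have mono := F.reg.mono.iterate i
  have o0 := X.orb_lt w (show 3 < 4 by omega)
  have o0' := X.orb_lt w (show 2 < 3 by omega)
  have o1 := X.orb_lt w (show s + 6 < s + 7 by omega)
  have o2 := X.orb_lt w (show s + 7 < s + 8 by omega)
  have o3 := X.orb_lt w (show 2 < s + 8 by omega)
  have hyr : y < X.orb w (s + 7) := lt_of_le_of_lt hy.2 o1
  have k0 := F.crK_pos
  refine le_deriv_of_forall_right (F.reg.hasDerivAt_iterate i y) (sub_pos.2 hyr) fun h h0 hh => ?_
  have hy1 := hy.1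
  have h1 := F.reg.coRatio_iterate_le (a := X.orb w 2) (b := y) (c := y + h)
    (d := X.orb w (s + 8)) (by linarith) (by linarith) (by linarith) i (by
      intro j hj x hx
      obtain ⟨u, rfl⟩ := X.sys.surjective.iterate j x
      exact S.deriv_ne_zero ((F.reg.mono.iterate j).lt_iff_lt.1 hx.1).le
        (((F.reg.mono.iterate j).lt_iff_lt.1 hx.2).trans (X.orb_lt w (by omega))) (by omega))
  have hs := mul_le_mul_of_nonneg_left (F.sum_sq_le S hi) F.reg.nonneg
  have hexp : (1 : ℝ) / 2 ≤ Real.exp (-(A * ∑ j ∈ Finset.range i,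
      (f^[j] (X.orb w (s + 8)) - f^[j] (X.orb w 2)) ^ 2)) := by
    have := Real.add_one_le_exp (-(A * ∑ j ∈ Finset.range i,
      (f^[j] (X.orb w (s + 8)) - f^[j] (X.orb w 2)) ^ 2))
    linarith
  have m0 := mono o0'
  have m0' := mono (show X.orb w 3 < y by linarith)
  have m1 := mono (show y < y + h by linarith)
  have m2 := mono (show y + h < X.orb w (s + 7) by linarith)
  have m3 := mono o2
  have h2 := F.image_right S hi
  have h3 := F.image_left S hi
  have hpos := coRatio_pos (show X.orb w 2 < y by linarith) (show y < y + h by linarith)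
    (show y + h < X.orb w (s + 8) by linarith)
  set T := X.orb w (s + 8) - X.orb w 2 with hT
  set U := f^[i] (X.orb w (s + 8)) - f^[i] (X.orb w 2) with hU
  set κ := crK B C d
  have pT : 0 < T := sub_pos.2 o3
  have pU : 0 < U := sub_pos.2 (mono o3)
  have e1 : coRatio (f^[i] (X.orb w 2)) (f^[i] y) (f^[i] (y + h)) (f^[i] (X.orb w (s + 8))) ≤
      (f^[i] (y + h) - f^[i] y) * (4 / (κ ^ 4 * U)) := by
    unfold coRatio
    rw [mul_div_assoc, ← hU]
    refine mul_le_mul_of_nonneg_left ?_ (by linarith)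
    rw [div_le_div_iff₀ (mul_pos (by linarith) (by linarith)) (by positivity)]
    calc U * (κ ^ 4 * U) = (κ ^ 2 * U) * (κ ^ 2 * U) := by ring
      _ ≤ (2 * (f^[i] y - f^[i] (X.orb w 2))) *
          (2 * (f^[i] (X.orb w (s + 8)) - f^[i] (y + h))) :=
        mul_le_mul (by linarith) (by linarith) (by positivity) (by linarith)
      _ = _ := by ring
  have e2 : h / T ≤ coRatio (X.orb w 2) y (y + h) (X.orb w (s + 8)) := by
    unfold coRatio
    rw [show y + h - y = h by ring, ← hT,
      div_le_div_iff₀ pT (mul_pos (by linarith) (by linarith)), mul_assoc]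
    exact mul_le_mul_of_nonneg_left (mul_le_mul (by linarith) (by linarith) (by linarith) pT.le)
      h0.le
  have e3 := (mul_le_mul hexp e2 (by positivity) (Real.exp_pos _).le).trans (h1.trans e1)
  rw [← mul_div_assoc (f^[i] (y + h) - f^[i] y), le_div_iff₀ (by positivity)] at e3
  calc κ ^ 4 / 8 * (U / T) * h = 1 / 2 * (h / T) * (κ ^ 4 * U) / 4 := by ring
    _ ≤ _ := by linarith

lemma epsK_le (F : X.Fine B C A t ℓ) : epsK B C d ≤ 1 / 64 := by
  have hK := F.one_le_koeK
  have hB := F.cr.1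
  have k0 := F.crK_pos
  unfold epsK
  rw [div_le_iff₀ (by positivity)]
  have h1 : crK B C d ^ 14 ≤ 1 := pow_le_one₀ k0.le F.crK_le_one
  have h2 : 1 ≤ (B * koeK B C d) ^ 2 := one_le_pow₀ (one_le_mul_of_one_le_of_one_le hB hK)
  linarith

lemma itS_nonpos (F : X.Fine B C A t ℓ) (S : X.Stretch w (s + 8)) (hA : A * ℓ ≤ epsK B C d)
    {y : ℝ} (hy : y ∈ Icc (X.orb w 4) (X.orb w (s + 6))) : itS f q' y ≤ 0 := by
  obtain ⟨u, ⟨hu1, hu2⟩, i, hi, hc⟩ := S.left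
  rw [X.mv_orb] at hu2
  have hcr := (F.crit _ hc).1
  have mono := F.reg.mono.iterate i
  have k0 := F.crK_pos
  have hK := F.one_le_koeK
  have hB := F.cr.1
  have hℓ := F.image_le S (j := 1) i (by omega)
  have ho := F.image_outer S hi.le
  have hlow := F.le_itD S (hA.trans F.epsK_le) hi.le hy
  have o1 := X.orb_lt w (show 2 < 4 by omega)
  have o2 := X.orb_lt w (show s + 6 < s + 8 by omega)
  have o3 := X.orb_lt w (show 2 < s + 8 by omega)
  have m1 : f^[i] u < f^[i] y := mono (by linarith [hy.1])
  have m2 := mono.monotone hu1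
  have m3 := mono (show y < X.orb w (s + 8) by linarith [hy.2])
  have hlt := F.lt
  have hneg := hcr (f^[i] y) m1.ne' (by rw [abs_of_pos (by linarith)]; linarith)
  set T := X.orb w (s + 8) - X.orb w 2 with hT
  set κ := crK B C d with hκ
  set M := 2 * (B * koeK B C d) / κ ^ 2 with hM
  have pT : 0 < T := sub_pos.2 o3
  have pU : 0 < f^[i] (X.orb w (s + 8)) - f^[i] (X.orb w 2) := sub_pos.2 (mono o3)
  have hv : logD2 f (f^[i] y) * itD f i y ^ 2 ≤ -(κ ^ 10 / 128 / T ^ 2) := by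
    set U := f^[i] (X.orb w (s + 8)) - f^[i] (X.orb w 2)
    set D := f^[i] y - f^[i] u
    have pD : 0 < D := sub_pos.2 m1
    have hD : κ * D ≤ U := (mul_le_mul_of_nonneg_left (by linarith) k0.le).trans ho
    have h1 : logD2 f (f^[i] y) ≤ -(1 / 2) / D ^ 2 := by
      rw [le_div_iff₀ (by positivity)]; linarith
    have h2 : logD2 f (f^[i] y) ≤ -(1 / 2) * (κ / U) ^ 2 := by
      refine h1.trans ?_
      have : (κ / U) ^ 2 ≤ 1 / D ^ 2 := by
        rw [← one_div_pow]
        refine pow_le_pow_left₀ (by positivity) ?_ 2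
        rw [div_le_div_iff₀ pU pD]; linarith
      have e : -(1 / 2) / D ^ 2 = -(1 / 2) * (1 / D ^ 2) := by ring
      rw [e]; linarith
    have h3 : (κ ^ 4 / 8 * (U / T)) ^ 2 ≤ itD f i y ^ 2 :=
      pow_le_pow_left₀ (by positivity) hlow 2
    calc _ ≤ -(1 / 2) * (κ / U) ^ 2 * itD f i y ^ 2 := mul_le_mul_of_nonneg_right h2 (sq_nonneg _)
      _ ≤ -(1 / 2) * (κ / U) ^ 2 * (κ ^ 4 / 8 * (U / T)) ^ 2 := by
        have : 0 ≤ 1 / 2 * (κ / U) ^ 2 := by positivity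
        have := mul_le_mul_of_nonneg_left h3 this
        linarith
      _ = _ := by field_simp; norm_num
  have hne : ∀ j < q', deriv f (f^[j] y) ≠ 0 := fun j hj =>
    S.deriv_ne_zero (by linarith [hy.1]) (lt_of_le_of_lt hy.2 (X.orb_lt w (by omega))) hj
  have h4 := F.reg.itS_le y (E := fun j => M ^ 2 / T ^ 2 *
      (f^[j] (X.orb w (s + 8)) - f^[j] (X.orb w 2)) ^ 2) q' hne (by
    intro j hj
    refine (pow_le_pow_left₀ (F.reg.itD_pos j y fun k hk => hne k (by omega)).le
      (F.itD_le S hj.le hy) 2).trans (le_of_eq ?_)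
    rw [mul_pow, div_pow, ← hT, ← hκ]; ring_nf) hv
  rw [if_pos hi, ← Finset.mul_sum] at h4
  have h5 := F.sum_sq_le S le_rfl
  have h6 : A * (M ^ 2 / T ^ 2 * ∑ j ∈ Finset.range q',
      (f^[j] (X.orb w (s + 8)) - f^[j] (X.orb w 2)) ^ 2) ≤ κ ^ 10 / 128 / T ^ 2 := by
    have hA0 := F.reg.nonneg
    calc _ ≤ A * (M ^ 2 / T ^ 2 * (32 * ℓ)) := by gcongr
      _ = A * ℓ * (32 * M ^ 2 / T ^ 2) := by ring
      _ ≤ epsK B C d * (32 * M ^ 2 / T ^ 2) := by gcongr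
      _ = _ := by
        have : B * koeK B C d ≠ 0 := by positivity
        rw [hM]; unfold epsK; rw [← hκ]
        field_simp; norm_num
  linarith

end Fine
end Cfg
end MCircle

namespace MCircle
namespace Cfg

variable {f : ℝ → ℝ} {N : ℕ} {d ρ : ℝ} {q : ℕ} {p : ℤ} {q' : ℕ} {p' : ℤ}
variable {X : Cfg f N d ρ q p q' p'} {B C A t ℓ w : ℝ} {s : ℕ}

/-- Bound for the inverse square root of the derivative of the bridges. -/
def bridgeH (B C d : ℝ) : ℝ :=
  2 * (B * koeK B C d) / crK B C d ^ 2 * koeK B C d + 8 * koeK B C d / crK B C d ^ 4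

namespace Fine

lemma one_le_bridgeH (F : X.Fine B C A t ℓ) : 1 ≤ bridgeH B C d := by
  have hK := F.one_le_koeK
  have hB := F.cr.1
  have k0 := F.crK_pos
  have h2 : 1 ≤ 8 * koeK B C d / crK B C d ^ 4 := by
    rw [le_div_iff₀ (by positivity)]
    have : crK B C d ^ 4 ≤ 1 := pow_le_one₀ k0.le F.crK_le_one
    linarith
  unfold bridgeH
  have : 0 ≤ 2 * (B * koeK B C d) / crK B C d ^ 2 * koeK B C d := by positivity
  linarith

lemma itD_mem (F : X.Fine B C A t ℓ) (S : X.Stretch w (s + 8)) (hA : A * ℓ ≤ 1 / 64) {y : ℝ}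
    (hy : y ∈ Icc (X.orb w 4) (X.orb w (s + 6))) :
    itD f q' y ≤ bridgeH B C d ∧ 1 ≤ bridgeH B C d * itD f q' y := by
  have hK := F.one_le_koeK
  have hB := F.cr.1
  have k0 := F.crK_pos
  have h1 := F.itD_le S le_rfl hy
  have h2 := F.le_itD S hA le_rfl hy
  rw [X.iter_q', X.iter_q', X.mv_orb, X.mv_orb, add_sub_add_right_eq_sub] at h1 h2
  have o1 := X.orb_lt w (show 2 < s + 8 by omega)
  have o2 := X.orb_le w (show 2 + 1 ≤ s + 8 by omega)
  have o3 := X.orb_lt w (show 2 + 1 < s + 8 + 1 by omega)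
  have o4 := X.orb_le w (show 2 + 1 ≤ 3 by omega)
  have g1 := F.chain_le S (k := 2) (a := 2 + 1) (e := s + 8 + 1) (by omega) (by omega) (by omega)
  have g2 := F.chain_le S (k := s + 8) (a := 2) (e := s + 8) (by omega) (by omega) (by omega)
  have o5 := X.orb_le w (show 2 + 1 ≤ s + 8 by omega)
  set T := X.orb w (s + 8) - X.orb w 2
  set U := X.orb w (s + 8 + 1) - X.orb w (2 + 1)
  have pT : 0 < T := sub_pos.2 o1
  have pU : 0 < U := sub_pos.2 o3
  have hUT : U / T ≤ koeK B C d := by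
    rw [div_le_iff₀ pT]
    exact g1.trans (mul_le_mul_of_nonneg_left (by simp only [T]; linarith) (by linarith))
  have hTU : 1 ≤ koeK B C d * (U / T) := by
    rw [← mul_div_assoc, le_div_iff₀ pT, one_mul]
    exact g2.trans (mul_le_mul_of_nonneg_left (by simp only [U]; linarith) (by linarith))
  have hp : 0 < itD f q' y := lt_of_lt_of_le (by positivity) h2
  constructor
  · refine h1.trans ((mul_le_mul_of_nonneg_left hUT (by positivity)).trans ?_)
    unfold bridgeH
    have : 0 ≤ 8 * koeK B C d / crK B C d ^ 4 := by positivity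
    linarith
  · calc 1 ≤ koeK B C d * (U / T) := hTU
      _ = 8 * koeK B C d / crK B C d ^ 4 * (crK B C d ^ 4 / 8 * (U / T)) := by
        field_simp
      _ ≤ 8 * koeK B C d / crK B C d ^ 4 * itD f q' y := by gcongr
      _ ≤ _ := by
        refine mul_le_mul_of_nonneg_right ?_ hp.le
        unfold bridgeH
        have : 0 ≤ 2 * (B * koeK B C d) / crK B C d ^ 2 * koeK B C d := by positivity
        linarith

/-- The return map on the central part of a stretch is a bridge after rescaling. -/
lemma bridge (F : X.Fine B C A t ℓ) (S : X.Stretch w (s + 8)) (hA : A * ℓ ≤ epsK B C d) {Λ : ℝ}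
    (hΛ : Λ = 8 * (1 + C) ^ 8 * X.gap w) :
    Bridge (bridgeH B C d) (1 / koeK B C d) (fun x => X.mv 0 1 (Λ * x) / Λ)
      (fun x => (√(itD f q' (Λ * x)))⁻¹) (X.orb w 4 / Λ) (X.orb w (s + 6) / Λ) := by
  have hC := F.one_le
  have hK := F.one_le_koeK
  have hgw := X.gap_pos w
  have hC8 : 1 ≤ (1 + C) ^ 8 := one_le_pow₀ (by linarith)
  have pΛ : 0 < Λ := by rw [hΛ]; positivity
  have o1 := X.orb_lt w (show 4 < s + 6 by omega)
  have hmem : ∀ x ∈ Icc (X.orb w 4 / Λ) (X.orb w (s + 6) / Λ),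
      Λ * x ∈ Icc (X.orb w 4) (X.orb w (s + 6)) := by
    intro x hx
    constructor
    · have := (div_le_iff₀' pΛ).1 hx.1; exact this
    · exact (le_div_iff₀' pΛ).1 hx.2
  have hd : ∀ y ∈ Icc (X.orb w 4) (X.orb w (s + 6)), 0 < itD f q' y ∧
      itD f q' y ≤ bridgeH B C d ∧ 1 ≤ bridgeH B C d * itD f q' y := by
    intro y hy
    refine ⟨F.reg.itD_pos q' y fun i hi => S.deriv_ne_zero ?_ ?_ hi,
      F.itD_mem S (hA.trans F.epsK_le) hy⟩
    · exact (X.orb_le w (by omega)).trans hy.1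
    · exact lt_of_le_of_lt hy.2 (X.orb_lt w (by omega))
  have hH := F.one_le_bridgeH
  have hendp : ∀ k, (k = 4 ∨ k = s + 6) →
      1 / koeK B C d ≤ X.mv 0 1 (Λ * (X.orb w k / Λ)) / Λ - X.orb w k / Λ := by
    intro k hk
    rw [mul_div_cancel₀ _ pΛ.ne', X.mv_orb, ← sub_div, div_le_div_iff₀ (by linarith) pΛ, one_mul]
    have h1 := F.le_ggap_orb S (k := k) (by omega) (by omega)
    rw [X.ggap_orb] at h1
    calc Λ = 8 * (1 + C) ^ 8 * X.gap w := hΛ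
      _ ≤ 8 * (1 + C) ^ 8 * (endK B C d * (X.orb w (k + 1) - X.orb w k)) := by gcongr
      _ = _ := by unfold koeK; ring
  refine ⟨hH, by positivity, by rw [div_le_one (by linarith)]; exact hK, by gcongr, ?_, ?_, ?_, ?_,
    ?_, ?_, ?_, hendp 4 (.inl rfl), hendp (s + 6) (.inr rfl)⟩
  · rw [← sub_div, div_le_one pΛ, hΛ]
    exact F.orb_sub_le S (by omega)
  · intro x hx
    have h1 := (hd _ (hmem x hx)).1
    have h2 : HasDerivAt (fun x => f^[q'] (Λ * x)) (itD f q' (Λ * x) * (Λ * 1)) x :=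
      (F.reg.hasDerivAt_iterate q' (Λ * x)).comp x ((hasDerivAt_id x).const_mul Λ)
    have h3 := (h2.sub_const (p' : ℝ)).div_const Λ
    have h4 : (fun x => X.mv 0 1 (Λ * x) / Λ) = fun x => (f^[q'] (Λ * x) - p') / Λ := by
      funext x; rw [X.iter_q']; ring
    rw [h4]
    refine h3.congr_deriv ?_
    rw [inv_pow, Real.sq_sqrt h1.le, one_div, inv_inv]
    field_simp
  · have h1 := F.reg.convexOn_itD q' (X.orb w 4) (X.orb w (s + 6))
      (fun y hy i hi => S.deriv_ne_zero ((X.orb_le w (by omega)).trans hy.1)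
        (lt_of_le_of_lt hy.2 (X.orb_lt w (by omega))) hi) (fun y hy => F.itS_nonpos S hA hy)
    refine ⟨convex_Icc _ _, fun x hx z hz a b ha hb hab => ?_⟩
    have := h1.2 (hmem x hx) (hmem z hz) ha hb hab
    simp only [smul_eq_mul] at this ⊢
    rwa [show Λ * (a * x + b * z) = a * (Λ * x) + b * (Λ * z) by ring]
  · intro x hx
    obtain ⟨h1, h2, -⟩ := hd _ (hmem x hx)
    rw [one_div]
    refine inv_anti₀ (Real.sqrt_pos.2 h1) (Real.sqrt_le_iff.2 ⟨by linarith, ?_⟩)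
    nlinarith
  · intro x hx
    obtain ⟨h1, -, h2⟩ := hd _ (hmem x hx)
    refine inv_le_of_inv_le₀ (by linarith) (Real.le_sqrt_of_sq_le ?_)
    rw [inv_pow, inv_le_iff_one_le_mul₀ (by positivity)]
    nlinarith
  · intro x hx
    have h1 := X.ggap_pos (Λ * x)
    have : X.mv 0 1 (Λ * x) / Λ - x = X.ggap (Λ * x) / Λ := by unfold Cfg.ggap; field_simp
    rw [this]; positivity
  · intro x hx
    have hm := hmem x hx
    have h0 := (X.orb_mem w S.short (k := 4) (by omega)).1
    have h1 := (X.orb_mem w S.short (k := s + 6) (by omega)).2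
    have h2 := (F.gap_near 8 w (Λ * x) (h0.trans hm.1) (hm.2.trans h1)).2
    have h3 := X.ggap_lt_gap (Λ * x)
    have : X.mv 0 1 (Λ * x) / Λ - x = X.ggap (Λ * x) / Λ := by unfold Cfg.ggap; field_simp
    rw [this, div_le_one pΛ]
    have : 0 ≤ (1 + C) ^ 8 * X.gap w := by positivity
    linarith

end Fine

/-- Size of the intervals of a stretch. -/
theorem exists_stretch_bound (B C d : ℝ) : ∃ K, 1 ≤ K ∧
    ∀ (f : ℝ → ℝ) (N : ℕ) (ρ : ℝ) (q : ℕ) (p : ℤ) (q' : ℕ) (p' : ℤ) (X : Cfg f N d ρ q p q' p')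
      (A t ℓ w : ℝ) (m : ℕ), X.Fine B C A t ℓ → A * ℓ ≤ epsK B C d → X.Stretch w m →
      ∀ k ≤ m, X.gap w ≤ K * (X.ggap (X.orb w (k + 1)) * min (k + 1 : ℝ) (m - k + 1 : ℝ) ^ 2) ∧
        X.ggap (X.orb w (k + 1)) * min (k + 1 : ℝ) (m - k + 1 : ℝ) ^ 2 ≤ K * X.gap w := by
  obtain ⟨M, hM1, hM⟩ := exists_bridge_bound (bridgeH B C d) (1 / koeK B C d)
  refine ⟨max 1 (|endK B C d| + 128 * |(1 + C) ^ 8| * M + M), le_max_left _ _, ?_⟩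
  intro f N ρ q p q' p' X A t ℓ w m F hA S k hk
  set K := max 1 (|endK B C d| + 128 * |(1 + C) ^ 8| * M + M)
  have hK : |endK B C d| + 128 * |(1 + C) ^ 8| * M + M ≤ K := le_max_right _ _
  have hE := F.one_le_endK
  have hC := F.one_le
  have hC8 : 1 ≤ (1 + C) ^ 8 := one_le_pow₀ (by linarith)
  rw [abs_of_nonneg (by linarith), abs_of_nonneg (by linarith)] at hK
  have hgw := X.gap_pos w
  have hgk := X.ggap_pos (X.orb w (k + 1))
  have hkm : (k : ℝ) ≤ m := by exact_mod_cast hk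
  have hk0 : (0 : ℝ) ≤ k := by positivity
  set W := min (k + 1 : ℝ) (m - k + 1 : ℝ) with hW
  have hW1 : 1 ≤ W := le_min (by linarith) (by linarith)
  have pM : 0 < (1 + C) ^ 8 * M := by positivity
  by_cases hcase : (k + 1 ≤ 7 ∨ m ≤ k + 1 + 5) ∧ W ≤ 8
  · obtain ⟨h1, h2⟩ := hcase
    have h3 := F.le_ggap_orb S (k := k + 1) (by omega) h1
    have h4 := F.ggap_orb_le S (k := k + 1) (by omega)
    have hW2 : 1 ≤ W ^ 2 := one_le_pow₀ hW1
    have hW3 : W ^ 2 ≤ 64 := by nlinarith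
    constructor
    · calc _ ≤ endK B C d * (X.ggap (X.orb w (k + 1)) * 1) := by rw [mul_one]; exact h3
        _ ≤ K * (X.ggap (X.orb w (k + 1)) * W ^ 2) := by
          refine mul_le_mul (by linarith) (by gcongr) (by positivity) (by linarith)
    · calc _ ≤ (1 + C) ^ 8 * X.gap w * 64 := by gcongr
        _ = 64 * (1 + C) ^ 8 * X.gap w := by ring
        _ ≤ _ := by
          refine mul_le_mul_of_nonneg_right ?_ hgw.le
          nlinarith
  · have hk3 : 3 ≤ k ∧ k + 3 ≤ m := by
      by_contra hcon
      refine hcase ⟨by omega, ?_⟩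
      rcases Nat.lt_or_ge k 3 with h | h
      · have : (k : ℝ) < 3 := by exact_mod_cast h
        exact (min_le_left _ _).trans (by linarith)
      · have : (m : ℝ) < k + 3 := by exact_mod_cast (by omega : m < k + 3)
        exact (min_le_right _ _).trans (by linarith)
    have hm8 : 8 ≤ m := by
      by_contra hcon
      refine hcase ⟨by omega, ?_⟩
      have : (k : ℝ) ≤ 7 := by exact_mod_cast (by omega : k ≤ 7)
      exact (min_le_left _ _).trans (by linarith)
    obtain ⟨s, rfl⟩ := Nat.exists_eq_add_of_le' hm8
    obtain ⟨j, rfl⟩ := Nat.exists_eq_add_of_le' hk3.1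
    set Λ := 8 * (1 + C) ^ 8 * X.gap w with hΛ
    have pΛ : 0 < Λ := by positivity
    have hb := F.bridge S hA hΛ
    have hx : Bridge.Crossing (fun x => X.mv 0 1 (Λ * x) / Λ) (X.orb w 4 / Λ)
        (X.orb w (s + 6) / Λ) (fun i => X.orb w (i + 4) / Λ) (s + 2) := by
      refine ⟨by simp, by simp, fun i hi => ?_, fun i hi => ⟨?_, ?_⟩⟩
      · show X.orb w (i + 1 + 4) / Λ = X.mv 0 1 (Λ * (X.orb w (i + 4) / Λ)) / Λ
        rw [mul_div_cancel₀ _ pΛ.ne', X.mv_orb]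
      · exact div_le_div_of_nonneg_right (X.orb_le w (by omega)) pΛ.le
      · exact div_le_div_of_nonneg_right (X.orb_le w (by omega)) pΛ.le
    have h := hM _ _ _ _ hb _ _ hx j (by omega)
    have e : X.mv 0 1 (Λ * (X.orb w (j + 4) / Λ)) / Λ - X.orb w (j + 4) / Λ =
        X.ggap (X.orb w (j + 3 + 1)) / Λ := by
      rw [mul_div_cancel₀ _ pΛ.ne', X.ggap_orb, X.mv_orb, sub_div]
    simp only [e] at h
    push_cast at h hW hkm
    obtain ⟨ha, hb'⟩ := h
    have hj0 : (0 : ℝ) ≤ j := by positivity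
    have hjs : (j : ℝ) ≤ s + 2 := by exact_mod_cast (by omega : j ≤ s + 2)
    set V := min (j + 1 : ℝ) (s + 2 - j + 1 : ℝ) with hV
    have v1 : V ≤ W := by
      rw [hW]
      refine le_min ((min_le_left _ _).trans (by linarith)) ((min_le_right _ _).trans (by linarith))
    have v2 : W ≤ 4 * V := by
      rcases min_choice (j + 1 : ℝ) (s + 2 - j + 1 : ℝ) with h | h <;> rw [hV, h]
      · exact (min_le_left _ _).trans (by push_cast; linarith)
      · exact (min_le_right _ _).trans (by push_cast; linarith)
    have v0 : 0 ≤ V := le_min (by linarith) (by linarith)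
    set g := X.ggap (X.orb w (j + 3 + 1))
    have v3 : V ^ 2 ≤ W ^ 2 := pow_le_pow_left₀ v0 v1 2
    have v4 : W ^ 2 ≤ 16 * V ^ 2 := by
      have := pow_le_pow_left₀ (by linarith) v2 2
      linarith [this, mul_pow 4 V 2]
    constructor
    · have h1 : Λ ≤ M * (g * V ^ 2) := by
        have : M * (g / Λ * V ^ 2) = M * (g * V ^ 2) / Λ := by ring
        rw [this, one_le_div pΛ] at ha
        exact ha
      calc X.gap w ≤ Λ := by rw [hΛ]; nlinarith
        _ ≤ M * (g * V ^ 2) := h1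
        _ ≤ K * (g * W ^ 2) := by
          refine mul_le_mul ?_ (by gcongr) (by positivity) (by linarith)
          nlinarith
    · have h1 : g * V ^ 2 ≤ M * Λ := by
        have : g / Λ * V ^ 2 = g * V ^ 2 / Λ := by ring
        rw [this, div_le_iff₀ pΛ] at hb'
        exact hb'
      calc g * W ^ 2 ≤ g * (16 * V ^ 2) := by gcongr
        _ = 16 * (g * V ^ 2) := by ring
        _ ≤ 16 * (M * Λ) := by gcongr
        _ = 128 * (1 + C) ^ 8 * M * X.gap w := by rw [hΛ]; ring
        _ ≤ K * X.gap w := by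
          refine mul_le_mul_of_nonneg_right ?_ hgw.le
          linarith
end Cfg
end MCircle

namespace MCircle

/-- Conjugacy between lifts that respects critical points. -/
structure Conj (f g h : ℝ → ℝ) : Prop where
  mono : StrictMono h
  surj : Function.Surjective h
  add_one : ∀ x, h (x + 1) = h x + 1
  comm : ∀ x, h (f x) = g (h x)
  crit : ∀ c, deriv f c = 0 ↔ deriv g (h c) = 0

namespace Cfg

variable {f g h : ℝ → ℝ} {N : ℕ} {d ρ : ℝ} {q : ℕ} {p : ℤ} {q' : ℕ} {p' : ℤ}
variable {X : Cfg f N d ρ q p q' p'} {Y : Cfg g N d ρ q p q' p'}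
variable {B C A t ℓ A' t' ℓ' w w' K x x' : ℝ} {m : ℕ}

lemma conj_mv (H : Conj f g h) (i j : ℤ) (x : ℝ) : h (X.mv i j x) = Y.mv i j (h x) :=
  X.sys.Φ_conj Y.sys H.add_one H.comm _ _ x

lemma conj_iterate (H : Conj f g h) (i : ℕ) (x : ℝ) : h (f^[i] x) = g^[i] (h x) :=
  Function.Semiconj.iterate_right (f := h) H.comm i x

variable (X Y) in
lemma conj_spot (H : Conj f g h) (y : ℝ) : X.Spot y ↔ Y.Spot (h y) := by
  constructor
  · rintro ⟨u, ⟨h1, h2⟩, i, hi, hc⟩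
    refine ⟨h u, ⟨H.mono.monotone h1, ?_⟩, i, hi, ?_⟩
    · rw [← conj_mv (X := X) H]; exact H.mono h2
    · rw [← conj_iterate H, ← H.crit]; exact hc
  · rintro ⟨v, ⟨h1, h2⟩, i, hi, hc⟩
    obtain ⟨u, rfl⟩ := H.surj v
    rw [← conj_mv (X := X) H] at h2
    refine ⟨u, ⟨H.mono.le_iff_le.1 h1, H.mono.lt_iff_lt.1 h2⟩, i, hi, ?_⟩
    rw [H.crit, conj_iterate H]; exact hc

variable (X) in
lemma exists_spot (x : ℝ) {n : ℕ} (hn : X.β + X.α ≤ n * X.α) : ∃ k < n, X.Spot (X.orb x k) := by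
  obtain ⟨c, hc⟩ := X.sys.exists_crit_pt
  obtain ⟨i, hi, b, h1, h2⟩ := X.exists_preimage_mem c x
  set u := X.sys.Φ (-(i : ℤ)) b c with hu
  have hcu : deriv f (f^[i] u) = 0 := by
    rw [hu, X.sys.iterate_Φ, add_neg_cancel, X.sys.Φ_zero_left, X.sys.deriv_add_int]
    exact hc
  have h3 : u < X.orb x n := lt_of_lt_of_le h2 (X.mv_le_mv (by push_cast; linarith) x)
  have key : ∀ n, u < X.orb x n → ∃ k < n, X.Spot (X.orb x k) := by
    intro n
    induction n with
    | zero => intro h; rw [X.orb_zero] at h; linarith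
    | succ n ih =>
      intro h
      by_cases h5 : u < X.orb x n
      · obtain ⟨k, hk, hs⟩ := ih h5
        exact ⟨k, by omega, hs⟩
      · exact ⟨n, by omega, u, ⟨not_lt.1 h5, by rw [X.mv_orb]; exact h⟩, i, hi, hcu⟩
  exact key n h3

variable (X) in
/-- Every point is in a stretch. -/
lemma exists_stretch (x : ℝ) : ∃ k m : ℕ, k ≤ m ∧ 1 ≤ k ∧
    X.Stretch (X.mv 0 (-(k + 1 : ℕ) : ℤ) x) m := by
  classical
  have hα := X.α_pos
  have hαβ := X.α_lt
  obtain ⟨n, hn1, hn2⟩ : ∃ n : ℕ, X.β ≤ n * X.α ∧ n * X.α < X.β + X.α := by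
    refine ⟨⌈X.β / X.α⌉₊, ?_, ?_⟩
    · exact (div_le_iff₀ hα).1 (Nat.le_ceil _)
    · have := Nat.ceil_lt_add_one (show 0 ≤ X.β / X.α from (div_pos X.β_pos hα).le)
      calc _ < (X.β / X.α + 1) * X.α := mul_lt_mul_of_pos_right this hα
        _ = _ := by field_simp
  have hn3 : X.β + X.α ≤ (n + 1 : ℕ) * X.α := by push_cast; linarith
  have eR : ∃ j, X.Spot (X.mv 0 (j : ℕ) x) := by
    obtain ⟨j, -, hj⟩ := X.exists_spot x hn3
    exact ⟨j, hj⟩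
  have shift : ∀ a b : ℕ, X.orb (X.mv 0 (-(a : ℕ) : ℤ) x) b = X.mv 0 (b - a : ℤ) x := by
    intro a b
    unfold orb
    rw [X.mv_mv, zero_add, sub_eq_add_neg]
  have eL' : ∃ j ≤ n, X.Spot (X.mv 0 (-(j + 1 : ℕ) : ℤ) x) := by
    obtain ⟨j, hj, hs⟩ := X.exists_spot (X.mv 0 (-(n + 1 : ℕ) : ℤ) x) hn3
    rw [shift] at hs
    refine ⟨n - j, by omega, ?_⟩
    convert hs using 2
    push_cast [Nat.cast_sub (show j ≤ n by omega)]
    ring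
  have eL : ∃ j, X.Spot (X.mv 0 (-(j + 1 : ℕ) : ℤ) x) := eL'.imp fun j h => h.2
  have hR := Nat.find_spec eR
  have hL := Nat.find_spec eL
  have hRm := fun j hj => Nat.find_min eR (m := j) hj
  have hLm := fun j hj => Nat.find_min eL (m := j) hj
  have hRn : Nat.find eR ≤ n := by
    obtain ⟨j, hj, hs⟩ := X.exists_spot x hn3
    exact (Nat.find_min' eR hs).trans (by omega)
  have hLn : Nat.find eL ≤ n := by
    obtain ⟨j, hj, hs⟩ := eL'
    exact (Nat.find_min' eL hs).trans hj
  set r := Nat.find eR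
  set l := Nat.find eL
  refine ⟨l + 1, r + l + 1, by omega, by omega, ?_, ?_, ?_, ?_⟩
  · have h1 : ((r + l + 1 + 2 : ℕ) : ℝ) ≤ n + n + 3 := by
      exact_mod_cast (by omega : r + l + 1 + 2 ≤ n + n + 3)
    have := mul_le_mul_of_nonneg_right h1 hα.le
    linarith
  · rw [shift]
    convert hL using 2
    push_cast; ring
  · rw [shift]
    convert hR using 2
    push_cast; ring
  · intro k hk1 hk2
    rw [shift]
    rcases Nat.lt_or_ge k (l + 2) with h | h
    · have := hLm (l + 1 - k) (by omega)
      convert this using 3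
      push_cast [Nat.cast_sub (show k ≤ l + 1 by omega)]
      ring
    · have := hRm (k - (l + 2)) (by omega)
      convert this using 3
      push_cast [Nat.cast_sub h]
      ring

variable (X Y) in
lemma Stretch.conj (H : Conj f g h) (S : X.Stretch w m) : Y.Stretch (h w) m := by
  have e : ∀ k, h (X.orb w k) = Y.orb (h w) k := fun k => conj_mv H 0 k w
  refine ⟨S.short, ?_, ?_, fun k h1 h2 => ?_⟩
  · rw [← e, ← conj_spot X Y H]; exact S.left
  · rw [← e, ← conj_spot X Y H]; exact S.right
  · rw [← e, ← conj_spot X Y H]; exact S.free k h1 h2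

/-- The conclusion of `exists_stretch_bound`. -/
def Bounded (X : Cfg f N d ρ q p q' p') (K w : ℝ) (m : ℕ) : Prop :=
  ∀ k ≤ m, X.gap w ≤ K * (X.ggap (X.orb w (k + 1)) * min (k + 1 : ℝ) (m - k + 1 : ℝ) ^ 2) ∧
    X.ggap (X.orb w (k + 1)) * min (k + 1 : ℝ) (m - k + 1 : ℝ) ^ 2 ≤ K * X.gap w

lemma Bounded.orb_sub_le (bX : X.Bounded K w m) (bY : Y.Bounded K w' m) (hK : 1 ≤ K) {u : ℕ}
    (hu : 1 ≤ u) (n : ℕ) : u + n ≤ m + 2 →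
    (Y.orb w' (u + n) - Y.orb w' u) * X.gap w ≤
      K ^ 2 * ((X.orb w (u + n) - X.orb w u) * Y.gap w') := by
  have pX := X.gap_pos w
  have pY := Y.gap_pos w'
  induction n with
  | zero => intro _; simp
  | succ n ih =>
    intro h
    have h1 := ih (by omega)
    obtain ⟨k, rfl⟩ := Nat.exists_eq_add_of_le' hu
    have h2 := (bX (k + n) (by omega)).1
    have h3 := (bY (k + n) (by omega)).2
    rw [show k + n + 1 = k + 1 + n by ring] at h2 h3
    set W := min (((k + n : ℕ) : ℝ) + 1) (m - ((k + n : ℕ) : ℝ) + 1) ^ 2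
    have gX := X.ggap_pos (X.orb w (k + 1 + n))
    have gY := Y.ggap_pos (Y.orb w' (k + 1 + n))
    have h4 : Y.ggap (Y.orb w' (k + 1 + n)) * X.gap w ≤
        K ^ 2 * (X.ggap (X.orb w (k + 1 + n)) * Y.gap w') := by
      calc _ ≤ Y.ggap (Y.orb w' (k + 1 + n)) * (K * (X.ggap (X.orb w (k + 1 + n)) * W)) := by gcongr
        _ = K * X.ggap (X.orb w (k + 1 + n)) * (Y.ggap (Y.orb w' (k + 1 + n)) * W) := by ring
        _ ≤ K * X.ggap (X.orb w (k + 1 + n)) * (K * Y.gap w') := by gcongr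
        _ = _ := by ring
    rw [X.ggap_orb, Y.ggap_orb] at h4
    rw [show k + 1 + (n + 1) = k + 1 + n + 1 by ring]
    linarith

lemma Bounded.first_le (bX : X.Bounded K w m) :
    X.gap w ≤ K * (X.orb w 2 - X.orb w 1) := by
  have h := (bX 0 (Nat.zero_le _)).1
  have e : min ((0 : ℕ) + 1 : ℝ) (m - (0 : ℕ) + 1 : ℝ) = 1 := by
    push_cast
    rw [min_eq_left (by have : (0 : ℝ) ≤ m := by positivity
                        linarith)]
    ring
  rw [e, X.ggap_orb] at h
  simpa using h

lemma Bounded.last_le (bX : X.Bounded K w m) :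
    X.gap w ≤ K * (X.orb w (m + 2) - X.orb w (m + 1)) := by
  have h := (bX m le_rfl).1
  have e : min ((m : ℕ) + 1 : ℝ) (m - (m : ℕ) + 1 : ℝ) = 1 := by
    rw [min_eq_right (by have : (0 : ℝ) ≤ m := by positivity
                         linarith)]
    ring
  rw [e, X.ggap_orb] at h
  simpa using h

lemma mv_compare (F : X.Fine B C A t ℓ) (F' : Y.Fine B C A' t' ℓ') (hK : 1 ≤ K) {k : ℕ}
    (hkm : k ≤ m) (hk : 1 ≤ k) (hw : w = X.mv 0 (-(k + 1 : ℕ) : ℤ) x)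
    (hw' : w' = Y.mv 0 (-(k + 1 : ℕ) : ℤ) x') (hm : (m + 2 : ℕ) * X.α ≤ 8 * X.β)
    (bX : X.Bounded K w m) (bY : Y.Bounded K w' m) {j : ℤ} (hj : (|(j : ℝ)| - 1) * X.α < X.β) :
    |Y.mv 0 j x' - x'| * X.gap x ≤
      2 * ((1 + C) ^ 8) ^ 2 * K ^ 2 * (|X.mv 0 j x - x| * Y.gap x') := by
  have hC := F.one_le
  have hα := X.α_pos
  have hmY : (m + 2 : ℕ) * Y.α ≤ 8 * Y.β := hm
  have hx : X.orb w (k + 1) = x := by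
    rw [hw]; unfold orb; rw [X.mv_mv]; simp
  have hx' : Y.orb w' (k + 1) = x' := by
    rw [hw']; unfold orb; rw [Y.mv_mv]; simp
  obtain ⟨o1, o2⟩ := X.orb_mem w hm (show k + 1 ≤ m + 2 by omega)
  obtain ⟨o1', o2'⟩ := Y.orb_mem w' hmY (show k + 1 ≤ m + 2 by omega)
  rw [hx] at o1 o2
  rw [hx'] at o1' o2'
  have gX := (F.gap_near 8 w x o1 o2).2
  have gY := (F'.gap_near 8 w' x' o1' o2').1
  have pX := X.gap_pos w
  have pY := Y.gap_pos w'
  have pX' := X.gap_pos x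
  have pY' := Y.gap_pos x'
  set D := (1 + C) ^ 8 with hD
  have hD1 : 1 ≤ D := one_le_pow₀ (by linarith)
  have near : ∀ a b, 0 ≤ a → 0 ≤ b → a * X.gap w ≤ K ^ 2 * (b * Y.gap w') →
      a * X.gap x ≤ 2 * D ^ 2 * K ^ 2 * (b * Y.gap x') := by
    intro a b ha hb hab
    calc a * X.gap x ≤ a * (D * X.gap w) := by gcongr
      _ = D * (a * X.gap w) := by ring
      _ ≤ D * (K ^ 2 * (b * Y.gap w')) := by gcongr
      _ ≤ D * (K ^ 2 * (b * (D * Y.gap x'))) := by gcongr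
      _ = 1 * (D ^ 2 * K ^ 2 * (b * Y.gap x')) := by ring
      _ ≤ 2 * (D ^ 2 * K ^ 2 * (b * Y.gap x')) := by
        refine mul_le_mul_of_nonneg_right one_le_two (by positivity)
      _ = _ := by ring
  have far : ∀ a b, 0 ≤ a → 0 ≤ b → a ≤ 2 * D * Y.gap x' → X.gap w ≤ K * b →
      a * X.gap x ≤ 2 * D ^ 2 * K ^ 2 * (b * Y.gap x') := by
    intro a b ha hb h1 h2
    calc a * X.gap x ≤ (2 * D * Y.gap x') * (D * X.gap w) := by gcongr
      _ ≤ (2 * D * Y.gap x') * (D * (K * b)) := by gcongr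
      _ = 2 * D ^ 2 * (b * Y.gap x') * (K * 1) := by ring
      _ ≤ 2 * D ^ 2 * (b * Y.gap x') * (K * K) := by gcongr
      _ = _ := by ring
  have hC2 : (1 + C) ^ 2 * (1 + C) ^ 2 ≤ D := by
    rw [← pow_add]; exact pow_le_pow_right₀ (by linarith) (by norm_num)
  have hC2' : 1 ≤ (1 + C) ^ 2 := one_le_pow₀ (by linarith)
  have hYα : Y.α = X.α := rfl
  have hYβ : Y.β = X.β := rfl
  have hαβ := X.α_lt
  rcases Int.eq_nat_or_neg j with ⟨n, rfl | rfl⟩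
  · have e : X.mv 0 n x = X.orb w (k + 1 + n) := by rw [← X.orb_orb, hx]; rfl
    have e' : Y.mv 0 n x' = Y.orb w' (k + 1 + n) := by rw [← Y.orb_orb, hx']; rfl
    have l := X.orb_le w (show k + 1 ≤ k + 1 + n by omega)
    have l' := Y.orb_le w' (show k + 1 ≤ k + 1 + n by omega)
    rw [hx] at l
    rw [hx'] at l'
    have m2 := Y.mv_le_mv (i := 0) (j := n) (i' := 2) (j' := 0) (by
      rw [hYα, hYβ]
      rw [Int.cast_natCast, abs_of_nonneg (by positivity)] at hj
      push_cast
      linarith) x'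
    rw [e', e, abs_of_nonneg (by linarith), abs_of_nonneg (by linarith)]
    rw [e'] at m2
    by_cases hn : k + 1 + n ≤ m + 2
    · have := bX.orb_sub_le bY hK (u := k + 1) (by omega) n hn
      rw [hx, hx'] at this
      exact near _ _ (by linarith) (by linarith) this
    · refine far _ _ (by linarith) (by linarith) ?_ ?_
      · have := F'.mv_sub_le 2 x'
        push_cast at this
        have h3 : (1 + C) ^ 2 * Y.gap x' ≤ D * Y.gap x' := by
          refine mul_le_mul_of_nonneg_right (le_trans ?_ hC2) pY'.le
          nlinarith
        linarith
      · refine bX.last_le.trans (mul_le_mul_of_nonneg_left ?_ (by linarith))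
        have l1 := X.orb_le w (show m + 2 ≤ k + 1 + n by omega)
        have l2 := X.orb_le w (show k + 1 ≤ m + 1 by omega)
        rw [hx] at l2
        linarith
  · have l : X.mv 0 (-n : ℤ) x ≤ x := by
      have := X.mv_le_mv (i := 0) (j := (-n : ℤ)) (i' := 0) (j' := 0) (by
        push_cast
        have : 0 ≤ (n : ℝ) * X.α := by positivity
        linarith) x
      rwa [X.mv_zero] at this
    have l' : Y.mv 0 (-n : ℤ) x' ≤ x' := by
      have := Y.mv_le_mv (i := 0) (j := (-n : ℤ)) (i' := 0) (j' := 0) (by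
        push_cast
        have : 0 ≤ (n : ℝ) * X.α := by positivity
        rw [hYα]
        linarith) x'
      rwa [Y.mv_zero] at this
    have m2 := Y.mv_le_mv (i' := 0) (j' := (-n : ℤ)) (i := -2) (j := 0) (by
      rw [hYα, hYβ]
      push_cast at hj ⊢
      rw [abs_neg, abs_of_nonneg (by positivity)] at hj
      linarith) x'
    rw [abs_sub_comm, abs_of_nonneg (by linarith), abs_sub_comm (X.mv _ _ _),
      abs_of_nonneg (by linarith)]
    by_cases hn : n ≤ k
    · obtain ⟨i, rfl⟩ := Nat.exists_eq_add_of_le' hn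
      have e : X.mv 0 (-n : ℤ) x = X.orb w (i + 1) := by
        rw [hw]; unfold orb; rw [X.mv_mv]; congr 1; push_cast; ring
      have e' : Y.mv 0 (-n : ℤ) x' = Y.orb w' (i + 1) := by
        rw [hw']; unfold orb; rw [Y.mv_mv]; congr 1; push_cast; ring
      have := bX.orb_sub_le bY hK (u := i + 1) (by omega) n (by omega)
      rw [show i + 1 + n = i + n + 1 by ring, hx, hx', ← e, ← e'] at this
      exact near _ _ (by linarith) (by linarith) this
    · refine far _ _ (by linarith) (by linarith) ?_ ?_
      · have h3 := F'.mv_sub_le 2 (Y.mv (-2) 0 x')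
        rw [Y.mv_mv] at h3
        norm_num at h3
        have h4 := (F'.gap_near 2 (Y.mv (-2) 0 x') x' (by linarith) (by
          rw [Y.mv_mv]; norm_num)).1
        have h5 : 2 * (1 + C) ^ 2 * Y.gap (Y.mv (-2) 0 x') ≤ 2 * D * Y.gap x' := by
          calc _ ≤ 2 * (1 + C) ^ 2 * ((1 + C) ^ 2 * Y.gap x') := by gcongr
            _ = 2 * ((1 + C) ^ 2 * (1 + C) ^ 2) * Y.gap x' := by ring
            _ ≤ _ := by gcongr
        linarith
      · refine bX.first_le.trans (mul_le_mul_of_nonneg_left ?_ (by linarith))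
        have l1 := X.orb_le w (show 2 ≤ k + 1 by omega)
        have l2 : X.mv 0 (-n : ℤ) x ≤ X.orb w 1 := by
          rw [hw]; unfold orb; rw [X.mv_mv]
          refine X.mv_le_mv ?_ x
          push_cast
          have : (k : ℝ) + 1 ≤ n := by exact_mod_cast (by omega : k + 1 ≤ n)
          nlinarith
        rw [hx] at l1
        linarith

/-- Comparison of the small scale geometry of two conjugate maps. -/
theorem exists_compare (B C d : ℝ) : ∃ K, 1 ≤ K ∧
    ∀ (f g h : ℝ → ℝ) (N : ℕ) (ρ : ℝ) (q : ℕ) (p : ℤ) (q' : ℕ) (p' : ℤ)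
      (X : Cfg f N d ρ q p q' p') (Y : Cfg g N d ρ q p q' p') (A t ℓ A' t' ℓ' : ℝ),
      X.Fine B C A t ℓ → A * ℓ ≤ epsK B C d → Y.Fine B C A' t' ℓ' → A' * ℓ' ≤ epsK B C d →
      Conj f g h → ∀ (x : ℝ) (j : ℤ), (|(j : ℝ)| - 1) * X.α < X.β →
      |Y.mv 0 j (h x) - h x| * X.gap x ≤ K * (|X.mv 0 j x - x| * Y.gap (h x)) ∧
      |X.mv 0 j x - x| * Y.gap (h x) ≤ K * (|Y.mv 0 j (h x) - h x| * X.gap x) := by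
  obtain ⟨K, hK1, hK⟩ := exists_stretch_bound B C d
  refine ⟨max 1 (2 * ((1 + C) ^ 8) ^ 2 * K ^ 2), le_max_left _ _, ?_⟩
  intro f g h N ρ q p q' p' X Y A t ℓ A' t' ℓ' F hA F' hA' H x j hj
  obtain ⟨k, m, hkm, hk, S⟩ := X.exists_stretch x
  have S' := S.conj X Y H
  have b1 := hK f N ρ q p q' p' X A t ℓ _ m F hA S
  have b2 := hK g N ρ q p q' p' Y A' t' ℓ' _ m F' hA' S'
  rw [conj_mv (Y := Y) H] at b2
  have pX := X.gap_pos x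
  have pY := Y.gap_pos (h x)
  constructor
  · refine (mv_compare F F' hK1 hkm hk rfl rfl S.short b1 b2 hj).trans ?_
    exact mul_le_mul_of_nonneg_right (le_max_right _ _) (by positivity)
  · refine (mv_compare F' F hK1 hkm hk rfl rfl S.short b2 b1 hj).trans ?_
    exact mul_le_mul_of_nonneg_right (le_max_right _ _) (by positivity)

end Cfg
end MCircle

namespace MCircle

/-- The sequence of closest returns of the rotation by `ρ`. -/
structure Returns (ρ : ℝ) (v : ℕ → ℕ × ℤ) : Prop where
  irr : Irrational ρ
  ret : ∀ n, IsReturn ρ (v n)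
  next : ∀ n, IsNextReturn ρ (v n) (v (n + 1))

/-- The closest returns of the reflected rotation. -/
def flip (v : ℕ → ℕ × ℤ) : ℕ → ℕ × ℤ := fun n => ((v n).1, -(v n).2)

/-- The displacement of the `n`-th closest return. -/
def disp (ρ : ℝ) (v : ℕ → ℕ × ℤ) (n : ℕ) : ℝ := (v n).1 * ρ - (v n).2

lemma disp_flip (ρ : ℝ) (v : ℕ → ℕ × ℤ) (n : ℕ) : disp (-ρ) (flip v) n = -disp ρ v n := by
  unfold disp flip; push_cast; ring

namespace Returns

variable {ρ : ℝ} {v : ℕ → ℕ × ℤ}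

lemma reflect (R : Returns ρ v) : Returns (-ρ) (flip v) :=
  ⟨R.irr.neg, fun n => (R.ret n).reflect, fun n => (R.next n).reflect⟩

lemma abs_lt (R : Returns ρ v) (n : ℕ) : |disp ρ v (n + 1)| < |disp ρ v n| := (R.next n).1

lemma mul_neg (R : Returns ρ v) (n : ℕ) : disp ρ v n * disp ρ v (n + 1) < 0 :=
  (R.next n).mul_neg R.irr (R.ret n) (R.ret (n + 1))

lemma disp_ne_zero (R : Returns ρ v) (n : ℕ) : disp ρ v n ≠ 0 := fun h => by
  have := R.mul_neg n
  simp [h] at this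

lemma mul_pos (R : Returns ρ v) (n : ℕ) : 0 < disp ρ v n * disp ρ v (n + 2) := by
  have h1 := R.mul_neg n
  have h2 := R.mul_neg (n + 1)
  have h3 := R.disp_ne_zero (n + 1)
  have h4 := mul_pos_of_neg_of_neg h1 h2
  have h5 : 0 < disp ρ v (n + 1) ^ 2 := by positivity
  by_contra h
  nlinarith

lemma two_mul_le (R : Returns ρ v) (n : ℕ) : 2 * |disp ρ v (n + 2)| ≤ |disp ρ v n| := by
  have h1 := IsNextReturn.abs_add_le R.irr (R.ret n) (R.ret (n + 1)) (R.ret (n + 2)) (R.next n)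
    (R.next (n + 1))
  change |disp ρ v (n + 1)| + |disp ρ v (n + 2)| ≤ |disp ρ v n| at h1
  linarith [R.abs_lt (n + 1)]

lemma abs_le_half (R : Returns ρ v) (n : ℕ) : |disp ρ v n| ≤ 1 / 2 := (R.ret n).2.1

lemma eight_mul_le (R : Returns ρ v) {n : ℕ} (hn : 4 ≤ n) : 8 * |disp ρ v n| ≤ 1 := by
  obtain ⟨k, rfl⟩ := Nat.exists_eq_add_of_le' hn
  have h1 := R.two_mul_le k
  have h2 := R.two_mul_le (k + 2)
  have h3 := R.abs_le_half k
  rw [show k + 2 + 2 = k + 4 by ring] at h2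
  linarith

lemma cfg (R : Returns ρ v) {f : ℝ → ℝ} {N : ℕ} {d : ℝ} (S : Sys f N d ρ) {n : ℕ} (hn : 4 ≤ n)
    (hs : disp ρ v n < 0) : Cfg f N d ρ (v n).1 (v n).2 (v (n + 1)).1 (v (n + 1)).2 := by
  refine ⟨S, (R.next n).lev R.irr (R.ret n) (R.ret (n + 1)) hs, ?_⟩
  have := R.eight_mul_le hn
  rw [abs_of_neg hs] at this
  unfold disp at this
  linarith

end Returns

namespace Sys

variable {f : ℝ → ℝ} {N : ℕ} {d ρ : ℝ} {v : ℕ → ℕ × ℤ}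

lemma RB.mono {S : Sys f N d ρ} {a b : ℤ} {C C' : ℝ} (h : S.RB a b C) (hC : C ≤ C') :
    S.RB a b C' := fun x =>
  ⟨(h x).1.trans (mul_le_mul_of_nonneg_right hC (abs_nonneg _)),
    (h x).2.trans (mul_le_mul_of_nonneg_right hC (abs_nonneg _))⟩

lemma exists_rb_of_neg (S : Sys f N d ρ) : ∃ C, 1 ≤ C ∧ ∀ v, Returns ρ v → ∀ n, 4 ≤ n →
    disp ρ v n < 0 → S.RB (-(v n).1) (v n).2 C := by
  obtain ⟨A, hA⟩ := S.exists_reg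
  obtain ⟨K, hK, hs⟩ := S.exists_slopeBd_three
  set B := K ^ (64 * N) * Real.exp (A * (32 * 3)) with hB
  refine ⟨max 1 (B * (2 + 4 * B) ^ 2), le_max_left _ _, fun v R n hn hd => ?_⟩
  have X := R.cfg S hn hd
  have := X.cr_of_slopeBd hA hK hs fun x => by linarith [X.mv_eight_le x]
  exact this.rb.mono (le_max_right _ _)

lemma exists_rb (S : Sys f N d ρ) : ∃ C, 1 ≤ C ∧ ∀ v, Returns ρ v → ∀ n, 4 ≤ n →
    S.RB (-(v n).1) (v n).2 C := by
  obtain ⟨C, hC, h⟩ := S.exists_rb_of_neg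
  obtain ⟨C', hC', h'⟩ := S.reflect.exists_rb_of_neg
  refine ⟨max C C', le_max_of_le_left hC, fun v R n hn => ?_⟩
  rcases lt_or_gt_of_ne (R.disp_ne_zero n) with hd | hd
  · exact (h v R n hn hd).mono (le_max_left _ _)
  · have := h' (flip v) R.reflect n hn (by rw [disp_flip]; linarith)
    simpa [flip] using this.of_reflect.mono (le_max_right _ _)

lemma len_add_le (S : Sys f N d ρ) {a b a' b' : ℤ} (h0 : 0 < (a * ρ + b) * (a' * ρ + b'))
    (h : 2 * |a * ρ + b| ≤ |a' * ρ + b'|) (x : ℝ) :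
    S.len a b x + S.len a b (S.Φ a b x) ≤ S.len a' b' x := by
  unfold len
  have e0 : S.Φ 0 0 x = x := S.Φ_zero x
  rcases lt_trichotomy (a * ρ + b) 0 with h1 | h1 | h1
  · have h2 : a' * ρ + b' < 0 := by by_contra hc; nlinarith
    rw [abs_of_neg h1, abs_of_neg h2] at h
    have k1 := S.Φ_le_Φ (a := a) (b := b) (a' := 0) (b' := 0) (by push_cast; linarith) x
    have k2 := S.Φ_le_Φ (a := a + a) (b := b + b) (a' := a) (b' := b) (by push_cast; linarith) x
    have k3 := S.Φ_le_Φ (a := a') (b := b') (a' := a + a) (b' := b + b)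
      (by push_cast; linarith) x
    rw [S.Φ_Φ, abs_of_nonpos (by linarith), abs_of_nonpos (by linarith),
      abs_of_nonpos (by linarith)]
    linarith
  · simp [h1] at h0
  · have h2 : 0 < a' * ρ + b' := by by_contra hc; nlinarith
    rw [abs_of_pos h1, abs_of_pos h2] at h
    have k1 := S.Φ_le_Φ (a' := a) (b' := b) (a := 0) (b := 0) (by push_cast; linarith) x
    have k2 := S.Φ_le_Φ (a' := a + a) (b' := b + b) (a := a) (b := b) (by push_cast; linarith) x
    have k3 := S.Φ_le_Φ (a' := a') (b' := b') (a := a + a) (b := b + b)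
      (by push_cast; linarith) x
    rw [S.Φ_Φ, abs_of_nonneg (by linarith), abs_of_nonneg (by linarith),
      abs_of_nonneg (by linarith)]
    linarith

/-- The length of the `n`-th fundamental interval at `x`. -/
def ret (S : Sys f N d ρ) (v : ℕ → ℕ × ℤ) (n : ℕ) (x : ℝ) : ℝ := S.len (-(v n).1) (v n).2 x

lemma ret_reflect (S : Sys f N d ρ) (v : ℕ → ℕ × ℤ) (n : ℕ) (x : ℝ) :
    S.reflect.ret (flip v) n x = S.ret v n (-x) := by
  unfold ret
  rw [S.len_reflect]
  simp [flip]

lemma ret_nonneg (S : Sys f N d ρ) (v : ℕ → ℕ × ℤ) (n : ℕ) (x : ℝ) : 0 ≤ S.ret v n x :=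
  abs_nonneg _

lemma len_pos (S : Sys f N d ρ) {a b : ℤ} (h : a * ρ + b ≠ 0) (x : ℝ) : 0 < S.len a b x := by
  unfold len
  rw [abs_pos, sub_ne_zero]
  have e0 : S.Φ 0 0 x = x := S.Φ_zero x
  rcases lt_or_gt_of_ne h with h | h
  · have := S.Φ_lt_Φ (a := a) (b := b) (a' := 0) (b' := 0) (by push_cast; linarith) x
    linarith
  · have := S.Φ_lt_Φ (a' := a) (b' := b) (a := 0) (b := 0) (by push_cast; linarith) x
    linarith

lemma disp_eq (ρ : ℝ) (v : ℕ → ℕ × ℤ) (n : ℕ) :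
    ((-(v n).1 : ℤ) : ℝ) * ρ + (v n).2 = -disp ρ v n := by
  unfold disp; push_cast; ring

lemma ret_pos (S : Sys f N d ρ) (R : Returns ρ v) (n : ℕ) (x : ℝ) : 0 < S.ret v n x :=
  S.len_pos (by rw [disp_eq]; exact neg_ne_zero.2 (R.disp_ne_zero n)) x

lemma ret_add_two_le (S : Sys f N d ρ) (R : Returns ρ v) {C : ℝ} (hC : 1 ≤ C) {n : ℕ}
    (h : S.RB (-(v (n + 2)).1) (v (n + 2)).2 C) (x : ℝ) :
    S.ret v (n + 2) x ≤ C / (1 + C) * S.ret v n x := by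
  have h1 := S.len_add_le (a := -(v (n + 2)).1) (b := (v (n + 2)).2) (a' := -(v n).1)
    (b' := (v n).2) (by rw [disp_eq, disp_eq]; linarith [R.mul_pos n])
    (by rw [disp_eq, disp_eq, abs_neg, abs_neg]; exact R.two_mul_le n) x
  have h2 := (h x).2
  change S.ret v (n + 2) x ≤ _ at h2
  change S.ret v (n + 2) x + _ ≤ S.ret v n x at h1
  rw [div_mul_eq_mul_div, le_div_iff₀ (by linarith)]
  nlinarith

/-- Fundamental intervals shrink geometrically. -/
lemma ret_add_le (S : Sys f N d ρ) (R : Returns ρ v) {C : ℝ} (hC : 1 ≤ C) {n₀ : ℕ}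
    (h : ∀ n, n₀ ≤ n → S.RB (-(v n).1) (v n).2 C) {n : ℕ} (hn : n₀ ≤ n) (k : ℕ) (x : ℝ) :
    S.ret v (n + 2 * k) x ≤ (C / (1 + C)) ^ k * S.ret v n x := by
  induction k with
  | zero => simp
  | succ k ih =>
    have h1 := S.ret_add_two_le R hC (h (n + 2 * k + 2) (by omega)) x
    rw [show n + 2 * (k + 1) = n + 2 * k + 2 by ring, pow_succ']
    refine h1.trans ?_
    rw [mul_assoc]
    exact mul_le_mul_of_nonneg_left ih (by positivity)

lemma ret_le_one (S : Sys f N d ρ) (R : Returns ρ v) (n : ℕ) (x : ℝ) : S.ret v n x ≤ 1 := by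
  have h := abs_le.1 (R.abs_le_half n)
  have e := disp_eq ρ v n
  have h1 := S.Φ_le_Φ (a := -(v n).1) (b := (v n).2) (a' := 0) (b' := 1)
    (by rw [e]; push_cast; linarith) x
  have h2 := S.Φ_le_Φ (a' := -(v n).1) (b' := (v n).2) (a := 0) (b := -1)
    (by rw [e]; push_cast; linarith) x
  rw [S.Φ_zero_left] at h1 h2
  push_cast at h1 h2
  unfold ret len
  rw [abs_le]
  constructor <;> linarith

lemma exists_pow_le {C ε : ℝ} (hC : 1 ≤ C) (hε : 0 < ε) : ∃ k : ℕ, (C / (1 + C)) ^ k ≤ ε := by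
  have h0 : 0 ≤ C / (1 + C) := by positivity
  obtain ⟨k, hk⟩ := exists_pow_lt_of_lt_one hε
    (show C / (1 + C) < 1 from (div_lt_one (by linarith)).2 (by linarith))
  exact ⟨k, hk.le⟩

/-- Fundamental intervals are uniformly small. -/
lemma exists_ret_le (S : Sys f N d ρ) (R : Returns ρ v) {ε : ℝ} (hε : 0 < ε) :
    ∃ n₀, 4 ≤ n₀ ∧ ∀ n, n₀ ≤ n → ∀ x, S.ret v n x ≤ ε := by
  obtain ⟨C, hC, h⟩ := S.exists_rb
  obtain ⟨k, hk⟩ := exists_pow_le hC hε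
  refine ⟨4 + 2 * k, by omega, fun n hn x => ?_⟩
  obtain ⟨m, rfl⟩ := Nat.exists_eq_add_of_le' hn
  have h1 := S.ret_add_le R hC (h v R) (n := m + 4) (by omega) k x
  rw [show m + (4 + 2 * k) = m + 4 + 2 * k by ring]
  refine h1.trans ?_
  calc _ ≤ ε * 1 := mul_le_mul hk (S.ret_le_one R _ x) (S.ret_nonneg v _ x) hε.le
    _ = ε := mul_one ε

end Sys

/-- The universal cross ratio distortion bound. -/
def uniB (N : ℕ) (d : ℝ) : ℝ := (4 * d) ^ (64 * N) * 2

/-- The universal comparability constant of adjacent fundamental intervals. -/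
def uniC (N : ℕ) (d : ℝ) : ℝ := uniB N d * (2 + 4 * uniB N d) ^ 2

lemma one_le_uniB {N : ℕ} {d : ℝ} (hd : 1 < d) : 1 ≤ uniB N d := by
  unfold uniB
  have : 1 ≤ (4 * d) ^ (64 * N) := one_le_pow₀ (by linarith)
  linarith

lemma one_le_uniC {N : ℕ} {d : ℝ} (hd : 1 < d) : 1 ≤ uniC N d := by
  have h := one_le_uniB (N := N) hd
  exact one_le_mul_of_one_le_of_one_le h (one_le_pow₀ (by linarith))

lemma epsK_pos {B C d : ℝ} (hB : 1 ≤ B) (hC : 1 ≤ C) : 0 < Cfg.epsK B C d := by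
  have h2 : (0 : ℝ) < 2 ^ d := Real.rpow_pos_of_pos (by norm_num) d
  unfold Cfg.epsK Cfg.koeK Cfg.crK Cfg.endK
  positivity

lemma SlopeBd.mono_right {f : ℝ → ℝ} {K ℓ ℓ' : ℝ} (h : SlopeBd f K ℓ) (hl : ℓ' ≤ ℓ) :
    SlopeBd f K ℓ' := fun u s t v h1 h2 h3 h4 => h u s t v h1 h2 h3 (h4.trans hl)

namespace Cfg

variable {f : ℝ → ℝ} {N : ℕ} {d ρ : ℝ} {q : ℕ} {p : ℤ} {q' : ℕ} {p' : ℤ}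

lemma mv_sub_le_of_gap_le (X : Cfg f N d ρ q p q' p') {ε : ℝ} (h : ∀ x, X.gap x ≤ ε) (n : ℕ)
    (x : ℝ) : X.mv n 0 x - x ≤ n * ε := by
  induction n with
  | zero => simp
  | succ n ih =>
    have h1 := h (X.mv n 0 x)
    rw [X.gap_mv] at h1
    push_cast at h1 ⊢
    linarith

end Cfg

namespace Sys

variable {f : ℝ → ℝ} {N : ℕ} {d ρ : ℝ} {v : ℕ → ℕ × ℤ}

lemma exists_fine_of_ret_le (S : Sys f N d ρ) : ∃ ε > 0, ∀ v, Returns ρ v → ∀ n, 4 ≤ n →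
    disp ρ v n < 0 → (∀ x, S.ret v n x ≤ ε) → S.RB (-(v n).1) (v n).2 (uniC N d) ∧
    (S.RB (-(v (n + 1)).1) (v (n + 1)).2 (uniC N d) →
      ∀ X : Cfg f N d ρ (v n).1 (v n).2 (v (n + 1)).1 (v (n + 1)).2, ∃ A t ℓ,
        X.Fine (uniB N d) (uniC N d) A t ℓ ∧ A * ℓ ≤ Cfg.epsK (uniB N d) (uniC N d) d) := by
  obtain ⟨A, hA⟩ := S.exists_reg
  obtain ⟨t, ht, hs⟩ := S.exists_slopeBd
  obtain ⟨t', ht', hc⟩ := S.exists_crit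
  have hd := S.one_lt_d
  have hB := one_le_uniB (N := N) hd
  have hC := one_le_uniC (N := N) hd
  have hK := epsK_pos (d := d) hB hC
  set κ := Cfg.epsK (uniB N d) (uniC N d) d with hκ
  have hA0 := hA.nonneg
  obtain ⟨ε, hε, e1, e2, e3, e4⟩ : ∃ ε > 0, 8 * ε ≤ t ∧ 8 * ε < t' ∧ A * (8 * ε) ≤ κ ∧
      A * (32 * (8 * ε)) ≤ Real.log 2 := by
    have hl : 0 < Real.log 2 := Real.log_pos one_lt_two
    set m := min (min t t') (min κ (Real.log 2)) with hm
    have hm0 : 0 < m := by positivity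
    refine ⟨m / (512 * (1 + A)), by positivity, ?_⟩
    have m1 : m ≤ t := (min_le_left _ _).trans (min_le_left _ _)
    have m2 : m ≤ t' := (min_le_left _ _).trans (min_le_right _ _)
    have m3 : m ≤ κ := (min_le_right _ _).trans (min_le_left _ _)
    have m4 : m ≤ Real.log 2 := (min_le_right _ _).trans (min_le_right _ _)
    set δ := m / (512 * (1 + A)) with hδ
    have e : δ * (512 * (1 + A)) = m := by rw [hδ]; field_simp
    have hδ0 : 0 < δ := by positivity
    have hAδ : 0 ≤ A * δ := by positivity
    refine ⟨?_, ?_, ?_, ?_⟩ <;> linarith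
  refine ⟨ε, hε, fun v R n hn hdn hr => ?_⟩
  have win : ∀ X : Cfg f N d ρ (v n).1 (v n).2 (v (n + 1)).1 (v (n + 1)).2,
      ∀ x, X.mv 8 0 x - x ≤ 8 * ε := fun X x => by
    have := X.mv_sub_le_of_gap_le (fun x => by rw [X.gap_eq_len]; exact hr x) 8 x
    exact_mod_cast this
  have hcr : ∀ X : Cfg f N d ρ (v n).1 (v n).2 (v (n + 1)).1 (v (n + 1)).2,
      X.CR (uniB N d) := fun X => by
    have h1 := X.cr_of_slopeBd hA (by linarith) (hs.mono_right e1) (win X)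
    have h2 : Real.exp (A * (32 * (8 * ε))) ≤ 2 := by
      rw [← Real.le_log_iff_exp_le two_pos]; exact e4
    refine ⟨hB, fun a b c e m hab hbc hce he hm => (h1.2 a b c e m hab hbc hce he hm).trans ?_⟩
    refine mul_le_mul_of_nonneg_right ?_ (crossRatio_pos hab hbc hce).le
    exact mul_le_mul_of_nonneg_left h2 (by positivity)
  refine ⟨(hcr (R.cfg S hn hdn)).rb, fun hG X => ⟨A, t', 8 * ε, ⟨hcr X, hC, (hcr X).rb, ?_, hA,
    hc, win X, e2⟩, e3⟩⟩
  simpa using hG.neg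

end Sys

end MCircle

namespace MCircle

lemma Conj.reflect {f g h : ℝ → ℝ} (H : Conj f g h) :
    Conj (fun x => -f (-x)) (fun x => -g (-x)) (fun x => -h (-x)) where
  mono := fun x y hxy => neg_lt_neg (H.mono (neg_lt_neg hxy))
  surj := fun y => by
    obtain ⟨x, hx⟩ := H.surj (-y)
    exact ⟨-x, by simp [hx]⟩
  add_one := fun x => by
    have := H.add_one (-x - 1)
    rw [sub_add_cancel] at this
    change -h (-(x + 1)) = -h (-x) + 1
    rw [neg_add']
    linarith
  comm := fun x => by simp [H.comm]
  crit := fun c => by simp [Sys.deriv_reflect, H.crit]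

/-- The conjugacy `h` between `f` and `g` preserves, up to the factor `K`, the ratios of the
lengths of the returns at every level from `n₀` on. -/
structure Comparable {f g : ℝ → ℝ} {N : ℕ} {d ρ : ℝ} (S : Sys f N d ρ) (S' : Sys g N d ρ)
    (h : ℝ → ℝ) (v : ℕ → ℕ × ℤ) (K : ℝ) (n₀ : ℕ) : Prop where
  conj : Conj f g h
  ret : Returns ρ v
  rb : ∀ n, n₀ ≤ n → S.RB (-(v n).1) (v n).2 K
  rb' : ∀ n, n₀ ≤ n → S'.RB (-(v n).1) (v n).2 K
  cmp : ∀ n, n₀ ≤ n → ∀ (x : ℝ) (j : ℤ), (|(j : ℝ)| - 1) * |disp ρ v (n + 1)| < |disp ρ v n| →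
    S'.len (j * (v (n + 1)).1) (-(j * (v (n + 1)).2)) (h x) * S.ret v n x ≤
      K * (S.len (j * (v (n + 1)).1) (-(j * (v (n + 1)).2)) x * S'.ret v n (h x)) ∧
    S.len (j * (v (n + 1)).1) (-(j * (v (n + 1)).2)) x * S'.ret v n (h x) ≤
      K * (S'.len (j * (v (n + 1)).1) (-(j * (v (n + 1)).2)) (h x) * S.ret v n x)

namespace Comparable

variable {f g h : ℝ → ℝ} {N : ℕ} {d ρ K : ℝ} {S : Sys f N d ρ} {S' : Sys g N d ρ}
  {v : ℕ → ℕ × ℤ} {n₀ : ℕ}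

lemma reflect (H : Comparable S S' h v K n₀) :
    Comparable S.reflect S'.reflect (fun x => -h (-x)) (flip v) K n₀ where
  conj := H.conj.reflect
  ret := H.ret.reflect
  rb := fun n hn => (H.rb n hn).reflect
  rb' := fun n hn => (H.rb' n hn).reflect
  cmp := fun n hn x j hj => by
    rw [disp_flip, disp_flip, abs_neg, abs_neg] at hj
    have := H.cmp n hn (-x) j hj
    simp only [S.ret_reflect, S'.ret_reflect, S.len_reflect, S'.len_reflect, neg_neg]
    simpa [flip] using this

end Comparable

/-- A topological conjugacy matching the critical points preserves the ratios of returns up to a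
universal factor at all deep levels. -/
theorem exists_comparable (N : ℕ) (d : ℝ) : ∃ K, 1 ≤ K ∧ ∀ (f g h : ℝ → ℝ) (ρ : ℝ)
    (S : Sys f N d ρ) (S' : Sys g N d ρ) (v : ℕ → ℕ × ℤ), Returns ρ v → Conj f g h →
    ∃ n₀, Comparable S S' h v K n₀ := by
  obtain ⟨K₀, hK₀, cmp₀⟩ := Cfg.exists_compare (uniB N d) (uniC N d) d
  refine ⟨max K₀ (uniC N d), le_max_of_le_left hK₀, fun f g h ρ S S' v R H => ?_⟩
  have key : ∀ (f g h : ℝ → ℝ) (ρ : ℝ) (S : Sys f N d ρ) (S' : Sys g N d ρ) (v : ℕ → ℕ × ℤ),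
      Returns ρ v → Conj f g h → ∃ n₀, 4 ≤ n₀ ∧ ∀ n, n₀ ≤ n → disp ρ v n < 0 →
      S.RB (-(v n).1) (v n).2 (uniC N d) ∧ S'.RB (-(v n).1) (v n).2 (uniC N d) ∧
      (S.RB (-(v (n + 1)).1) (v (n + 1)).2 (uniC N d) →
       S'.RB (-(v (n + 1)).1) (v (n + 1)).2 (uniC N d) →
       ∀ (x : ℝ) (j : ℤ), (|(j : ℝ)| - 1) * |disp ρ v (n + 1)| < |disp ρ v n| →
    S'.len (j * (v (n + 1)).1) (-(j * (v (n + 1)).2)) (h x) * S.ret v n x ≤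
      K₀ * (S.len (j * (v (n + 1)).1) (-(j * (v (n + 1)).2)) x * S'.ret v n (h x)) ∧
    S.len (j * (v (n + 1)).1) (-(j * (v (n + 1)).2)) x * S'.ret v n (h x) ≤
      K₀ * (S'.len (j * (v (n + 1)).1) (-(j * (v (n + 1)).2)) (h x) * S.ret v n x)) := by
    intro f g h ρ S S' v R H
    obtain ⟨ε, hε, F⟩ := S.exists_fine_of_ret_le
    obtain ⟨ε', hε', F'⟩ := S'.exists_fine_of_ret_le
    obtain ⟨n₁, hn₁, r₁⟩ := S.exists_ret_le R hε
    obtain ⟨n₂, hn₂, r₂⟩ := S'.exists_ret_le R hε'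
    refine ⟨max n₁ n₂, le_max_of_le_left hn₁, fun n hn hd => ?_⟩
    have hn1 := le_of_max_le_left hn
    have hn2 := le_of_max_le_right hn
    obtain ⟨a1, a2⟩ := F v R n (hn₁.trans hn1) hd (r₁ n hn1)
    obtain ⟨b1, b2⟩ := F' v R n (hn₁.trans hn1) hd (r₂ n hn2)
    refine ⟨a1, b1, fun c1 c2 x j hj => ?_⟩
    have X := R.cfg S (hn₁.trans hn1) hd
    have Y := R.cfg S' (hn₁.trans hn1) hd
    obtain ⟨A, t, l, FX, hA⟩ := a2 c1 X
    obtain ⟨A', t', l', FY, hA'⟩ := b2 c2 Y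
    have hmul := R.mul_neg n
    have hp : 0 < disp ρ v (n + 1) := by by_contra hc; nlinarith
    have := cmp₀ f g h N ρ _ _ _ _ X Y A t l A' t' l' FX hA FY hA' H x j (by
      rw [abs_of_pos hp, abs_of_neg hd] at hj
      unfold Cfg.α Cfg.β
      unfold disp at hj
      linarith)
    rw [X.gap_eq_len, Y.gap_eq_len] at this
    simpa [Cfg.mv, Sys.len, Sys.ret] using this
  obtain ⟨n₁, hn₁, k₁⟩ := key f g h ρ S S' v R H
  obtain ⟨n₂, hn₂, k₂⟩ := key _ _ _ _ S.reflect S'.reflect (flip v) R.reflect H.reflect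
  have rb : ∀ n, max n₁ n₂ ≤ n →
      S.RB (-(v n).1) (v n).2 (uniC N d) ∧ S'.RB (-(v n).1) (v n).2 (uniC N d) := by
    intro n hn
    rcases lt_or_gt_of_ne (R.disp_ne_zero n) with hd | hd
    · have := k₁ n (le_of_max_le_left hn) hd
      exact ⟨this.1, this.2.1⟩
    · have := k₂ n (le_of_max_le_right hn) (by rw [disp_flip]; linarith)
      exact ⟨by simpa [flip] using this.1.of_reflect, by simpa [flip] using this.2.1.of_reflect⟩
  refine ⟨max n₁ n₂, H, R, fun n hn => (rb n hn).1.mono (le_max_right _ _),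
    fun n hn => (rb n hn).2.mono (le_max_right _ _), fun n hn x j hj => ?_⟩
  obtain ⟨c1, c2⟩ := rb (n + 1) (by omega)
  suffices hs : S'.len (j * (v (n + 1)).1) (-(j * (v (n + 1)).2)) (h x) * S.ret v n x ≤
      K₀ * (S.len (j * (v (n + 1)).1) (-(j * (v (n + 1)).2)) x * S'.ret v n (h x)) ∧
    S.len (j * (v (n + 1)).1) (-(j * (v (n + 1)).2)) x * S'.ret v n (h x) ≤
      K₀ * (S'.len (j * (v (n + 1)).1) (-(j * (v (n + 1)).2)) (h x) * S.ret v n x) from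
    ⟨hs.1.trans (mul_le_mul_of_nonneg_right (le_max_left _ _)
      (mul_nonneg (abs_nonneg _) (abs_nonneg _))),
     hs.2.trans (mul_le_mul_of_nonneg_right (le_max_left _ _)
      (mul_nonneg (abs_nonneg _) (abs_nonneg _)))⟩
  rcases lt_or_gt_of_ne (R.disp_ne_zero n) with hd | hd
  · exact (k₁ n (le_of_max_le_left hn) hd).2.2 c1 c2 x j hj
  · have := (k₂ n (le_of_max_le_right hn) (by rw [disp_flip]; linarith)).2.2
      (c1.reflect) (c2.reflect) (-x) j (by rwa [disp_flip, disp_flip, abs_neg, abs_neg])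
    simp only [S.ret_reflect, S'.ret_reflect, S.len_reflect, S'.len_reflect, neg_neg] at this
    simpa [flip] using this

end MCircle

namespace MCircle

/-- The sign of the displacement of the `n`-th closest return. -/
def dispSign (ρ : ℝ) (v : ℕ → ℕ × ℤ) (n : ℕ) : ℤ := if 0 < disp ρ v n then 1 else -1

lemma dispSign_mul_disp (ρ : ℝ) (v : ℕ → ℕ × ℤ) (n : ℕ) :
    (dispSign ρ v n : ℝ) * disp ρ v n = |disp ρ v n| := by
  unfold dispSign
  split_ifs with h
  · simp [abs_of_pos h]
  · simp [abs_of_nonpos (not_lt.1 h)]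

lemma abs_dispSign (ρ : ℝ) (v : ℕ → ℕ × ℤ) (n : ℕ) : |(dispSign ρ v n : ℝ)| = 1 := by
  unfold dispSign
  split_ifs <;> simp

lemma Returns.abs_pos {ρ : ℝ} {v : ℕ → ℕ × ℤ} (R : Returns ρ v) (n : ℕ) : 0 < |disp ρ v n| :=
  _root_.abs_pos.2 (R.disp_ne_zero n)

namespace Sys

variable {f : ℝ → ℝ} {N : ℕ} {d ρ K : ℝ} {v : ℕ → ℕ × ℤ}

/-- The `n`-th closest return, iterated `j` times towards the right. -/
def rt (S : Sys f N d ρ) (v : ℕ → ℕ × ℤ) (n : ℕ) (j : ℤ) (x : ℝ) : ℝ :=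
  S.Φ (j * dispSign ρ v n * (v n).1) (-(j * dispSign ρ v n * (v n).2)) x

lemma rt_disp (ρ : ℝ) (v : ℕ → ℕ × ℤ) (n : ℕ) (j : ℤ) :
    ((j * dispSign ρ v n * (v n).1 : ℤ) : ℝ) * ρ + ((-(j * dispSign ρ v n * (v n).2) : ℤ) : ℝ) =
      j * |disp ρ v n| := by
  rw [← dispSign_mul_disp]
  unfold disp
  push_cast; ring

lemma rt_zero (S : Sys f N d ρ) (n : ℕ) (x : ℝ) : S.rt v n 0 x = x := by simp [rt]

lemma rt_rt (S : Sys f N d ρ) (n : ℕ) (i j : ℤ) (x : ℝ) :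
    S.rt v n i (S.rt v n j x) = S.rt v n (i + j) x := by
  unfold rt
  rw [S.Φ_Φ]
  congr 1 <;> ring

lemma rt_lt_rt_iff (S : Sys f N d ρ) {n m : ℕ} {i j : ℤ} {x : ℝ} :
    S.rt v n i x < S.rt v m j x ↔ i * |disp ρ v n| < j * |disp ρ v m| := by
  unfold rt
  rw [S.Φ_lt_Φ_iff, rt_disp, rt_disp]

lemma rt_le_rt_iff (S : Sys f N d ρ) {n m : ℕ} {i j : ℤ} {x : ℝ} :
    S.rt v n i x ≤ S.rt v m j x ↔ i * |disp ρ v n| ≤ j * |disp ρ v m| := by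
  rw [← not_lt, S.rt_lt_rt_iff, not_lt]

lemma le_rt (S : Sys f N d ρ) (n : ℕ) {j : ℤ} (hj : 0 ≤ j) (x : ℝ) : x ≤ S.rt v n j x := by
  have : S.rt v n 0 x ≤ S.rt v n j x := S.rt_le_rt_iff.2 (by
    have : (0 : ℝ) ≤ j := by exact_mod_cast hj
    push_cast; rw [zero_mul]; positivity)
  rwa [rt_zero] at this

lemma len_eq_rt_sub (S : Sys f N d ρ) (n : ℕ) {j : ℤ} (hj : 0 ≤ j) (x : ℝ) :
    S.len (j * dispSign ρ v n * (v n).1) (-(j * dispSign ρ v n * (v n).2)) x =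
      S.rt v n j x - x :=
  abs_of_nonneg (sub_nonneg.2 (S.le_rt n hj x))

lemma rb_rt (S : Sys f N d ρ) {n : ℕ} (h : S.RB (-(v n).1) (v n).2 K) :
    S.RB (1 * dispSign ρ v n * (v n).1) (-(1 * dispSign ρ v n * (v n).2)) K := by
  unfold dispSign
  split_ifs
  · simpa using h.neg
  · simpa using h

lemma ret_comparable_rt (S : Sys f N d ρ) (hK : 1 ≤ K) {n : ℕ} (h : S.RB (-(v n).1) (v n).2 K)
    (x : ℝ) : S.ret v n x ≤ K * (S.rt v n 1 x - x) ∧ S.rt v n 1 x - x ≤ K * S.ret v n x := by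
  rw [← S.len_eq_rt_sub n zero_le_one]
  unfold ret dispSign
  split_ifs
  · have h1 := S.len_neg (v n).1 (-(v n).2) x
    have h2 := h (S.Φ (v n).1 (-(v n).2) x)
    rw [S.Φ_Φ] at h2
    rw [neg_neg] at h1
    rw [h1] at h2
    simpa using h2
  · have h0 : 0 ≤ S.len (-(v n).1) (v n).2 x := abs_nonneg _
    simp only [one_mul, neg_mul, neg_neg]
    constructor <;> nlinarith

lemma ret_le_of_le (S : Sys f N d ρ) (R : Returns ρ v) (hK : 1 ≤ K) {n m : ℕ} (hnm : n ≤ m)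
    (hn : S.RB (-(v n).1) (v n).2 K) (hm : S.RB (-(v m).1) (v m).2 K) (x : ℝ) :
    S.ret v m x ≤ K ^ 2 * S.ret v n x := by
  have ha : |disp ρ v m| ≤ |disp ρ v n| :=
    antitone_nat_of_succ_le (f := fun n => |disp ρ v n|) (fun n => (R.abs_lt n).le) hnm
  have h1 : S.rt v m 1 x ≤ S.rt v n 1 x := S.rt_le_rt_iff.2 (by push_cast; linarith)
  have h2 := (S.ret_comparable_rt hK hm x).1
  have h3 := (S.ret_comparable_rt hK hn x).2
  nlinarith

lemma rt_succ_sub_le (S : Sys f N d ρ) (hK : 1 ≤ K) {n : ℕ} (h : S.RB (-(v n).1) (v n).2 K)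
    {j : ℤ} (hj : 1 ≤ j) (x : ℝ) : S.rt v n (j + 1) x - x ≤ (1 + K) * (S.rt v n j x - x) := by
  have h1 := (S.rb_rt h (S.rt v n (j - 1) x)).1
  rw [S.len_eq_rt_sub n zero_le_one, S.len_eq_rt_sub n zero_le_one] at h1
  change S.rt v n 1 (S.rt v n 1 (S.rt v n (j - 1) x)) - S.rt v n 1 (S.rt v n (j - 1) x) ≤ _ at h1
  rw [S.rt_rt n 1 (j - 1), show 1 + (j - 1) = j by ring, S.rt_rt, add_comm 1 j] at h1
  have h2 := S.le_rt (v := v) n (show 0 ≤ j - 1 by linarith) x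
  nlinarith

end Sys

namespace Comparable

variable {f g h : ℝ → ℝ} {N : ℕ} {d ρ K : ℝ} {S : Sys f N d ρ} {S' : Sys g N d ρ}
  {v : ℕ → ℕ × ℤ} {n₀ : ℕ}

lemma map_rt (H : Comparable S S' h v K n₀) (n : ℕ) (j : ℤ) (x : ℝ) :
    h (S.rt v n j x) = S'.rt v n j (h x) :=
  S.Φ_conj S' H.conj.add_one H.conj.comm _ _ x

/-- Right translations of `x` are mapped by `h` with a factor given by the return lengths. -/
lemma right_bound (H : Comparable S S' h v K n₀) (hK : 1 ≤ K) (x : ℝ) :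
    ∃ δ > 0, ∀ t, 0 < t → t < δ → ∃ n, n₀ ≤ n ∧ S.ret v (n + 1) x ≤ K * t ∧ t ≤ K * S.ret v n x ∧
      t * S'.ret v n (h x) ≤ K * (1 + K) * ((h (x + t) - h x) * S.ret v n x) ∧
      (h (x + t) - h x) * S.ret v n x ≤ K * (1 + K) * (t * S'.ret v n (h x)) := by
  have R := H.ret
  refine ⟨S.rt v n₀ 1 x - x, ?_, fun t ht htδ => ?_⟩
  · have : S.rt v n₀ 0 x < S.rt v n₀ 1 x := S.rt_lt_rt_iff.2 (by simpa using R.disp_ne_zero n₀)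
    rw [S.rt_zero] at this
    linarith
  have hex : ∃ k, S.rt v (n₀ + k) 1 x ≤ x + t := by
    obtain ⟨n₁, -, h₁⟩ := S.exists_ret_le R (show 0 < t / K by positivity)
    refine ⟨n₁, ?_⟩
    have h2 := (S.ret_comparable_rt hK (H.rb (n₀ + n₁) (by omega)) x).2
    have h3 := h₁ (n₀ + n₁) (by omega) x
    rw [le_div_iff₀ (by linarith)] at h3
    linarith
  classical
  obtain ⟨n, hn, h1, h2⟩ : ∃ n, n₀ ≤ n ∧ x + t < S.rt v n 1 x ∧ S.rt v (n + 1) 1 x ≤ x + t := by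
    have hs := Nat.find_spec hex
    have hm := fun k => Nat.find_min hex (m := k)
    cases hk : Nat.find hex with
    | zero =>
      rw [hk] at hs
      simp only [add_zero] at hs
      linarith
    | succ k =>
      rw [hk] at hs
      exact ⟨n₀ + k, by omega, not_le.1 (hm k (by omega)), hs⟩
  have hex' : ∃ j : ℕ, x + t < S.rt v (n + 1) ((j : ℤ) + 1) x := by
    obtain ⟨j, hj⟩ := exists_nat_gt (|disp ρ v n| / |disp ρ v (n + 1)|)
    rw [div_lt_iff₀ (R.abs_pos _)] at hj
    refine ⟨j, h1.trans (S.rt_lt_rt_iff.2 ?_)⟩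
    have := R.abs_pos (n + 1)
    push_cast
    linarith
  obtain ⟨j, hj, h3, h4⟩ : ∃ j : ℤ, 1 ≤ j ∧ S.rt v (n + 1) j x ≤ x + t ∧
      x + t < S.rt v (n + 1) (j + 1) x := by
    have hs := Nat.find_spec hex'
    have hm := fun k => Nat.find_min hex' (m := k)
    cases hk : Nat.find hex' with
    | zero =>
      rw [hk] at hs
      simp only [Nat.cast_zero, zero_add] at hs
      linarith
    | succ k =>
      rw [hk] at hs
      exact ⟨(k + 1 : ℕ), by omega, by simpa using hm k (by omega), hs⟩
  have hadm : (j : ℝ) * |disp ρ v (n + 1)| < |disp ρ v n| := by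
    have := S.rt_lt_rt_iff.1 (h3.trans_lt h1)
    push_cast at this
    linarith
  have hj0 : (1 : ℝ) ≤ j := by exact_mod_cast hj
  have hcmp := H.cmp n hn x (j * dispSign ρ v (n + 1)) (by
    push_cast
    rw [abs_mul, abs_dispSign, abs_of_nonneg (by linarith)]
    have := R.abs_pos (n + 1)
    linarith)
  rw [S.len_eq_rt_sub _ (by linarith), S'.len_eq_rt_sub _ (by linarith)] at hcmp
  have g1 := S.rt_succ_sub_le hK (H.rb (n + 1) (by omega)) hj x
  have g2 := S'.rt_succ_sub_le hK (H.rb' (n + 1) (by omega)) hj (h x)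
  have m1 := H.conj.mono.monotone h3
  have m2 := H.conj.mono.monotone h4.le
  rw [H.map_rt] at m1 m2
  have p1 := S.ret_pos R n x
  have p2 := S'.ret_pos R n (h x)
  refine ⟨n, hn, ?_, ?_, ?_, ?_⟩
  · have := (S.ret_comparable_rt hK (H.rb (n + 1) (by omega)) x).1
    exact this.trans (mul_le_mul_of_nonneg_left (by linarith) (by linarith))
  · have := (S.ret_comparable_rt hK (H.rb n hn) x).2
    linarith
  · calc t * S'.ret v n (h x) ≤ (1 + K) * (S.rt v (n + 1) j x - x) * S'.ret v n (h x) :=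
          mul_le_mul_of_nonneg_right (by linarith) p2.le
      _ = (1 + K) * ((S.rt v (n + 1) j x - x) * S'.ret v n (h x)) := by ring
      _ ≤ (1 + K) * (K * ((S'.rt v (n + 1) j (h x) - h x) * S.ret v n x)) :=
          mul_le_mul_of_nonneg_left hcmp.2 (by linarith)
      _ ≤ (1 + K) * (K * ((h (x + t) - h x) * S.ret v n x)) := by
          refine mul_le_mul_of_nonneg_left ?_ (by linarith)
          refine mul_le_mul_of_nonneg_left ?_ (by linarith)
          exact mul_le_mul_of_nonneg_right (by linarith) p1.le
      _ = _ := by ring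
  · calc (h (x + t) - h x) * S.ret v n x
          ≤ (1 + K) * (S'.rt v (n + 1) j (h x) - h x) * S.ret v n x :=
          mul_le_mul_of_nonneg_right (by linarith) p1.le
      _ = (1 + K) * ((S'.rt v (n + 1) j (h x) - h x) * S.ret v n x) := by ring
      _ ≤ (1 + K) * (K * ((S.rt v (n + 1) j x - x) * S'.ret v n (h x))) :=
          mul_le_mul_of_nonneg_left hcmp.1 (by linarith)
      _ ≤ (1 + K) * (K * (t * S'.ret v n (h x))) := by
          refine mul_le_mul_of_nonneg_left ?_ (by linarith)
          refine mul_le_mul_of_nonneg_left ?_ (by linarith)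
          exact mul_le_mul_of_nonneg_right (by linarith) p2.le
      _ = _ := by ring

lemma left_bound (H : Comparable S S' h v K n₀) (hK : 1 ≤ K) (x : ℝ) :
    ∃ δ > 0, ∀ t, 0 < t → t < δ → ∃ n, n₀ ≤ n ∧ S.ret v (n + 1) x ≤ K * t ∧ t ≤ K * S.ret v n x ∧
      t * S'.ret v n (h x) ≤ K * (1 + K) * ((h x - h (x - t)) * S.ret v n x) ∧
      (h x - h (x - t)) * S.ret v n x ≤ K * (1 + K) * (t * S'.ret v n (h x)) := by
  obtain ⟨δ, hδ, hb⟩ := H.reflect.right_bound hK (-x)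
  refine ⟨δ, hδ, fun t ht htδ => ?_⟩
  have := hb t ht htδ
  simp only [S.ret_reflect, S'.ret_reflect, neg_neg] at this
  have e : -h (-(-x + t)) - -h x = h x - h (x - t) := by
    rw [show -(-x + t) = x - t by ring]; ring
  simpa only [e] using this

lemma ret_ratio_succ (H : Comparable S S' h v K n₀) {n : ℕ} (hn : n₀ ≤ n) (x : ℝ) :
    S'.ret v (n + 1) (h x) * S.ret v n x ≤ K * (S.ret v (n + 1) x * S'.ret v n (h x)) ∧
    S.ret v (n + 1) x * S'.ret v n (h x) ≤ K * (S'.ret v (n + 1) (h x) * S.ret v n x) := by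
  have := H.cmp n hn x (-1) (by simpa using H.ret.disp_ne_zero n)
  simpa [Sys.ret] using this

lemma ret_ratio (H : Comparable S S' h v K n₀) (hK : 1 ≤ K) {n : ℕ} (hn : n₀ ≤ n) (k : ℕ) (x : ℝ) :
    S'.ret v (n + k) (h x) * S.ret v n x ≤ K ^ k * (S.ret v (n + k) x * S'.ret v n (h x)) ∧
    S.ret v (n + k) x * S'.ret v n (h x) ≤ K ^ k * (S'.ret v (n + k) (h x) * S.ret v n x) := by
  induction k with
  | zero => simp [mul_comm]
  | succ k ih =>
    obtain ⟨s1, s2⟩ := H.ret_ratio_succ (n := n + k) (by omega) x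
    obtain ⟨i1, i2⟩ := ih
    have b0 := S.ret_pos H.ret (n + k) x
    have b0' := S'.ret_pos H.ret (n + k) (h x)
    have a0 := S.ret_pos H.ret n x
    have a0' := S'.ret_pos H.ret n (h x)
    have c0 := S.ret_pos H.ret (n + k + 1) x
    have c0' := S'.ret_pos H.ret (n + k + 1) (h x)
    rw [← add_assoc, pow_succ]
    generalize S.ret v (n + k) x = b at *
    generalize S'.ret v (n + k) (h x) = b' at *
    generalize S.ret v n x = a at *
    generalize S'.ret v n (h x) = a' at *
    generalize S.ret v (n + k + 1) x = c at *
    generalize S'.ret v (n + k + 1) (h x) = c' at *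
    constructor
    · refine le_of_mul_le_mul_right ?_ b0
      calc c' * a * b = a * (c' * b) := by ring
        _ ≤ a * (K * (c * b')) := mul_le_mul_of_nonneg_left s1 a0.le
        _ = K * c * (b' * a) := by ring
        _ ≤ K * c * (K ^ k * (b * a')) := mul_le_mul_of_nonneg_left i1 (by positivity)
        _ = _ := by ring
    · refine le_of_mul_le_mul_right ?_ b0'
      calc c * a' * b' = a' * (c * b') := by ring
        _ ≤ a' * (K * (c' * b)) := mul_le_mul_of_nonneg_left s2 a0'.le
        _ = K * c' * (b * a') := by ring
        _ ≤ K * c' * (K ^ k * (b' * a)) := mul_le_mul_of_nonneg_left i2 (by positivity)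
        _ = _ := by ring

lemma ret_ratio_of_le (H : Comparable S S' h v K n₀) (hK : 1 ≤ K) {n m D : ℕ} (hn : n₀ ≤ n)
    (hm : n₀ ≤ m) (hnm : n ≤ m + D) (hmn : m ≤ n + D) (x : ℝ) :
    S'.ret v n (h x) * S.ret v m x ≤ K ^ D * (S.ret v n x * S'.ret v m (h x)) := by
  have a0 := S.ret_pos H.ret n x
  have a0' := S'.ret_pos H.ret m (h x)
  rcases le_total n m with hle | hle
  · obtain ⟨k, rfl⟩ := Nat.exists_eq_add_of_le hle
    have := (H.ret_ratio hK hn k x).2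
    rw [mul_comm, mul_comm (S.ret v n x)]
    exact this.trans (mul_le_mul_of_nonneg_right (pow_le_pow_right₀ hK (by omega)) (by positivity))
  · obtain ⟨k, rfl⟩ := Nat.exists_eq_add_of_le hle
    have := (H.ret_ratio hK hm k x).1
    exact this.trans (mul_le_mul_of_nonneg_right (pow_le_pow_right₀ hK (by omega)) (by positivity))

/-- Comparable returns have comparable levels. -/
lemma level_le (H : Comparable S S' h v K n₀) (hK : 1 ≤ K) {s : ℕ}
    (hs : (K / (1 + K)) ^ s ≤ 1 / (2 * K ^ 4)) {n m : ℕ} (hn : n₀ ≤ n) {x : ℝ}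
    (hnm : S.ret v (n + 1) x ≤ K ^ 2 * S.ret v m x) : m ≤ n + 2 * s := by
  by_contra hc
  obtain ⟨r, rfl⟩ := Nat.exists_eq_add_of_lt (not_le.1 hc)
  have h1 := S.ret_add_le H.ret hK H.rb (n := n + r + 1) (by omega) s x
  rw [show n + r + 1 + 2 * s = n + 2 * s + r + 1 by ring] at h1
  have h2 := S.ret_le_of_le H.ret hK (show n + 1 ≤ n + r + 1 by omega) (H.rb _ (by omega))
    (H.rb _ (by omega)) x
  have p := S.ret_pos H.ret (n + 2 * s + r + 1) x
  have p2 := S.ret_nonneg v (n + r + 1) x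
  have hK4 : 0 < K ^ 4 := by positivity
  have : S.ret v (n + 2 * s + r + 1) x ≤ 1 / 2 * S.ret v (n + 2 * s + r + 1) x := by
    calc _ ≤ _ := h1
      _ ≤ 1 / (2 * K ^ 4) * S.ret v (n + r + 1) x := mul_le_mul_of_nonneg_right hs p2
      _ ≤ 1 / (2 * K ^ 4) * (K ^ 2 * (K ^ 2 * S.ret v (n + 2 * s + r + 1) x)) := by
          refine mul_le_mul_of_nonneg_left (h2.trans ?_) (by positivity)
          exact mul_le_mul_of_nonneg_left hnm (by positivity)
      _ = _ := by field_simp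
  linarith

/-- The images under `h` of adjacent small intervals of equal length are comparable. -/
lemma exists_quasisymmetric (H : Comparable S S' h v K n₀) (hK : 1 ≤ K) {s : ℕ}
    (hs : (K / (1 + K)) ^ s ≤ 1 / (2 * K ^ 4)) (x : ℝ) :
    ∃ δ > 0, ∀ t, 0 < t → t < δ →
      h (x + t) - h x ≤ (K * (1 + K)) ^ 2 * K ^ (2 * s) * (h x - h (x - t)) ∧
      h x - h (x - t) ≤ (K * (1 + K)) ^ 2 * K ^ (2 * s) * (h (x + t) - h x) := by
  obtain ⟨δ, hδ, hr⟩ := H.right_bound hK x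
  obtain ⟨δ', hδ', hl⟩ := H.left_bound hK x
  refine ⟨min δ δ', lt_min hδ hδ', fun t ht htδ => ?_⟩
  obtain ⟨n, hn, n1, n2, n3, n4⟩ := hr t ht (htδ.trans_le (min_le_left _ _))
  obtain ⟨m, hm, m1, m2, m3, m4⟩ := hl t ht (htδ.trans_le (min_le_right _ _))
  have hnm : n ≤ m + 2 * s := H.level_le hK hs hm (m1.trans (by nlinarith))
  have hmn : m ≤ n + 2 * s := H.level_le hK hs hn (n1.trans (by nlinarith))
  have r1 := H.ret_ratio_of_le hK hn hm hnm hmn x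
  have r2 := H.ret_ratio_of_le hK hm hn hmn hnm x
  have a := S.ret_pos H.ret n x
  have a' := S'.ret_pos H.ret n (h x)
  have b := S.ret_pos H.ret m x
  have b' := S'.ret_pos H.ret m (h x)
  have u0 : 0 < h (x + t) - h x := sub_pos.2 (H.conj.mono (by linarith))
  have w0 : 0 < h x - h (x - t) := sub_pos.2 (H.conj.mono (by linarith))
  generalize S.ret v n x = A at *
  generalize S'.ret v n (h x) = A' at *
  generalize S.ret v m x = B at *
  generalize S'.ret v m (h x) = B' at *
  generalize h (x + t) - h x = u at *
  generalize h x - h (x - t) = w at *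
  have hM : 0 < K * (1 + K) := by positivity
  generalize K * (1 + K) = M at *
  constructor
  · refine le_of_mul_le_mul_right ?_ (mul_pos a b')
    calc u * (A * B') = B' * (u * A) := by ring
      _ ≤ B' * (M * (t * A')) := mul_le_mul_of_nonneg_left n4 b'.le
      _ = M * A' * (t * B') := by ring
      _ ≤ M * A' * (M * (w * B)) := mul_le_mul_of_nonneg_left m3 (by positivity)
      _ = M ^ 2 * w * (A' * B) := by ring
      _ ≤ M ^ 2 * w * (K ^ (2 * s) * (A * B')) := mul_le_mul_of_nonneg_left r1 (by positivity)
      _ = _ := by ring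
  · refine le_of_mul_le_mul_right ?_ (mul_pos b a')
    calc w * (B * A') = A' * (w * B) := by ring
      _ ≤ A' * (M * (t * B')) := mul_le_mul_of_nonneg_left m4 a'.le
      _ = M * B' * (t * A') := by ring
      _ ≤ M * B' * (M * (u * A)) := mul_le_mul_of_nonneg_left n3 (by positivity)
      _ = M ^ 2 * u * (B' * A) := by ring
      _ ≤ M ^ 2 * u * (K ^ (2 * s) * (B * A')) := mul_le_mul_of_nonneg_left r2 (by positivity)
      _ = _ := by ring

end Comparable

lemma qsDistortion_le {h : ℝ → ℝ} (hm : StrictMono h) {Q x δ : ℝ} (hδ : 0 < δ)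
    (hQ : ∀ t, 0 < t → t < δ → h (x + t) - h x ≤ Q * (h x - h (x - t)) ∧
      h x - h (x - t) ≤ Q * (h (x + t) - h x)) : qsDistortion h x ≤ ENNReal.ofReal Q := by
  unfold qsDistortion
  refine Filter.limsup_le_of_le (h := ?_)
  have hev : ∀ᶠ t in 𝓝[≠] (0 : ℝ), t ∈ Ioo (-δ) δ :=
    mem_nhdsWithin_of_mem_nhds (Ioo_mem_nhds (by linarith) hδ)
  filter_upwards [hev, self_mem_nhdsWithin] with t ht ht0
  refine ENNReal.ofReal_le_ofReal ?_
  rcases lt_or_gt_of_ne (show t ≠ 0 from ht0) with h0 | h0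
  · obtain ⟨-, h2⟩ := hQ (-t) (by linarith) (by linarith [ht.1])
    rw [sub_neg_eq_add, ← sub_eq_add_neg] at h2
    have u0 : h (x + t) < h x := hm (by linarith)
    have w0 : h x < h (x - t) := hm (by linarith)
    rw [abs_of_neg (by linarith), abs_of_neg (by linarith), div_le_iff₀ (by linarith)]
    linarith
  · obtain ⟨h1, -⟩ := hQ t h0 ht.2
    have u0 : h x < h (x + t) := hm (by linarith)
    have w0 : h (x - t) < h x := hm (by linarith)
    rw [abs_of_pos (by linarith), abs_of_pos (by linarith), div_le_iff₀ (by linarith)]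
    linarith

/-- A conjugacy mapping critical points to critical points matches the critical sets. -/
lemma conj_of_goodMap {f g h : ℝ → ℝ} {Cf Cg : Finset ℝ} {dcf dcg : ℝ → ℝ} {ρ : ℝ}
    (hf : GoodMap f Cf dcf ρ) (hg : GoodMap g Cg dcg ρ) (hcard : Cf.card = Cg.card)
    (hc : Continuous h) (hm : StrictMono h) (h1 : ∀ x, h (x + 1) = h x + 1)
    (hfg : ∀ x, h (f x) = g (h x)) (hC : ∀ c ∈ Cf, ∃ c' ∈ Cg, SameCirclePt (h c) c') :
    Conj f g h := by
  have h_int := add_int_of_add_one h1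
  have hsurj : Function.Surjective h := by
    intro y
    obtain ⟨n, hn⟩ := exists_int_lt (y - h 0)
    obtain ⟨m, hm'⟩ := exists_int_gt (y - h 0)
    have e1 : h n = h 0 + n := by simpa using h_int 0 n
    have e2 : h m = h 0 + m := by simpa using h_int 0 m
    have hnm : (n : ℝ) ≤ m := by linarith
    obtain ⟨x, -, hx⟩ := intermediate_value_Icc hnm hc.continuousOn
      (show y ∈ Icc (h n) (h m) by constructor <;> linarith)
    exact ⟨x, hx⟩
  obtain ⟨-, -, hIf, hf0, -⟩ := hf.1
  obtain ⟨-, -, hIg, hg0, -⟩ := hg.1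
  choose! F hF hF' using hC
  have inj : Set.InjOn F Cf := by
    intro a ha b hb hab
    obtain ⟨m, hm'⟩ := hF' a ha
    obtain ⟨n, hn⟩ := hF' b hb
    rw [hab] at hm'
    have e : h (a + (n - m : ℤ)) = h b := by
      rw [h_int, hm', hn]; push_cast; ring
    have e2 := hm.injective e
    have ha' := hIf ha
    have hb' := hIf hb
    have l1 : ((n - m : ℤ) : ℝ) < (1 : ℤ) := by push_cast at *; linarith [ha'.1, hb'.2]
    have l2 : ((-1 : ℤ) : ℝ) < ((n - m : ℤ) : ℝ) := by push_cast at *; linarith [ha'.2, hb'.1]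
    have l1' := Int.cast_lt.1 l1
    have l2' := Int.cast_lt.1 l2
    have : n - m = 0 := by omega
    rw [this] at e2
    simpa using e2
  have surj := Finset.surjOn_of_injOn_of_card_le F hF inj hcard.ge
  refine ⟨hm, hsurj, h1, hfg, fun c => ?_⟩
  rw [hf0, hg0]
  constructor
  · rintro ⟨a, ha, k, rfl⟩
    obtain ⟨m, hm'⟩ := hF' a ha
    exact ⟨F a, hF a ha, m + k, by rw [h_int, hm']; push_cast; ring⟩
  · rintro ⟨b, hb, k, hk⟩
    obtain ⟨a, ha, rfl⟩ := surj hb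
    obtain ⟨m, hm'⟩ := hF' a ha
    refine ⟨a, ha, k - m, hm.injective ?_⟩
    rw [h_int, hk, hm']
    push_cast; ring

end MCircle

/-- **Universally bounded quasi-symmetric distortion of conjugacies** (Corollary 1.2).
If `f, g` are multicritical circle maps with the same irrational rotation number and
the same number `N` of critical points, all of criticality at most `d`, and `h` is a
topological conjugacy between `f` and `g` mapping critical points of `f` to critical
points of `g`, then `h` is quasi-symmetric with local quasi-symmetric distortion
bounded by a universal constant `K = K(N,d) > 1`: `σ_h(x) ≤ K` for all `x ∈ S¹`. -/
theorem conjugacy_qs_universal (N : ℕ) (hN : 1 ≤ N) (d : ℝ) (hd : 1 < d) :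
    ∃ K : ℝ, 1 < K ∧
      ∀ (f g h : ℝ → ℝ) (Cf Cg : Finset ℝ) (dcf dcg : ℝ → ℝ) (ρ : ℝ),
        GoodMap f Cf dcf ρ → GoodMap g Cg dcg ρ →
        Cf.card = N → Cg.card = N →
        (∀ c ∈ Cf, dcf c ≤ d) → (∀ c ∈ Cg, dcg c ≤ d) →
        Continuous h → StrictMono h → (∀ x : ℝ, h (x + 1) = h x + 1) →
        (∀ x : ℝ, h (f x) = g (h x)) →
        (∀ c ∈ Cf, ∃ c' ∈ Cg, SameCirclePt (h c) c') →
        ∀ x : ℝ, qsDistortion h x ≤ ENNReal.ofReal K := by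
  obtain ⟨K, hK, hcmp⟩ := exists_comparable N d
  obtain ⟨s, hs⟩ := Sys.exists_pow_le hK (show 0 < 1 / (2 * K ^ 4) by positivity)
  refine ⟨(K * (1 + K)) ^ 2 * K ^ (2 * s), ?_, ?_⟩
  · have h1 : 1 < (K * (1 + K)) ^ 2 := one_lt_pow₀ (by nlinarith) two_ne_zero
    exact one_lt_mul_of_lt_of_le h1 (one_le_pow₀ hK)
  intro f g h Cf Cg dcf dcg ρ hf hg hfN hgN hdf hdg hc hm h1 hfg hC x
  have S := hf.sys hfN.le hdf
  have S' := hg.sys hgN.le hdg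
  obtain ⟨v, hv, hv'⟩ := exists_returns S.irr
  obtain ⟨n₀, H⟩ := hcmp f g h ρ S S' v ⟨S.irr, hv, hv'⟩
    (conj_of_goodMap hf hg (hfN.trans hgN.symm) hc hm h1 hfg hC)
  obtain ⟨δ, hδ, hq⟩ := H.exists_quasisymmetric hK hs x
  exact qsDistortion_le hm hδ hq
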